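/- arXiv:alg-geom/9610009 — 2 statements merged into one kernel-verified Lean document; each statement's English description precedes it below -/
import Mathlib

section
/- Let k be an algebraically closed field of odd characteristic p, and let f ∈ k[x,y,z] be a homogeneous polynomial of degree 3 such that f and its three partial derivatives have no common zero in k³ other than (0,0,0). Then for every q = pⁿ with n ≥ 1, the socle degree of the artinian ring k[x,y,z]/(f, x^q, y^q, z^q) equals (3q − 1)/2; that is, there exists a homogeneous polynomial of degree (3q−1)/2 not lying in the ideal (f, x^q, y^q, z^q), while every homogeneous polynomial of degree strictly greater than (3q−1)/2 lies in this ideal. -/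
open MvPolynomial

/-- The values at the point `x` of the forms of degree `N` in three variables. -/
noncomputable def formValues {k K : Type*} [Field k] [Field K] [Algebra k K] (x : Fin 3 → K)
    (N : ℕ) : Submodule k K :=
  (homogeneousSubmodule (Fin 3) k N).map (aeval x).toLinearMap

/-- `K` is the function field of the smooth plane cubic `f = 0`, with `x` its generic point
normalized by `x 2 = 1`, and `D` is its invariant derivation. -/
structure IsCubicFunctionField {k K : Type*} [Field k] [Field K] [Algebra k K]
    (f : MvPolynomial (Fin 3) k) (x : Fin 3 → K) (D : Derivation k K K) : Prop where
  isHomogeneous : f.IsHomogeneous 3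
  smooth : ∀ a : Fin 3 → k, eval a f = 0 → (∀ i : Fin 3, eval a (pderiv i f) = 0) → a = 0
  apply_two : x 2 = 1
  adjoin_eq_top : IntermediateField.adjoin k (Set.range x) = ⊤
  aeval_eq_zero : aeval x f = 0
  dvd_of_aeval_eq_zero : ∀ {n : ℕ} {g : MvPolynomial (Fin 3) k},
    g.IsHomogeneous n → aeval x g = 0 → f ∣ g
  cross_eq : crossProduct x (fun i => D (x i)) = fun i => aeval x (pderiv i f)

section FormValues

variable {k K : Type*} [Field k] [Field K] [Algebra k K] {x : Fin 3 → K}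

lemma mem_formValues {N : ℕ} {u : K} :
    u ∈ formValues (k := k) x N ↔
      ∃ g : MvPolynomial (Fin 3) k, g.IsHomogeneous N ∧ aeval x g = u := by
  simp [formValues, Submodule.mem_map]

lemma mul_mem_formValues {M N : ℕ} {u v : K} (hu : u ∈ formValues (k := k) x M)
    (hv : v ∈ formValues (k := k) x N) : u * v ∈ formValues (k := k) x (M + N) := by
  rw [mem_formValues] at *
  obtain ⟨g, hg, rfl⟩ := hu
  obtain ⟨h, hh, rfl⟩ := hv
  exact ⟨g * h, hg.mul hh, by simp⟩

lemma pow_mem_formValues {N : ℕ} {u : K} (hu : u ∈ formValues (k := k) x N) (m : ℕ) :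
    u ^ m ∈ formValues (k := k) x (N * m) := by
  rw [mem_formValues] at *
  obtain ⟨g, hg, rfl⟩ := hu
  exact ⟨g ^ m, hg.pow m, by simp⟩

lemma one_mem_formValues_zero : (1 : K) ∈ formValues (k := k) x 0 :=
  mem_formValues.2 ⟨1, isHomogeneous_one _ _, by simp⟩

lemma formValues_mono (hx : x 2 = 1) {M N : ℕ} (h : M ≤ N) :
    formValues (k := k) x M ≤ formValues (k := k) x N := by
  intro u hu
  rw [mem_formValues] at *
  obtain ⟨g, hg, rfl⟩ := hu
  refine ⟨g * X 2 ^ (N - M), ?_, by simp [hx]⟩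
  have := hg.mul (isHomogeneous_X_pow (R := k) (2 : Fin 3) (N - M))
  rwa [Nat.add_sub_cancel' h] at this

lemma aeval_mem_formValues (hx : x 2 = 1) (g : MvPolynomial (Fin 3) k) {N : ℕ}
    (hN : g.totalDegree ≤ N) : aeval x g ∈ formValues (k := k) x N := by
  rw [← sum_homogeneousComponent g, map_sum]
  refine Submodule.sum_mem _ fun i hi => formValues_mono hx (M := i) ?_ ?_
  · have := Finset.mem_range.1 hi; omega
  · exact mem_formValues.2 ⟨_, homogeneousComponent_isHomogeneous i g, rfl⟩

lemma aeval_div_of_isHomogeneous {N : ℕ} {g : MvPolynomial (Fin 3) k} (hg : g.IsHomogeneous N)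
    (c : K) : aeval (fun i => x i / c) g = aeval x g / c ^ N := by
  rw [div_eq_inv_mul, ← inv_pow]
  have : (fun i => x i / c) = fun i => c⁻¹ * x i := by ext i; rw [div_eq_inv_mul]
  rw [this, aeval_def, aeval_def, eval₂_eq, eval₂_eq, Finset.mul_sum]
  refine Finset.sum_congr rfl fun d hd => ?_
  have h1 : d.degree = N := by
    by_contra h
    exact (mem_support_iff.1 hd) (hg.coeff_eq_zero h)
  simp_rw [mul_pow, Finset.prod_mul_distrib, Finset.prod_pow_eq_pow_sum]
  rw [← h1, Finsupp.degree_apply]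
  ring

lemma exists_div_of_adjoin_eq_top (hx : x 2 = 1)
    (htop : IntermediateField.adjoin k (Set.range x) = ⊤) (u : K) :
    ∃ N, ∃ a ∈ formValues (k := k) x N, ∃ b ∈ formValues (k := k) x N, b ≠ 0 ∧ u = a / b := by
  have hu : u ∈ IntermediateField.adjoin k (Set.range x) := htop ▸ IntermediateField.mem_top
  obtain ⟨r, s, rfl⟩ := (IntermediateField.mem_adjoin_range_iff k x u).1 hu
  by_cases hs : aeval x s = 0
  · exact ⟨0, 0, zero_mem _, 1, one_mem_formValues_zero, one_ne_zero, by simp [hs]⟩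
  · exact ⟨max r.totalDegree s.totalDegree, _, aeval_mem_formValues hx r (le_max_left _ _), _,
      aeval_mem_formValues hx s (le_max_right _ _), hs, rfl⟩

lemma exists_common_denominator (hx : x 2 = 1)
    (htop : IntermediateField.adjoin k (Set.range x) = ⊤) {m : ℕ} (c : Fin m → K) :
    ∃ G : K, G ≠ 0 ∧ ∃ N, ∀ j, G * c j ∈ formValues (k := k) x N := by
  choose N a ha b hb hb0 hab using fun j => exists_div_of_adjoin_eq_top (k := k) hx htop (c j)
  have key : ∀ s : Finset (Fin m), ∏ i ∈ s, b i ∈ formValues (k := k) x (∑ i ∈ s, N i) := by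
    intro s
    induction s using Finset.induction_on with
    | empty => simpa using one_mem_formValues_zero
    | insert i s hi ih =>
      rw [Finset.prod_insert hi, Finset.sum_insert hi]
      exact mul_mem_formValues (hb i) ih
  refine ⟨∏ i, b i, Finset.prod_ne_zero_iff.2 fun i _ => hb0 i, ∑ i, N i, fun j => ?_⟩
  rw [← Finset.mul_prod_erase _ _ (Finset.mem_univ j),
    ← Finset.add_sum_erase _ _ (Finset.mem_univ j)]
  have : b j * (∏ i ∈ Finset.univ.erase j, b i) * c j = a j * ∏ i ∈ Finset.univ.erase j, b i := by
    rw [hab j]; field_simp [hb0 j]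
  rw [this]
  exact mul_mem_formValues (ha j) (key _)

instance (N : ℕ) : FiniteDimensional k (homogeneousSubmodule (Fin 3) k N) :=
  Module.Finite.iff_fg.2 (homogeneousSubmodule_fg (Fin 3) k N)

instance (N : ℕ) : FiniteDimensional k (formValues (k := k) x N) := by
  unfold formValues; infer_instance

lemma finrank_homogeneousSubmodule (N : ℕ) :
    Module.finrank k (homogeneousSubmodule (Fin 3) k N) = (N + 2).choose 2 := by
  classical
  rw [homogeneousSubmodule_eq_finsupp_supported]
  rw [(AddMonoidAlgebra.supportedEquivFinsupp (R := k) {d : Fin 3 →₀ ℕ | d.degree = N}).finrank_eq]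
  have : {d : Fin 3 →₀ ℕ | d.degree = N} =
      ((Finset.univ : Finset (Fin 3)).finsuppAntidiag N : Set (Fin 3 →₀ ℕ)) := by
    ext d
    simp [Finset.mem_finsuppAntidiag, Finsupp.degree_eq_sum]
  rw [this, Module.finrank_finsupp_self, ← Nat.card_eq_fintype_card, Nat.card_coe_set_eq,
    Set.ncard_coe_finset,
    Finset.card_finsuppAntidiag_nat_eq_choose]
  simp only [Finset.card_univ, Fintype.card_fin]
  rw [show 3 + N - 1 = N + 2 by omega, Nat.choose_symm_add]

lemma finrank_formValues_le {f : MvPolynomial (Fin 3) k} (hf : f.IsHomogeneous 3) (hf0 : f ≠ 0)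
    (hfx : aeval x f = 0) (N : ℕ) :
    Module.finrank k (formValues (k := k) x N) ≤ 3 * N + 3 := by
  by_cases hN : N < 3
  · have h1 := Submodule.finrank_map_le (aeval x : MvPolynomial (Fin 3) k →ₐ[k] K).toLinearMap
      (homogeneousSubmodule (Fin 3) k N)
    rw [finrank_homogeneousSubmodule] at h1
    refine h1.trans ?_
    interval_cases N <;> decide
  obtain ⟨N, rfl⟩ : ∃ M, N = M + 3 := ⟨N - 3, by omega⟩
  let φ : homogeneousSubmodule (Fin 3) k (N + 3) →ₗ[k] K :=
    (aeval x).toLinearMap ∘ₗ (homogeneousSubmodule (Fin 3) k (N + 3)).subtype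
  have hr : LinearMap.range φ = formValues (k := k) x (N + 3) := by
    simp [φ, formValues, LinearMap.range_comp]
  have h2 := LinearMap.finrank_range_add_finrank_ker φ
  rw [hr, finrank_homogeneousSubmodule] at h2
  let ψ : homogeneousSubmodule (Fin 3) k N →ₗ[k] LinearMap.ker φ :=
    LinearMap.codRestrict _ (LinearMap.codRestrict _
      (LinearMap.mulLeft k f ∘ₗ (homogeneousSubmodule (Fin 3) k N).subtype) (by
        rintro ⟨g, hg⟩
        have := hf.mul ((mem_homogeneousSubmodule _ _).1 hg)
        rw [add_comm] at this
        simpa [mem_homogeneousSubmodule] using this)) (by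
        intro g
        simp [φ, hfx])
  have hψ : Function.Injective ψ := by
    intro a b hab
    have := congrArg (fun z : LinearMap.ker φ => (z.1.1 : MvPolynomial (Fin 3) k)) hab
    simpa [ψ, hf0] using this
  have h3 := LinearMap.finrank_le_finrank_of_injective hψ
  rw [finrank_homogeneousSubmodule] at h3
  have h4 : (N + 3 + 2).choose 2 = (N + 2).choose 2 + (3 * (N + 3)) := by
    simp only [Nat.choose_succ_succ, Nat.choose_zero_right, Nat.choose_one_right]
    ring
  omega

lemma linearIndependent_pow_of_transcendental {A : Type*} [CommRing A] [Algebra k A] {a : A}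
    (ha : Transcendental k a) : LinearIndependent k (fun i : ℕ => a ^ i) := by
  have h := (Polynomial.basisMonomials k).linearIndependent.map' (Polynomial.aeval a).toLinearMap
    (LinearMap.ker_eq_bot.2 (transcendental_iff_injective.1 ha))
  convert! h using 1
  ext i
  simp

/-- If `β ^ r` is a ratio of two forms of degree `e`, then `r [K : k(β)] ≤ 3 e`. -/
lemma mul_le_of_pow_eq_div {f : MvPolynomial (Fin 3) k} (hf : f.IsHomogeneous 3) (hf0 : f ≠ 0)
    (hfx : aeval x f = 0) (hx : x 2 = 1)
    (htop : IntermediateField.adjoin k (Set.range x) = ⊤) {β a c : K} (hβ : Transcendental k β)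
    {r e m : ℕ} (ha : a ∈ formValues (k := k) x e) (hc : c ∈ formValues (k := k) x e)
    (hc0 : c ≠ 0) (hr : 0 < r) (hac : β ^ r = a / c) {w : Fin m → K}
    (hw : LinearIndependent (IntermediateField.adjoin k {β}) w) : m * r ≤ 3 * e := by
  by_contra hcon
  push Not at hcon
  obtain ⟨j, u, hu, v, hv, hv0, huv⟩ := exists_div_of_adjoin_eq_top (k := k) hx htop β
  obtain ⟨G, hG0, l, hG⟩ := exists_common_denominator (k := k) hx htop w
  let β' : IntermediateField.adjoin k {β} := ⟨β, IntermediateField.mem_adjoin_simple_self k β⟩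
  have hβ' : Transcendental k β' := by
    intro h
    exact hβ (h.algebraMap (A := K))
  set M := 3 * ((r - 1) * j + l) + 3 with hM
  have h1 : LinearIndependent k (fun p : (Fin (r * (M + 1))) × Fin m =>
      β ^ (p.1 : ℕ) * w p.2) := by
    have hli : LinearIndependent k (fun i : Fin (r * (M + 1)) => β' ^ (i : ℕ)) :=
      (linearIndependent_pow_of_transcendental hβ').comp _ Fin.val_injective
    have := linearIndependent_smul hli hw
    convert! this using 1
  have h2 : LinearIndependent k (fun p : (Fin (r * (M + 1))) × Fin m =>
      (c ^ M * v ^ (r - 1) * G) * (β ^ (p.1 : ℕ) * w p.2)) := by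
    have hinj : LinearMap.ker (LinearMap.mulLeft k (c ^ M * v ^ (r - 1) * G)) = ⊥ := by
      rw [LinearMap.ker_eq_bot]
      exact mul_right_injective₀ (by positivity)
    exact h1.map' _ hinj
  have h3 : ∀ p : (Fin (r * (M + 1))) × Fin m,
      (c ^ M * v ^ (r - 1) * G) * (β ^ (p.1 : ℕ) * w p.2) ∈
        formValues (k := k) x (e * M + (j * (r - 1) + l)) := by
    rintro ⟨i, s⟩
    obtain ⟨i, hi⟩ := i
    have hi1 : i / r ≤ M := by
      have := Nat.div_lt_of_lt_mul hi; omega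
    have hi2 : i % r ≤ r - 1 := by
      have := Nat.mod_lt i hr; omega
    have e1 : (c ^ M * v ^ (r - 1) * G) * (β ^ i * w s) =
        (a ^ (i / r) * c ^ (M - i / r)) * ((u ^ (i % r) * v ^ (r - 1 - i % r)) * (G * w s)) := by
      have : β ^ i = (a / c) ^ (i / r) * (u / v) ^ (i % r) := by
        rw [← hac, ← huv, ← pow_mul, ← pow_add, Nat.div_add_mod]
      rw [this, div_pow, div_pow, ← pow_sub_mul_pow c hi1, ← pow_sub_mul_pow v hi2]
      field_simp
    rw [e1]
    refine mul_mem_formValues ?_ (mul_mem_formValues ?_ (hG s))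
    · have := mul_mem_formValues (pow_mem_formValues ha (i / r)) (pow_mem_formValues hc (M - i / r))
      rwa [← mul_add, Nat.add_sub_cancel' hi1] at this
    · have := mul_mem_formValues (pow_mem_formValues hu (i % r))
        (pow_mem_formValues hv (r - 1 - i % r))
      rwa [← mul_add, Nat.add_sub_cancel' hi2] at this
  have h4 : LinearIndependent k (fun p : (Fin (r * (M + 1))) × Fin m =>
      (⟨_, h3 p⟩ : formValues (k := k) x (e * M + (j * (r - 1) + l)))) :=
    LinearIndependent.of_comp (formValues (k := k) x _).subtype h2
  have h5 := h4.fintype_card_le_finrank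
  have h6 := finrank_formValues_le hf hf0 hfx (e * M + (j * (r - 1) + l))
  simp only [Fintype.card_prod, Fintype.card_fin] at h5
  have h7 : (3 * e + 1) * (M + 1) ≤ m * r * (M + 1) := Nat.mul_le_mul_right _ hcon
  have h8 : (r - 1) * j = j * (r - 1) := mul_comm _ _
  nlinarith

end FormValues

section Valuation

variable {k K : Type*} [Field k] [Field K] [Algebra k K]

lemma mem_range_algebraMap_of_isAlgebraic [IsAlgClosed k] {θ : K} (h : IsAlgebraic k θ) :
    θ ∈ Set.range (algebraMap k K) :=
  minpoly.mem_range_of_degree_eq_one k θ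
    (IsAlgClosed.degree_eq_one_of_irreducible k (minpoly.irreducible h.isIntegral))

lemma isAlgebraic_iff_mem_range_algebraMap [IsAlgClosed k] {θ : K} :
    IsAlgebraic k θ ↔ θ ∈ Set.range (algebraMap k K) := by
  refine ⟨mem_range_algebraMap_of_isAlgebraic, ?_⟩
  rintro ⟨c, rfl⟩
  exact isAlgebraic_algebraMap c

/-- An element of every valuation ring of `K / k` is a constant. -/
lemma mem_range_algebraMap_of_forall_valuationSubring [IsAlgClosed k] {θ : K}
    (h : ∀ O : ValuationSubring K, (∀ c : k, algebraMap k K c ∈ O) → θ ∈ O) :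
    θ ∈ Set.range (algebraMap k K) := by
  apply mem_range_algebraMap_of_isAlgebraic
  have h1 := iInf_valuationSubring_superset (s := Set.range (algebraMap k K))
  have h2 : θ ∈ (⨅ V : {V : ValuationSubring K // Set.range (algebraMap k K) ⊆ V.toSubring},
      V.1.toSubring) := by
    rw [Subring.mem_iInf]
    rintro ⟨V, hV⟩
    exact h V fun c => hV ⟨c, rfl⟩
  rw [h1] at h2
  replace h2 : IsIntegral (Subring.closure (Set.range (algebraMap k K))) θ := h2
  have h3 : Subring.closure (Set.range (algebraMap k K)) = (algebraMap k K).range := by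
    rw [← RingHom.coe_range, Subring.closure_eq]
  rw [h3] at h2
  obtain ⟨P, hP, hP0⟩ := h2
  have hsurj := (algebraMap k K).rangeRestrict_surjective
  obtain ⟨Q, hQ, -, hQm⟩ := Polynomial.lifts_and_degree_eq_and_monic
    (f := (algebraMap k K).rangeRestrict) (p := P) (by
      rw [Polynomial.lifts_iff_coeff_lifts]
      intro n
      exact hsurj _) hP
  refine IsIntegral.isAlgebraic ⟨Q, hQm, ?_⟩
  rw [← hQ, Polynomial.eval₂_map] at hP0
  exact hP0

namespace ValuationSubring

variable {O : ValuationSubring K}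

lemma valuation_algebraMap_eq_one (hk : ∀ c : k, algebraMap k K c ∈ O) {c : k} (hc : c ≠ 0) :
    O.valuation (algebraMap k K c) = 1 := by
  refine le_antisymm ((O.valuation_le_one_iff _).2 (hk c)) ?_
  have h := (O.valuation_le_one_iff _).2 (hk c⁻¹)
  have h0 : algebraMap k K c ≠ 0 := by simpa using hc
  rwa [map_inv₀, map_inv₀, inv_le_one₀ (by simpa [zero_lt_iff] using hc)] at h

lemma eq_zero_of_valuation_algebraMap_lt_one (hk : ∀ c : k, algebraMap k K c ∈ O) {c : k}
    (hc : O.valuation (algebraMap k K c) < 1) : c = 0 := by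
  by_contra h
  exact hc.ne (valuation_algebraMap_eq_one hk h)

lemma polynomialAeval_mem (hk : ∀ c : k, algebraMap k K c ∈ O) {u : K} (hu : u ∈ O)
    (P : Polynomial k) : Polynomial.aeval u P ∈ O := by
  induction P using Polynomial.induction_on' with
  | add P Q hP hQ => rw [map_add]; exact AddMemClass.add_mem hP hQ
  | monomial m a =>
    rw [Polynomial.aeval_monomial]
    exact MulMemClass.mul_mem (hk a) (pow_mem hu m)

/-- If `K` is algebraic over every `k(u)` with `u` transcendental, then the residue field of a
nontrivial valuation ring of `K / k` is `k`. -/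
lemma exists_valuation_sub_lt_one [IsAlgClosed k]
    (halg : ∀ u : K, Transcendental k u → Algebra.IsAlgebraic (IntermediateField.adjoin k {u}) K)
    (hk : ∀ c : k, algebraMap k K c ∈ O) (hO : O ≠ ⊤) {u : K} (hu : u ∈ O) :
    ∃ c : k, O.valuation (u - algebraMap k K c) < 1 := by
  by_contra! hcon
  apply hO
  have hinv : ∀ c : k, (u - algebraMap k K c)⁻¹ ∈ O := by
    intro c
    rw [← valuation_le_one_iff, map_inv₀]
    exact inv_le_one_of_one_le₀ (hcon c)
  have htr : Transcendental k u := by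
    intro h
    obtain ⟨c, rfl⟩ := mem_range_algebraMap_of_isAlgebraic h
    simpa using hcon c
  have hP : ∀ P : Polynomial k, Polynomial.aeval u P ∈ O := polynomialAeval_mem hk hu
  have hQ : ∀ P : Polynomial k, (Polynomial.aeval u P)⁻¹ ∈ O := by
    intro P
    by_cases hP0 : P = 0
    · simp [hP0, O.zero_mem]
    rw [(IsAlgClosed.splits P).eq_prod_roots]
    rw [map_mul, Polynomial.aeval_C, mul_inv, ← map_inv₀]
    refine MulMemClass.mul_mem (hk _) ?_
    generalize P.roots = s
    induction s using Multiset.induction_on with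
    | empty => simp [O.one_mem]
    | cons a s ih =>
      rw [Multiset.map_cons, Multiset.prod_cons, map_mul, mul_inv]
      refine MulMemClass.mul_mem ?_ ih
      simpa using hinv a
  have hsub : ∀ z ∈ IntermediateField.adjoin k {u}, z ∈ O := by
    intro z hz
    obtain ⟨r, s, rfl⟩ := (IntermediateField.mem_adjoin_simple_iff k z).1 hz
    rw [div_eq_mul_inv]
    exact MulMemClass.mul_mem (hP r) (hQ s)
  have := halg u htr
  rw [_root_.eq_top_iff]
  intro z _
  obtain ⟨P, hPm, hP0⟩ := (Algebra.IsAlgebraic.isAlgebraic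
    (R := IntermediateField.adjoin k {u}) z).isIntegral
  let g : IntermediateField.adjoin k {u} →+* O :=
    (algebraMap (IntermediateField.adjoin k {u}) K).codRestrict O fun z => hsub z z.2
  have h1 : IsIntegral O z := by
    refine ⟨P.map g, hPm.map g, ?_⟩
    rw [Polynomial.eval₂_map]
    exact hP0
  obtain ⟨y, rfl⟩ := IsIntegrallyClosed.isIntegral_iff.1 h1
  exact y.2

end ValuationSubring

end Valuation

lemma MvPolynomial.exists_eq_C_eval_add_sum {σ R : Type*} [Fintype σ] [CommRing R] (c : σ → R)
    (g : MvPolynomial σ R) :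
    ∃ G : σ → MvPolynomial σ R, g = C (eval c g) + ∑ m, (X m - C (c m)) * G m := by
  classical
  induction g using MvPolynomial.induction_on with
  | C a => exact ⟨0, by simp⟩
  | add g h hg hh =>
    obtain ⟨G, hG⟩ := hg
    obtain ⟨H, hH⟩ := hh
    refine ⟨G + H, ?_⟩
    simp only [Pi.add_apply, mul_add, Finset.sum_add_distrib, map_add]
    linear_combination hG + hH
  | mul_X g i hg =>
    obtain ⟨G, hG⟩ := hg
    refine ⟨fun m => G m * X i + if m = i then C (eval c g) else 0, ?_⟩
    have : ∑ m, (X m - C (c m)) * (G m * X i + if m = i then C (eval c g) else 0) =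
        (∑ m, (X m - C (c m)) * G m) * X i + (X i - C (c i)) * C (eval c g) := by
      simp only [mul_add, Finset.sum_add_distrib, mul_ite, mul_zero, Finset.sum_ite_eq',
        Finset.mem_univ, if_true, Finset.sum_mul, mul_assoc]
    rw [this, map_mul, eval_X, map_mul]
    linear_combination X i * hG

lemma MvPolynomial.eval_eq_eval_pderiv_of_eq {σ R : Type*} [Fintype σ] [CommRing R] {c : σ → R}
    {g : MvPolynomial σ R} {a : R} {G : σ → MvPolynomial σ R}
    (h : g = C a + ∑ m, (X m - C (c m)) * G m) (i : σ) :
    eval c (G i) = eval c (pderiv i g) := by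
  classical
  rw [h]
  simp [pderiv_X, Pi.single_apply, apply_ite (eval c)]

namespace IsCubicFunctionField

variable {k K : Type*} [Field k] [Field K] [Algebra k K] {f : MvPolynomial (Fin 3) k}
  {x : Fin 3 → K} {D : Derivation k K K}

lemma ne_zero (h : IsCubicFunctionField f x D) : f ≠ 0 := by
  rintro rfl
  simpa using congrFun (h.smooth 1 (by simp) (by simp)) 0

lemma finiteDimensional_adjoin (h : IsCubicFunctionField f x D) {β : K}
    (hβ : Transcendental k β) : FiniteDimensional (IntermediateField.adjoin k {β}) K := by
  obtain ⟨e, a, ha, b, hb, hb0, hab⟩ := exists_div_of_adjoin_eq_top h.apply_two h.adjoin_eq_top β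
  refine Module.rank_lt_aleph0_iff.1 ?_
  by_contra hcon
  push Not at hcon
  have h1 : ((3 * e + 1 : ℕ) : Cardinal) ≤ Module.rank (IntermediateField.adjoin k {β}) K :=
    (Cardinal.natCast_lt_aleph0).le.trans hcon
  obtain ⟨w, hw⟩ := Module.le_rank_iff.1 h1
  have := mul_le_of_pow_eq_div h.isHomogeneous h.ne_zero h.aeval_eq_zero h.apply_two
    h.adjoin_eq_top hβ ha hb hb0 one_pos (by simpa using hab) hw
  omega

lemma exists_valuation_sub_lt_one [IsAlgClosed k] (h : IsCubicFunctionField f x D)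
    {O : ValuationSubring K} (hk : ∀ c : k, algebraMap k K c ∈ O) (hO : O ≠ ⊤) {u : K}
    (hu : u ∈ O) : ∃ c : k, O.valuation (u - algebraMap k K c) < 1 :=
  ValuationSubring.exists_valuation_sub_lt_one (fun _ hu => by
    have := h.finiteDimensional_adjoin hu
    infer_instance) hk hO hu

end IsCubicFunctionField

section Residue

variable {k K : Type*} [Field k] [Field K] [Algebra k K] {O : ValuationSubring K}

lemma ValuationSubring.valuation_aeval_le_one {σ : Type*} (hk : ∀ c : k, algebraMap k K c ∈ O)
    {y : σ → K} (hy : ∀ i, O.valuation (y i) ≤ 1) (g : MvPolynomial σ k) :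
    O.valuation (aeval y g) ≤ 1 := by
  induction g using MvPolynomial.induction_on with
  | C a => rw [aeval_C]; exact (O.valuation_le_one_iff _).2 (hk a)
  | add g h hg hh => rw [map_add]; exact (O.valuation.map_add _ _).trans (max_le hg hh)
  | mul_X g i hg =>
    rw [map_mul, aeval_X, map_mul]
    exact mul_le_one' hg (hy i)

lemma ValuationSubring.valuation_aeval_sub_lt_one {σ : Type*}
    (hk : ∀ c : k, algebraMap k K c ∈ O) {y : σ → K} {c : σ → k}
    (hc : ∀ i, O.valuation (y i - algebraMap k K (c i)) < 1) (g : MvPolynomial σ k) :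
    O.valuation (aeval y g - algebraMap k K (eval c g)) < 1 := by
  have hy : ∀ i, O.valuation (y i) ≤ 1 := by
    intro i
    have : y i = (y i - algebraMap k K (c i)) + algebraMap k K (c i) := by ring
    rw [this]
    exact (O.valuation.map_add _ _).trans
      (max_le (hc i).le ((O.valuation_le_one_iff _).2 (hk _)))
  induction g using MvPolynomial.induction_on with
  | C a => simp
  | add g h hg hh =>
    have : aeval y (g + h) - algebraMap k K (eval c (g + h)) =
      (aeval y g - algebraMap k K (eval c g)) + (aeval y h - algebraMap k K (eval c h)) := by
      simp only [map_add]; ring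
    rw [this]
    exact (O.valuation.map_add _ _).trans_lt (max_lt hg hh)
  | mul_X g i hg =>
    have : aeval y (g * X i) - algebraMap k K (eval c (g * X i)) =
      (aeval y g - algebraMap k K (eval c g)) * y i +
        algebraMap k K (eval c g) * (y i - algebraMap k K (c i)) := by
      simp only [map_mul, aeval_X, eval_X]; ring
    rw [this]
    refine (O.valuation.map_add _ _).trans_lt (max_lt ?_ ?_)
    · rw [map_mul]; exact (mul_le_of_le_one_right' (hy i)).trans_lt hg
    · rw [map_mul]
      exact (mul_le_of_le_one_left' ((O.valuation_le_one_iff _).2 (hk _))).trans_lt (hc i)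

lemma ValuationSubring.valuation_aeval_eq_one {σ : Type*}
    (hk : ∀ c : k, algebraMap k K c ∈ O) {y : σ → K} {c : σ → k}
    (hc : ∀ i, O.valuation (y i - algebraMap k K (c i)) < 1) {g : MvPolynomial σ k}
    (hg : eval c g ≠ 0) : O.valuation (aeval y g) = 1 := by
  have h1 := valuation_aeval_sub_lt_one hk hc g
  have h2 := valuation_algebraMap_eq_one hk hg
  rw [← h2] at h1
  rw [← h2, ← Valuation.map_eq_of_sub_lt _ h1]

end Residue

namespace IsCubicFunctionField

variable {k K : Type*} [Field k] [Field K] [Algebra k K] {f : MvPolynomial (Fin 3) k}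
  {x : Fin 3 → K} {D : Derivation k K K} {O : ValuationSubring K}

lemma derivation_div (h : IsCubicFunctionField f x D) {j a : Fin 3} (hja : a ≠ j)
    (hj : x j ≠ 0) : ∃ i, i ≠ j ∧ i ≠ a ∧
      (D (x a / x j) = aeval (fun i => x i / x j) (pderiv i f) ∨
        D (x a / x j) = -aeval (fun i => x i / x j) (pderiv i f)) := by
  have hD : D (x a / x j) = (x j * D (x a) - x a * D (x j)) / x j ^ 2 := by
    rw [div_eq_mul_inv, D.leibniz, D.leibniz_inv]
    simp only [smul_eq_mul]
    field_simp
    ring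
  have hc := h.cross_eq
  rw [cross_apply] at hc
  have h0 := congrFun hc 0
  have h1 := congrFun hc 1
  have h2 := congrFun hc 2
  have hh : ∀ i, aeval (fun i => x i / x j) (pderiv i f) = aeval x (pderiv i f) / x j ^ 2 :=
    fun _ => aeval_div_of_isHomogeneous h.isHomogeneous.pderiv _
  simp only [hD, hh, ← neg_div]
  simp only [Matrix.cons_val_zero, Matrix.cons_val_one, Matrix.cons_val] at h0 h1 h2
  fin_cases j <;> fin_cases a <;> simp only [Fin.isValue, Fin.zero_eta, Fin.mk_one,
    Fin.reduceFinMk, ne_eq, not_true_eq_false] at hja ⊢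
  · exact ⟨2, by decide, by decide, .inl (by rw [← h2])⟩
  · exact ⟨1, by decide, by decide, .inr (by rw [← h1]; ring)⟩
  · exact ⟨2, by decide, by decide, .inr (by rw [← h2]; ring)⟩
  · exact ⟨0, by decide, by decide, .inl (by rw [← h0])⟩
  · exact ⟨1, by decide, by decide, .inl (by rw [← h1])⟩
  · exact ⟨0, by decide, by decide, .inr (by rw [← h0]; ring)⟩

/-- Coordinates around the center of a valuation ring. -/
lemma exists_center [IsAlgClosed k] (h : IsCubicFunctionField f x D)
    (hk : ∀ c : k, algebraMap k K c ∈ O) (hO : O ≠ ⊤) :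
    ∃ j : Fin 3, ∃ c : Fin 3 → k, x j ≠ 0 ∧ c j = 1 ∧
      (∀ i, O.valuation (x i / x j) ≤ 1) ∧
      (∀ i, O.valuation (x i / x j - algebraMap k K (c i)) < 1) := by
  obtain ⟨j, hj⟩ := Finite.exists_max fun i => O.valuation (x i)
  have hj0 : x j ≠ 0 := by
    intro h0
    have := hj 2
    rw [h0, h.apply_two] at this
    simp at this
  have hy : ∀ i, O.valuation (x i / x j) ≤ 1 := by
    intro i
    rw [map_div₀]
    exact div_le_one_of_le₀ (hj i) zero_le
  choose c hc using fun i =>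
    h.exists_valuation_sub_lt_one hk hO ((O.valuation_le_one_iff _).1 (hy i))
  refine ⟨j, c, hj0, ?_, hy, hc⟩
  have h1 := hc j
  rw [div_self hj0, ← map_one (algebraMap k K), ← map_sub] at h1
  have := ValuationSubring.eq_zero_of_valuation_algebraMap_lt_one hk h1
  exact (sub_eq_zero.1 this).symm

lemma eval_center_eq_zero [IsAlgClosed k] (h : IsCubicFunctionField f x D)
    (hk : ∀ c : k, algebraMap k K c ∈ O) {j : Fin 3} {c : Fin 3 → k} 
    (hc : ∀ i, O.valuation (x i / x j - algebraMap k K (c i)) < 1) : eval c f = 0 := by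
  have h1 := ValuationSubring.valuation_aeval_sub_lt_one hk hc f
  rw [aeval_div_of_isHomogeneous h.isHomogeneous, h.aeval_eq_zero, zero_div, zero_sub,
    Valuation.map_neg] at h1
  exact ValuationSubring.eq_zero_of_valuation_algebraMap_lt_one hk h1

lemma exists_pderiv_ne_zero (h : IsCubicFunctionField f x D) {j : Fin 3} {c : Fin 3 → k}
    (hj : c j = 1) (hf : eval c f = 0) : ∃ i, i ≠ j ∧ eval c (pderiv i f) ≠ 0 := by
  by_contra! hcon
  have h1 := congrArg (eval c) h.isHomogeneous.sum_X_mul_pderiv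
  rw [map_sum, Finset.sum_eq_single j] at h1
  · rw [map_mul, eval_X, hj, one_mul, map_nsmul, hf, smul_zero] at h1
    have := h.smooth c hf fun i => by
      by_cases hi : i = j
      · rw [hi, h1]
      · exact hcon i hi
    rw [this] at hj
    simp at hj
  · intro i _ hi
    rw [map_mul, hcon i hi, mul_zero]
  · simp

/-- The powers of a nonunit of a valuation ring eventually clear any denominator. -/
lemma exists_pow_mul_mem [IsAlgClosed k] (h : IsCubicFunctionField f x D)
    (hk : ∀ c : k, algebraMap k K c ∈ O) {t : K} (ht0 : t ≠ 0) (ht : O.valuation t < 1) (u : K) :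
    ∃ N : ℕ, O.valuation (t ^ N * u) ≤ 1 := by
  have htN : ∀ N, O.valuation (t ^ N) ≤ 1 := fun N => by
    rw [map_pow]; exact pow_le_one' ht.le N
  let V : ValuationSubring K :=
    { carrier := {u | ∃ N : ℕ, O.valuation (t ^ N * u) ≤ 1}
      mul_mem' := by
        rintro a b ⟨M, hM⟩ ⟨N, hN⟩
        refine ⟨M + N, ?_⟩
        rw [show t ^ (M + N) * (a * b) = (t ^ M * a) * (t ^ N * b) by ring, map_mul]
        exact mul_le_one' hM hN
      one_mem' := ⟨0, by simp⟩
      add_mem' := by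
        rintro a b ⟨M, hM⟩ ⟨N, hN⟩
        refine ⟨M + N, ?_⟩
        rw [show t ^ (M + N) * (a + b) = t ^ N * (t ^ M * a) + t ^ M * (t ^ N * b) by ring]
        refine (O.valuation.map_add _ _).trans (max_le ?_ ?_)
        · rw [map_mul]; exact mul_le_one' (htN N) hM
        · rw [map_mul]; exact mul_le_one' (htN M) hN
      zero_mem' := ⟨0, by simp⟩
      neg_mem' := by
        rintro a ⟨M, hM⟩
        exact ⟨M, by rwa [mul_neg, Valuation.map_neg]⟩
      mem_or_inv_mem' := by
        intro a
        rcases O.mem_or_inv_mem a with ha | ha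
        · exact .inl ⟨0, by simpa using (O.valuation_le_one_iff _).2 ha⟩
        · exact .inr ⟨0, by simpa using (O.valuation_le_one_iff _).2 ha⟩ }
  have hmem : ∀ u, u ∈ V ↔ ∃ N : ℕ, O.valuation (t ^ N * u) ≤ 1 := fun _ => Iff.rfl
  have hOV : ∀ u ∈ O, u ∈ V := fun u hu =>
    (hmem u).2 ⟨0, by simpa using (O.valuation_le_one_iff _).2 hu⟩
  by_cases hV : V = ⊤
  · rw [← hmem, hV]; trivial
  exfalso
  obtain ⟨c, hc⟩ := h.exists_valuation_sub_lt_one (fun c => hOV _ (hk c)) hV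
    (hOV t ((O.valuation_le_one_iff _).1 ht.le))
  have hinv : (t - algebraMap k K c)⁻¹ ∈ V := by
    by_cases hc0 : c = 0
    · rw [hc0, map_zero, sub_zero]
      exact (hmem _).2 ⟨1, by simp [ht0]⟩
    · apply hOV
      have h1 := ValuationSubring.valuation_algebraMap_eq_one hk hc0
      rw [← O.valuation_le_one_iff, map_inv₀, Valuation.map_sub_swap,
        Valuation.map_sub_eq_of_lt_left _ (by rwa [h1]), h1, inv_one]
  have hne : t - algebraMap k K c ≠ 0 := by
    intro h0
    rw [sub_eq_zero] at h0
    by_cases hc0 : c = 0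
    · simp [hc0] at h0; exact ht0 h0
    · rw [h0, ValuationSubring.valuation_algebraMap_eq_one hk hc0] at ht
      exact lt_irrefl _ ht
  rw [← V.valuation_le_one_iff, map_inv₀] at hinv
  exact absurd ((inv_le_one₀ (by simpa [zero_lt_iff] using hne)).1 hinv) (not_le.2 hc)

lemma valuation_derivation_aeval_le_one {σ : Type*} (hk : ∀ c : k, algebraMap k K c ∈ O)
    {y : σ → K} (hy : ∀ i, O.valuation (y i) ≤ 1) (hD : ∀ i, O.valuation (D (y i)) ≤ 1)
    (g : MvPolynomial σ k) : O.valuation (D (aeval y g)) ≤ 1 := by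
  induction g using MvPolynomial.induction_on with
  | C a => rw [aeval_C, D.map_algebraMap]; simp
  | add g h hg hh =>
    rw [map_add, map_add]; exact (O.valuation.map_add _ _).trans (max_le hg hh)
  | mul_X g i hg =>
    rw [map_mul, aeval_X, D.leibniz, smul_eq_mul, smul_eq_mul]
    refine (O.valuation.map_add _ _).trans (max_le ?_ ?_)
    · rw [map_mul]
      exact mul_le_one' (ValuationSubring.valuation_aeval_le_one hk hy g) (hD i)
    · rw [map_mul]
      exact mul_le_one' (hy i) hg

/-- Every nontrivial valuation ring of `K / k` has a local parameter `t` such that every element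
is a power of `t` times a ratio of polynomials in the local coordinates not vanishing at
the center. -/
lemma exists_local_parameter [IsAlgClosed k] (h : IsCubicFunctionField f x D)
    (hk : ∀ c : k, algebraMap k K c ∈ O) (hO : O ≠ ⊤) :
    ∃ t : K, O.valuation t < 1 ∧ O.valuation (D t) = 1 ∧
      ∀ u, u ≠ 0 → ∃ M N : ℕ, ∃ a b : K, O.valuation a = 1 ∧ O.valuation b = 1 ∧
        O.valuation (D a) ≤ 1 ∧ O.valuation (D b) ≤ 1 ∧ t ^ M * a * u = t ^ N * b := by
  obtain ⟨j, c, hj0, hcj, hy, hc⟩ := h.exists_center hk hO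
  set y : Fin 3 → K := fun i => x i / x j with hydef
  have hyj : y j = 1 := div_self hj0
  have hfc : eval c f = 0 := h.eval_center_eq_zero hk hc
  have hfy : aeval y f = 0 := by
    rw [hydef, aeval_div_of_isHomogeneous h.isHomogeneous, h.aeval_eq_zero, zero_div]
  obtain ⟨i, hij, hi⟩ := h.exists_pderiv_ne_zero hcj hfc
  have hyO := ValuationSubring.valuation_aeval_le_one hk hy
  have hunit : ∀ g : MvPolynomial (Fin 3) k, eval c g ≠ 0 → O.valuation (aeval y g) = 1 :=
    fun g hg => ValuationSubring.valuation_aeval_eq_one hk hc hg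
  have hDy : ∀ a, O.valuation (D (y a)) ≤ 1 := by
    intro a
    by_cases haj : a = j
    · rw [haj, hyj, D.map_one_eq_zero]; simp
    obtain ⟨b, -, -, hb | hb⟩ := h.derivation_div haj hj0
    · rw [hydef, hb]; exact hyO _
    · rw [hydef, hb, Valuation.map_neg]; exact hyO _
  have hDg := valuation_derivation_aeval_le_one (D := D) hk hy hDy
  obtain ⟨l, hlj, hli⟩ : ∃ l : Fin 3, l ≠ j ∧ l ≠ i :=
    (by decide : ∀ i j : Fin 3, ∃ l : Fin 3, l ≠ j ∧ l ≠ i) i j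
  have hDl : O.valuation (D (y l)) = 1 := by
    obtain ⟨b, hbj, hbl, hb⟩ := h.derivation_div hlj hj0
    have hbi : b = i := by
      revert hbj hbl hlj hli hij; clear * -; revert b l i j; decide
    subst hbi
    rcases hb with hb | hb
    · rw [hydef, hb]; exact hunit _ hi
    · rw [hydef, hb, Valuation.map_neg]; exact hunit _ hi
  set t : K := y l - algebraMap k K (c l) with ht
  have hDt : O.valuation (D t) = 1 := by
    rw [ht, map_sub, D.map_algebraMap, sub_zero, hDl]
  have ht1 : O.valuation t < 1 := hc l
  have ht0 : t ≠ 0 := by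
    intro h0
    rw [h0] at hDt
    simp at hDt
  have hsum : ∀ (g : MvPolynomial (Fin 3) k) (G : Fin 3 → MvPolynomial (Fin 3) k),
      eval c g = 0 → g = C (eval c g) + ∑ m, (X m - C (c m)) * G m →
      aeval y g = (y i - algebraMap k K (c i)) * aeval y (G i) + t * aeval y (G l) := by
    intro g G hg0 hG
    have huniv : (Finset.univ : Finset (Fin 3)) = {i, l, j} := by
      clear * - hlj hli hij
      revert i j l; decide
    have := congrArg (aeval y) hG
    rw [hg0, huniv, Finset.sum_insert (by simp [hli.symm, hij]), Finset.sum_insert (by simp [hlj]),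
      Finset.sum_singleton] at this
    simp only [map_add, map_mul, map_sub, aeval_X, aeval_C, map_zero, hyj, hcj, map_one, sub_self,
      zero_mul, zero_add, add_zero] at this
    exact this
  obtain ⟨F, hF⟩ := exists_eq_C_eval_add_sum c f
  have hFi : eval c (F i) ≠ 0 := by rwa [eval_eq_eval_pderiv_of_eq hF]
  have hF1 := hunit _ hFi
  have hF0 : aeval y (F i) ≠ 0 := by
    intro h0; rw [h0] at hF1; simp at hF1
  have hfsum := hsum f F hfc hF
  rw [hfy] at hfsum
  have hstep : ∀ g : MvPolynomial (Fin 3) k, eval c g = 0 → ∃ g' : MvPolynomial (Fin 3) k,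
      aeval y (F i) * aeval y g = t * aeval y g' := by
    intro g hg
    obtain ⟨G, hG⟩ := exists_eq_C_eval_add_sum c g
    refine ⟨F i * G l - F l * G i, ?_⟩
    rw [hsum g G hg hG, map_sub, map_mul, map_mul]
    linear_combination - aeval y (G i) * hfsum
  have key : ∀ (N : ℕ) (g : MvPolynomial (Fin 3) k), aeval y g ≠ 0 →
      O.valuation (t ^ N * (aeval y g)⁻¹) ≤ 1 → ∃ (M : ℕ) (a b : MvPolynomial (Fin 3) k),
        eval c a ≠ 0 ∧ eval c b ≠ 0 ∧ aeval y a * aeval y g = t ^ M * aeval y b := by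
    intro N
    induction N with
    | zero =>
      intro g hg0 hg
      refine ⟨0, 1, g, by simp, fun hg1 => ?_, by simp⟩
      have h1 := ValuationSubring.valuation_aeval_sub_lt_one hk hc g
      rw [hg1, map_zero, sub_zero] at h1
      rw [pow_zero, one_mul, map_inv₀] at hg
      exact absurd ((inv_le_one₀ (by simpa [zero_lt_iff] using hg0)).1 hg) (not_le.2 h1)
    | succ N ih =>
      intro g hg0 hg
      by_cases hg1 : eval c g = 0
      · obtain ⟨g', hg'⟩ := hstep g hg1
        have hg'0 : aeval y g' ≠ 0 := by
          intro h0
          rw [h0, mul_zero] at hg'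
          exact (mul_ne_zero hF0 hg0) hg'
        obtain ⟨M, a, b, ha, hb, hab⟩ := ih g' hg'0 (by
          have h2 : t ^ N * (aeval y g')⁻¹ =
              (aeval y (F i))⁻¹ * (t ^ (N + 1) * (aeval y g)⁻¹) := by
            field_simp
            linear_combination t ^ N * hg'
          rw [h2, map_mul, map_inv₀, hF1, inv_one, one_mul]
          exact hg)
        refine ⟨M + 1, a * F i, b, by simp [ha, hFi], hb, ?_⟩
        rw [map_mul]
        linear_combination aeval y a * hg' + t * hab
      · exact ⟨0, 1, g, by simp, hg1, by simp⟩
  have key' : ∀ g : MvPolynomial (Fin 3) k, aeval y g ≠ 0 →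
      ∃ (M : ℕ) (a b : MvPolynomial (Fin 3) k),
        eval c a ≠ 0 ∧ eval c b ≠ 0 ∧ aeval y a * aeval y g = t ^ M * aeval y b := by
    intro g hg
    obtain ⟨N, hN⟩ := h.exists_pow_mul_mem hk ht0 ht1 (aeval y g)⁻¹
    exact key N g hg hN
  refine ⟨t, ht1, hDt, fun u hu => ?_⟩
  obtain ⟨N, a, ha, b, hb, hb0, hab⟩ :=
    exists_div_of_adjoin_eq_top h.apply_two h.adjoin_eq_top u
  obtain ⟨P, hP, rfl⟩ := mem_formValues.1 ha
  obtain ⟨Q, hQ, rfl⟩ := mem_formValues.1 hb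
  have hu' : u * aeval y Q = aeval y P := by
    rw [hydef, aeval_div_of_isHomogeneous hP, aeval_div_of_isHomogeneous hQ, hab]
    field_simp
  have hQ0 : aeval y Q ≠ 0 := by
    rw [hydef, aeval_div_of_isHomogeneous hQ]
    exact div_ne_zero hb0 (pow_ne_zero _ hj0)
  have hP0 : aeval y P ≠ 0 := hu' ▸ mul_ne_zero hu hQ0
  obtain ⟨M₁, a₁, b₁, ha₁, hb₁, hab₁⟩ := key' P hP0
  obtain ⟨M₂, a₂, b₂, ha₂, hb₂, hab₂⟩ := key' Q hQ0
  refine ⟨M₂, M₁, aeval y (a₁ * b₂), aeval y (a₂ * b₁), hunit _ (by simp [ha₁, hb₂]),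
    hunit _ (by simp [ha₂, hb₁]), hDg _, hDg _, ?_⟩
  rw [map_mul, map_mul]
  linear_combination aeval y a₂ * hab₁ - aeval y a₁ * u * hab₂ +
    aeval y a₁ * aeval y a₂ * hu'

lemma exists_uniformizer [IsAlgClosed k] (h : IsCubicFunctionField f x D)
    (hk : ∀ c : k, algebraMap k K c ∈ O) (hO : O ≠ ⊤) :
    ∃ t : K, O.valuation t < 1 ∧ O.valuation (D t) = 1 := by
  obtain ⟨t, h1, h2, -⟩ := h.exists_local_parameter hk hO
  exact ⟨t, h1, h2⟩

/-- The invariant derivation preserves every valuation ring. -/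
lemma derivation_mem [IsAlgClosed k] (h : IsCubicFunctionField f x D)
    (hk : ∀ c : k, algebraMap k K c ∈ O) {u : K} (hu : u ∈ O) : D u ∈ O := by
  by_cases hO : O = ⊤
  · rw [hO]; trivial
  by_cases hu0 : u = 0
  · rw [hu0, map_zero]; exact O.zero_mem
  obtain ⟨t, ht, hDt, hloc⟩ := h.exists_local_parameter hk hO
  obtain ⟨M, N, a, b, ha, hb, hDa, hDb, hab⟩ := hloc u hu0
  have ht0 : t ≠ 0 := by
    intro h0
    rw [h0] at hDt
    simp at hDt
  have ha0 : a ≠ 0 := by rintro rfl; simp at ha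
  have hvu := (O.valuation_le_one_iff _).2 hu
  rw [← O.valuation_le_one_iff]
  have hMN : M ≤ N := by
    by_contra! hlt
    obtain ⟨e, rfl⟩ := Nat.exists_eq_add_of_lt hlt
    have h1 : t ^ (e + 1) * a * u = b := by
      apply mul_left_cancel₀ (pow_ne_zero N ht0)
      rw [← hab]; ring
    have h2 := congrArg O.valuation h1
    rw [hb, map_mul, map_mul, ha, mul_one, map_pow] at h2
    have h3 : O.valuation t ^ (e + 1) < 1 := pow_lt_one' ht (by omega)
    exact (((mul_le_of_le_one_right' hvu).trans_lt h3).ne h2)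
  obtain ⟨e, rfl⟩ := Nat.exists_eq_add_of_le hMN
  have h1 : a * u = t ^ e * b := by
    apply mul_left_cancel₀ (pow_ne_zero M ht0)
    linear_combination hab
  have h2 := congrArg D h1
  simp only [D.leibniz, D.leibniz_pow, smul_eq_mul, nsmul_eq_mul] at h2
  have h3 : a * D u = t ^ e * D b + b * (((e : k) • (1 : K)) * t ^ (e - 1) * D t) - u * D a := by
    rw [Algebra.smul_def, map_natCast]
    linear_combination h2
  have h4 : O.valuation (D u) = O.valuation (a * D u) := by rw [map_mul, ha, one_mul]
  have htn : ∀ n, O.valuation (t ^ n) ≤ 1 := fun n => by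
    rw [map_pow]; exact pow_le_one' ht.le n
  rw [h4, h3]
  refine (Valuation.map_sub _ _ _).trans (max_le ((O.valuation.map_add _ _).trans
    (max_le ?_ ?_)) ?_)
  · rw [map_mul]; exact mul_le_one' (htn _) hDb
  · rw [map_mul, map_mul, map_mul, hb, hDt, one_mul, mul_one, Algebra.smul_def, mul_one]
    exact mul_le_one' ((O.valuation_le_one_iff _).2 (hk _)) (htn _)
  · rw [map_mul]; exact mul_le_one' hvu hDa

end IsCubicFunctionField

lemma Polynomial.exists_isCoprime_mul {k : Type*} [Field k] (r s : Polynomial k) :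
    ∃ g P Q : Polynomial k, IsCoprime P Q ∧ r = g * P ∧ s = g * Q := by
  let := UniqueFactorizationMonoid.toGCDMonoid (Polynomial k)
  obtain ⟨P, Q, h1, h2, hu⟩ := extract_gcd r s
  exact ⟨_, P, Q, (gcd_isUnit_iff P Q).1 hu, h1, h2⟩

lemma IntermediateField.exists_isCoprime_of_mem_adjoin_simple {k K : Type*} [Field k] [Field K]
    [Algebra k K] {T u : K} (hu : u ∈ IntermediateField.adjoin k {T}) :
    ∃ P Q : Polynomial k, IsCoprime P Q ∧ u * Polynomial.aeval T Q = Polynomial.aeval T P := by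
  obtain ⟨r, s, rfl⟩ := (IntermediateField.mem_adjoin_simple_iff k u).1 hu
  by_cases hs : Polynomial.aeval T s = 0
  · exact ⟨0, 1, isCoprime_one_right, by simp [hs]⟩
  obtain ⟨g, P, Q, hPQ, rfl, rfl⟩ := Polynomial.exists_isCoprime_mul r s
  refine ⟨P, Q, hPQ, ?_⟩
  rw [map_mul] at hs
  simp only [map_mul]
  field_simp [left_ne_zero_of_mul hs, right_ne_zero_of_mul hs]

namespace IsCubicFunctionField

variable {k K : Type*} [Field k] [Field K] [Algebra k K] {f : MvPolynomial (Fin 3) k}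
  {x : Fin 3 → K} {D : Derivation k K K} {O : ValuationSubring K}

lemma aeval_ne_zero (h : IsCubicFunctionField f x D) {n : ℕ} (hn : n < 3)
    {g : MvPolynomial (Fin 3) k} (hg : g.IsHomogeneous n) (hg0 : g ≠ 0) : aeval x g ≠ 0 := by
  intro h0
  obtain ⟨r, rfl⟩ := h.dvd_of_aeval_eq_zero hg h0
  have h1 := totalDegree_mul_of_isDomain (left_ne_zero_of_mul hg0) (right_ne_zero_of_mul hg0)
  rw [hg.totalDegree hg0, h.isHomogeneous.totalDegree h.ne_zero] at h1
  omega

lemma transcendental_zero [IsAlgClosed k] (h : IsCubicFunctionField f x D) :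
    Transcendental k (x 0) := by
  intro halg
  obtain ⟨c, hc⟩ := mem_range_algebraMap_of_isAlgebraic halg
  refine h.aeval_ne_zero (n := 1) (g := X 0 - C c * X 2) (by norm_num)
    ((isHomogeneous_X _ _).sub (isHomogeneous_C_mul_X _ _)) ?_ (by simp [h.apply_two, hc])
  intro h0
  simpa using congrArg (eval (Pi.single 0 1)) h0

lemma transcendental_of_adjoin_eq_top [IsAlgClosed k] (h : IsCubicFunctionField f x D) {T : K}
    (hT : IntermediateField.adjoin k {T} = ⊤) : Transcendental k T := by
  intro halg
  obtain ⟨c, rfl⟩ := mem_range_algebraMap_of_isAlgebraic halg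
  have h1 : x 0 ∈ IntermediateField.adjoin k {algebraMap k K c} := by rw [hT]; trivial
  rw [IntermediateField.adjoin_simple_eq_bot_iff.2 (algebraMap_mem _ c),
    IntermediateField.mem_bot] at h1
  exact h.transcendental_zero (isAlgebraic_iff_mem_range_algebraMap.2 h1)

lemma exists_valuationSubring_sub_lt_one [IsAlgClosed k] {T : K}
    (hT : Transcendental k T) (a : k) : ∃ O : ValuationSubring K,
      (∀ c : k, algebraMap k K c ∈ O) ∧ O ≠ ⊤ ∧ O.valuation (T - algebraMap k K a) < 1 := by
  by_contra! hcon
  have h1 : (T - algebraMap k K a)⁻¹ ∈ Set.range (algebraMap k K) := by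
    apply mem_range_algebraMap_of_forall_valuationSubring
    intro O hk
    by_cases hO : O = ⊤
    · rw [hO]; trivial
    · rw [← O.valuation_le_one_iff, map_inv₀]
      exact inv_le_one_of_one_le₀ (hcon O hk hO)
  obtain ⟨b, hb⟩ := h1
  apply hT
  rw [isAlgebraic_iff_mem_range_algebraMap]
  refine ⟨a + b⁻¹, ?_⟩
  rw [map_add, map_inv₀, hb]
  simp

lemma exists_derivation_eq_algebraMap [IsAlgClosed k] (h : IsCubicFunctionField f x D) {T : K}
    (hT : IntermediateField.adjoin k {T} = ⊤) : ∃ c : k, c ≠ 0 ∧ D T = algebraMap k K c := by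
  have htr := h.transcendental_of_adjoin_eq_top hT
  have hmem : ∀ u : K, u ∈ IntermediateField.adjoin k {T} := fun u => by rw [hT]; trivial
  have hval : ∀ a : k, ∃ O : ValuationSubring K, O.valuation (D T) = 1 ∧
      ∀ P : Polynomial k, (O.valuation (Polynomial.aeval T P) ≤ 1) ∧
        (O.valuation (Polynomial.aeval T P) = 1 ↔ P.eval a ≠ 0) := by
    intro a
    obtain ⟨O, hk, hO, hTa⟩ := exists_valuationSubring_sub_lt_one htr a
    have hP : ∀ P : Polynomial k, (O.valuation (Polynomial.aeval T P) ≤ 1) ∧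
        (O.valuation (Polynomial.aeval T P) = 1 ↔ P.eval a ≠ 0) := by
      intro P
      obtain ⟨R, hR⟩ := Polynomial.X_sub_C_dvd_sub_C_eval (p := P) (a := a)
      have hTO : T ∈ O := by
        have : T = (T - algebraMap k K a) + algebraMap k K a := by ring
        rw [this]
        exact add_mem ((O.valuation_le_one_iff _).1 hTa.le) (hk a)
      have hRO : O.valuation (Polynomial.aeval T R) ≤ 1 := by
        rw [O.valuation_le_one_iff]
        exact ValuationSubring.polynomialAeval_mem hk hTO R
      have h1 := congrArg (Polynomial.aeval T) hR
      simp only [map_sub, map_mul, Polynomial.aeval_C, Polynomial.aeval_X] at h1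
      have h2 : O.valuation (Polynomial.aeval T P - algebraMap k K (P.eval a)) < 1 := by
        rw [h1, map_mul]
        exact (mul_le_of_le_one_right' hRO).trans_lt hTa
      by_cases h0 : P.eval a = 0
      · rw [h0, map_zero, sub_zero] at h2
        exact ⟨h2.le, by simp [h0, h2.ne]⟩
      · have h3 := ValuationSubring.valuation_algebraMap_eq_one hk h0
        rw [← h3] at h2
        have h4 := Valuation.map_eq_of_sub_lt _ h2
        rw [h3] at h4
        exact ⟨h4.le, by simp [h0, h4]⟩
    refine ⟨O, ?_, hP⟩
    have hTO : T ∈ O := by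
      simpa using (O.valuation_le_one_iff _).1 (hP Polynomial.X).1
    have hDT := (O.valuation_le_one_iff _).2 (h.derivation_mem hk hTO)
    refine hDT.eq_of_not_lt fun hlt => ?_
    obtain ⟨t, ht, hDt⟩ := h.exists_uniformizer hk hO
    obtain ⟨P, Q, hPQ, htPQ⟩ :=
      IntermediateField.exists_isCoprime_of_mem_adjoin_simple (hmem t)
    have hQ : Q.eval a ≠ 0 := by
      intro hQ0
      have hP0 : P.eval a ≠ 0 := by
        intro hP0
        obtain ⟨A, B, hAB⟩ := hPQ
        simpa [hP0, hQ0] using congrArg (Polynomial.eval a) hAB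
      have h1 := congrArg O.valuation htPQ
      rw [(hP P).2.2 hP0, map_mul] at h1
      exact ((mul_le_of_le_one_right' (hP Q).1).trans_lt ht).ne h1
    have h1 := congrArg D htPQ
    rw [D.leibniz, D.map_aeval, D.map_aeval] at h1
    simp only [smul_eq_mul] at h1
    have h2 : Polynomial.aeval T Q * D t =
        Polynomial.aeval T (Polynomial.derivative P) * D T -
          t * (Polynomial.aeval T (Polynomial.derivative Q) * D T) := by
      linear_combination h1
    have h3 : O.valuation (Polynomial.aeval T Q * D t) < 1 := by
      rw [h2]
      refine (Valuation.map_sub _ _ _).trans_lt (max_lt ?_ ?_)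
      · rw [map_mul]
        exact (mul_le_of_le_one_left' (hP _).1).trans_lt hlt
      · rw [map_mul, map_mul]
        exact (mul_le_of_le_one_right' (mul_le_one' (hP _).1 hDT)).trans_lt ht
    rw [map_mul, hDt, (hP Q).2.2 hQ, mul_one] at h3
    exact lt_irrefl _ h3
  obtain ⟨P, Q, hPQ, htPQ⟩ :=
    IntermediateField.exists_isCoprime_of_mem_adjoin_simple (hmem (D T))
  have hiff : ∀ a, P.eval a ≠ 0 ∧ Q.eval a ≠ 0 := by
    intro a
    obtain ⟨O, hO, hP⟩ := hval a
    have h1 := congrArg O.valuation htPQ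
    rw [map_mul, hO, one_mul] at h1
    have h2 : Q.eval a ≠ 0 ↔ P.eval a ≠ 0 := by
      rw [← (hP P).2, ← (hP Q).2, h1]
    have h3 : ¬ (P.eval a = 0 ∧ Q.eval a = 0) := by
      rintro ⟨hP0, hQ0⟩
      obtain ⟨A, B, hAB⟩ := hPQ
      simpa [hP0, hQ0] using congrArg (Polynomial.eval a) hAB
    tauto
  have hconst : ∀ P : Polynomial k, (∀ a, P.eval a ≠ 0) → ∃ b, P = Polynomial.C b ∧ b ≠ 0 := by
    intro P hP
    by_cases hd : P.degree = 0
    · refine ⟨_, Polynomial.eq_C_of_degree_eq_zero hd, ?_⟩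
      rw [Polynomial.coeff_zero_eq_eval_zero]
      exact hP 0
    · obtain ⟨a, ha⟩ := IsAlgClosed.exists_root P hd
      exact absurd ha (hP a)
  obtain ⟨b, rfl, hb⟩ := hconst P fun a => (hiff a).1
  obtain ⟨c, rfl, hc⟩ := hconst Q fun a => (hiff a).2
  refine ⟨b / c, div_ne_zero hb hc, ?_⟩
  have hc' : algebraMap k K c ≠ 0 := by simpa using hc
  rw [Polynomial.aeval_C, Polynomial.aeval_C] at htPQ
  rw [map_div₀, eq_div_iff hc', htPQ]

/-- A smooth plane cubic is not rational. -/
lemma adjoin_simple_ne_top [IsAlgClosed k] (h : IsCubicFunctionField f x D) (T : K) :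
    IntermediateField.adjoin k {T} ≠ ⊤ := by
  intro hT
  have htr := h.transcendental_of_adjoin_eq_top hT
  have hT' : IntermediateField.adjoin k {T⁻¹} = ⊤ := by
    rw [eq_top_iff, ← hT, IntermediateField.adjoin_simple_le_iff]
    simpa using inv_mem (IntermediateField.mem_adjoin_simple_self k T⁻¹)
  obtain ⟨c, hc, hDT⟩ := h.exists_derivation_eq_algebraMap hT
  obtain ⟨c', hc', hDT'⟩ := h.exists_derivation_eq_algebraMap hT'
  have hT0 : T ≠ 0 := by
    rintro rfl
    exact htr isAlgebraic_zero
  rw [D.leibniz_inv, hDT, smul_eq_mul] at hDT'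
  have h0 : algebraMap k K c' ≠ 0 := by simpa using hc'
  have h1 : T ^ 2 = algebraMap k K (-c / c') := by
    rw [map_div₀, map_neg, eq_div_iff h0, ← hDT']
    field_simp
  exact htr (IsAlgebraic.of_pow two_pos (h1 ▸ isAlgebraic_algebraMap _))

end IsCubicFunctionField

section FrobeniusRange

variable {k K : Type*} [Field k] [Field K] [Algebra k K]

/-- The subfield of `p`-th powers, as an extension of the algebraically closed field `k`. -/
def powIntermediateField (k : Type*) (K : Type*) [Field k] [Field K] [Algebra k K]
    [IsAlgClosed k] (p : ℕ) [Fact p.Prime] [CharP K p] : IntermediateField k K where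
  __ := (frobenius K p).fieldRange
  algebraMap_mem' c := by
    obtain ⟨b, hb⟩ := IsAlgClosed.exists_pow_nat_eq c (Fact.out : p.Prime).pos
    exact ⟨algebraMap k K b, by rw [← hb, map_pow]; rfl⟩

variable [IsAlgClosed k] {p : ℕ} [Fact p.Prime] [CharP K p]

lemma mem_powIntermediateField {u : K} : u ∈ powIntermediateField k K p ↔ ∃ v, v ^ p = u :=
  Iff.rfl

lemma Derivation.eq_zero_of_mem_powIntermediateField (D : Derivation k K K) {u : K}
    (hu : u ∈ powIntermediateField k K p) : D u = 0 := by
  obtain ⟨v, rfl⟩ := mem_powIntermediateField.1 hu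
  rw [D.leibniz_pow, ← Nat.cast_smul_eq_nsmul K, CharP.cast_eq_zero, zero_smul]

lemma Derivation.aeval_powIntermediateField (D : Derivation k K K) (z : K)
    (Q : Polynomial (powIntermediateField k K p)) :
    D (Polynomial.aeval z Q) = Polynomial.aeval z (Polynomial.derivative Q) * D z := by
  induction Q using Polynomial.induction_on' with
  | add P Q hP hQ => simp only [map_add, hP, hQ, add_mul]
  | monomial m a =>
    rw [Polynomial.aeval_monomial, D.leibniz, Polynomial.derivative_monomial,
      Polynomial.aeval_monomial, IntermediateField.algebraMap_apply,
      D.eq_zero_of_mem_powIntermediateField a.2, D.leibniz_pow]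
    simp only [smul_eq_mul, nsmul_eq_mul, mul_zero, add_zero, map_mul]
    have hm : algebraMap (powIntermediateField k K p) K m = m := _root_.map_natCast _ m
    rw [IntermediateField.algebraMap_apply, hm]
    ring

/-- If `K` is generated by `z` over its subfield of `p`-th powers and `D z ≠ 0`, then the
kernel of `D` consists of `p`-th powers. -/
lemma Derivation.exists_pow_eq_of_adjoin_eq_top (D : Derivation k K K) {z : K}
    (hz : IntermediateField.adjoin (powIntermediateField k K p) {z} = ⊤) (hDz : D z ≠ 0) {u : K}
    (hu : D u = 0) : ∃ v, v ^ p = u := by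
  have hp : p ≠ 0 := (Fact.out : p.Prime).ne_zero
  rw [← mem_powIntermediateField (k := k)]
  let zp : powIntermediateField k K p := ⟨z ^ p, z, rfl⟩
  have hmon := Polynomial.monic_X_pow_sub_C zp hp
  have hev : Polynomial.aeval z (Polynomial.X ^ p - Polynomial.C zp) = 0 := by
    simp [zp, IntermediateField.algebraMap_apply]
  have hint : IsIntegral (powIntermediateField k K p) z := ⟨_, hmon, hev⟩
  have hdeg : (minpoly (powIntermediateField k K p) z).degree ≤ p := by
    rw [← Polynomial.degree_X_pow_sub_C (Nat.pos_of_ne_zero hp) zp]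
    exact minpoly.min _ _ hmon hev
  have humem : u ∈ IntermediateField.adjoin (powIntermediateField k K p) {z} := by rw [hz]; trivial
  rw [← IntermediateField.mem_toSubalgebra,
    IntermediateField.adjoin_simple_toSubalgebra_of_isAlgebraic hint.isAlgebraic,
    Algebra.adjoin_singleton_eq_range_aeval] at humem
  obtain ⟨Q₀, hQ₀⟩ := humem
  replace hQ₀ : Polynomial.aeval z Q₀ = u := hQ₀
  set Q := Q₀ %ₘ minpoly (powIntermediateField k K p) z with hQdef
  have hQ : Polynomial.aeval z Q = u := by
    rw [hQdef, Polynomial.aeval_modByMonic_eq_self_of_root (minpoly.aeval _ _), hQ₀]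
  have hQdeg : Q.degree < (minpoly (powIntermediateField k K p) z).degree :=
    Polynomial.degree_modByMonic_lt _ (minpoly.monic hint)
  rw [← hQ, D.aeval_powIntermediateField, mul_eq_zero, or_iff_left hDz] at hu
  have hder : Polynomial.derivative Q = 0 := by
    by_contra hne
    exact absurd (minpoly.degree_le_of_ne_zero _ _ hne hu)
      (not_le.2 ((Polynomial.degree_derivative_le).trans_lt hQdeg))
  have hC : Q = Polynomial.C (Q.coeff 0) := by
    ext n
    rw [Polynomial.coeff_C]
    split_ifs with hn
    · rw [hn]
    · obtain ⟨n, rfl⟩ := Nat.exists_eq_succ_of_ne_zero hn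
      by_cases hnp : n + 1 < p
      · have h1 := congrArg (fun P => Polynomial.coeff P n) hder
        simp only [Polynomial.coeff_derivative, Polynomial.coeff_zero] at h1
        rcases mul_eq_zero.1 h1 with h1 | h1
        · simpa using congrArg Subtype.val h1
        · exfalso
          have h2 : ((n + 1 : ℕ) : K) = 0 := by
            have := congrArg (algebraMap (powIntermediateField k K p) K) h1
            simpa using this
          rw [CharP.cast_eq_zero_iff K p] at h2
          exact absurd (Nat.le_of_dvd (by omega) h2) (by omega)
      · rw [Polynomial.coeff_eq_zero_of_degree_lt]
        refine hQdeg.trans_le (hdeg.trans ?_)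
        exact_mod_cast not_lt.1 hnp
  rw [← hQ, hC, Polynomial.aeval_C]
  exact (Q.coeff 0).2

lemma isSeparable_of_aeval_derivative_ne_zero {F E : Type*} [Field F] [Field E] [Algebra F E]
    {z : E} {P : Polynomial F} (h0 : Polynomial.aeval z P = 0)
    (h1 : Polynomial.aeval z (Polynomial.derivative P) ≠ 0) : IsSeparable F z := by
  have hP : P ≠ 0 := by rintro rfl; simp at h1
  have hint : IsIntegral F z := IsAlgebraic.isIntegral ⟨P, hP, h0⟩
  refine (Polynomial.separable_iff_derivative_ne_zero (minpoly.irreducible hint)).2 fun hd => h1 ?_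
  obtain ⟨R, rfl⟩ := minpoly.dvd F z h0
  simp [hd]

lemma mem_of_pow_mem_of_isSeparable (E : IntermediateField (powIntermediateField k K p) K)
    {z : K} (hz : IsSeparable E z) : z ∈ E := by
  have hp : z ^ p ∈ E := E.algebraMap_mem ⟨z ^ p, z, rfl⟩
  have : CharP E p := (algebraMap E K).charP (algebraMap E K).injective p
  have h1 : z ∈ perfectClosure E K := by
    rw [mem_perfectClosure_iff_pow_mem p]
    exact ⟨1, ⟨⟨z ^ p, hp⟩, by simp [IntermediateField.algebraMap_apply]⟩⟩
  have h2 : z ∈ separableClosure E K ⊓ perfectClosure E K := ⟨hz, h1⟩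
  rw [separableClosure_inf_perfectClosure, IntermediateField.mem_bot] at h2
  obtain ⟨y, rfl⟩ := h2
  exact y.2

end FrobeniusRange

lemma MvPolynomial.derivative_aeval_update {σ R A : Type*} [DecidableEq σ] [CommRing R]
    [CommRing A] [Algebra R A] (e : σ → A) (j : σ) (g : MvPolynomial σ R) :
    Polynomial.derivative (aeval (Function.update (fun m => Polynomial.C (e m)) j Polynomial.X) g)
      = aeval (Function.update (fun m => Polynomial.C (e m)) j Polynomial.X) (pderiv j g) := by
  induction g using MvPolynomial.induction_on with
  | C a => simp [Polynomial.algebraMap_apply]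
  | add g h hg hh => simp [hg, hh]
  | mul_X g i hg =>
    by_cases hij : i = j
    · subst hij
      simp [hg, Derivation.leibniz]
      ring
    · simp [hg, Derivation.leibniz, pderiv_X, Ne.symm hij, Function.update_of_ne hij]
      ring

namespace IsCubicFunctionField

variable {k K : Type*} [Field k] [Field K] [Algebra k K] {f : MvPolynomial (Fin 3) k}
  {x : Fin 3 → K} {D : Derivation k K K}

lemma exists_aeval_pderiv_ne_zero [IsAlgClosed k] (h : IsCubicFunctionField f x D) :
    ∃ i, aeval x (pderiv i f) ≠ 0 := by
  obtain ⟨O, hk, hO, -⟩ := exists_valuationSubring_sub_lt_one h.transcendental_zero 0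
  obtain ⟨j, c, -, hcj, -, hc⟩ := h.exists_center hk hO
  obtain ⟨i, -, hi⟩ := h.exists_pderiv_ne_zero hcj (h.eval_center_eq_zero hk hc)
  refine ⟨i, h.aeval_ne_zero (n := 2) (by norm_num) h.isHomogeneous.pderiv ?_⟩
  intro h0
  simp [h0] at hi

lemma exists_pow_eq_of_derivation_ne_zero [IsAlgClosed k] (h : IsCubicFunctionField f x D)
    {p : ℕ} [Fact p.Prime] [CharP K p] {i j : Fin 3} (hij : i ≠ j) (hi : i ≠ 2) (hj : j ≠ 2)
    (hDi : D (x i) ≠ 0) (hfj : aeval x (pderiv j f) ≠ 0) {u : K} (hu : D u = 0) :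
    ∃ v, v ^ p = u := by
  refine D.exists_pow_eq_of_adjoin_eq_top (z := x i) ?_ hDi hu
  set E := IntermediateField.adjoin (powIntermediateField k K p) {x i}
  have hiE : x i ∈ E := IntermediateField.mem_adjoin_simple_self _ _
  have huniv : ∀ m, m ≠ j → x m ∈ E := by
    intro m hm
    by_cases hmi : m = i
    · rw [hmi]; exact hiE
    · have : m = 2 := by
        revert hij hi hj hm hmi; clear * -; revert i j m; decide
      rw [this, h.apply_two]
      exact one_mem E
  let e : Fin 3 → E := fun m => if hm : m = j then 0 else ⟨x m, huniv m hm⟩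
  have hcomp : ∀ g : MvPolynomial (Fin 3) k, Polynomial.aeval (x j)
      (aeval (Function.update (fun m => Polynomial.C (e m)) j Polynomial.X) g) = aeval x g := by
    intro g
    induction g using MvPolynomial.induction_on with
    | C a =>
      simp [Polynomial.algebraMap_apply]
      rfl
    | add g h hg hh => simp only [map_add, hg, hh]
    | mul_X g m hg =>
      rw [map_mul, map_mul, map_mul, hg, aeval_X, aeval_X]
      congr 1
      by_cases hm : m = j
      · subst hm; simp
      · simp [e, hm]
  have hsep : IsSeparable E (x j) := by
    refine isSeparable_of_aeval_derivative_ne_zero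
      (P := aeval (Function.update (fun m => Polynomial.C (e m)) j Polynomial.X) f) ?_ ?_
    · rw [hcomp, h.aeval_eq_zero]
    · rw [derivative_aeval_update, hcomp]
      exact hfj
  have hjE := mem_of_pow_mem_of_isSeparable E hsep
  have hall : ∀ m, x m ∈ E := fun m => by
    by_cases hm : m = j
    · rw [hm]; exact hjE
    · exact huniv m hm
  have hle : IntermediateField.adjoin k (Set.range x) ≤ E.restrictScalars k := by
    rw [IntermediateField.adjoin_le_iff]
    rintro _ ⟨m, rfl⟩
    exact hall m
  rw [h.adjoin_eq_top] at hle
  rw [eq_top_iff]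
  intro y _
  exact hle (show y ∈ (⊤ : IntermediateField k K) from trivial)

/-- The field of constants of the invariant derivation is the field of `p`-th powers. -/
lemma exists_pow_eq_of_derivation_eq_zero [IsAlgClosed k] (h : IsCubicFunctionField f x D)
    (p : ℕ) [Fact p.Prime] [CharP K p] {u : K} (hu : D u = 0) : ∃ v, v ^ p = u := by
  have hc := h.cross_eq
  rw [cross_apply] at hc
  have h0 := congrFun hc 0
  have h1 := congrFun hc 1
  have h2 := congrFun hc 2
  simp only [Matrix.cons_val_zero, Matrix.cons_val_one, Matrix.cons_val, h.apply_two,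
    D.map_one_eq_zero] at h0 h1 h2
  by_cases hD0 : D (x 0) = 0
  · by_cases hD1 : D (x 1) = 0
    · obtain ⟨i, hi⟩ := h.exists_aeval_pderiv_ne_zero
      exfalso
      simp only [hD0, hD1, mul_zero, sub_zero] at h0 h1 h2
      fin_cases i
      · exact hi h0.symm
      · exact hi h1.symm
      · exact hi h2.symm
    · refine h.exists_pow_eq_of_derivation_ne_zero (i := 1) (j := 0) (by decide) (by decide)
        (by decide) hD1 ?_ hu
      rw [← h0]
      simpa using hD1
  · refine h.exists_pow_eq_of_derivation_ne_zero (i := 0) (j := 1) (by decide) (by decide)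
      (by decide) hD0 ?_ hu
    rw [← h1]
    simpa using hD0

lemma crossProduct_derivation_div (D : Derivation k K K) (β : Fin 3 → K) {b : K} (hb : b ≠ 0)
    (j : Fin 3) : crossProduct (fun i => β i / b) (fun i => D (β i / b)) j =
      crossProduct β (fun i => D (β i)) j / b ^ 2 := by
  have hD : ∀ a, D (a / b) = (b * D a - a * D b) / b ^ 2 := by
    intro a
    rw [div_eq_mul_inv, D.leibniz, D.leibniz_inv]
    simp only [smul_eq_mul]
    field_simp
    ring
  rw [cross_apply, cross_apply]
  fin_cases j <;> simp [hD] <;> field_simp <;> ring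

/-- The Wronskian of a relation among `Q`-th powers is regular, hence vanishes for
degree reasons. -/
lemma derivation_eq_zero_of_sum_eq_zero [IsAlgClosed k] (h : IsCubicFunctionField f x D) {p : ℕ}
    [CharP K p] {e P Q : ℕ} (hP : P ≠ 0) (hQ : p ∣ Q) (he : 2 * e < P * Q) {s β : Fin 3 → K}
    (hs : ∀ i, s i ∈ formValues (k := k) x e) {m : Fin 3} (hsm : s m ≠ 0) (hβm : β m = 1)
    (hβ : ∀ i, β i ^ P * s m = s i) (hsum : ∑ i, β i * x i ^ Q = 0) (i : Fin 3) :
    D (β i) = 0 := by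
  have hDx : ∀ i, D (x i ^ Q) = 0 := by
    intro i
    obtain ⟨Q, rfl⟩ := hQ
    rw [D.leibniz_pow, ← Nat.cast_smul_eq_nsmul K, Nat.cast_mul, CharP.cast_eq_zero, zero_mul,
      zero_smul]
  have hDsum : ∑ i, D (β i) * x i ^ Q = 0 := by
    have h1 := congrArg D hsum
    rw [map_sum, map_zero] at h1
    rw [← h1]
    refine Finset.sum_congr rfl fun i _ => ?_
    rw [D.leibniz, hDx]
    simp [mul_comm]
  set η := crossProduct β (fun i => D (β i)) 2 with hη
  have hcross : ∀ j, crossProduct β (fun i => D (β i)) j = η * x j ^ Q := by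
    intro j
    rw [hη, cross_apply]
    rw [Fin.sum_univ_three, h.apply_two, one_pow, mul_one] at hsum hDsum
    fin_cases j
    · simp
      linear_combination β 1 * hDsum - D (β 1) * hsum
    · simp
      linear_combination D (β 0) * hsum - β 0 * hDsum
    · simp [h.apply_two]
  have hreg : ∀ i, s m ^ 2 * η ^ P * x i ^ (P * Q - 2 * e) ∈ Set.range (algebraMap k K) := by
    intro i
    apply mem_range_algebraMap_of_forall_valuationSubring
    intro O hk
    obtain ⟨j, hj⟩ := Finite.exists_max fun i => O.valuation (x i)
    obtain ⟨l, hl⟩ := Finite.exists_max fun i => O.valuation (s i)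
    have hj0 : x j ≠ 0 := by
      intro h0
      have := hj 2
      rw [h0, h.apply_two] at this
      simp at this
    have hl0 : s l ≠ 0 := by
      intro h0
      have := hl m
      rw [h0, map_zero, le_zero_iff, map_eq_zero] at this
      exact hsm this
    have hβl : β l ≠ 0 := by
      intro h0
      have := hβ l
      rw [h0, zero_pow hP, zero_mul] at this
      exact hl0 this.symm
    have hO : ∀ i, β i / β l ∈ O := by
      intro i
      have h1 : (β i / β l) ^ P = s i / s l := by
        rw [div_pow, ← hβ i, ← hβ l]
        field_simp
      rw [← O.valuation_le_one_iff, ← pow_le_one_iff hP, ← map_pow, h1, map_div₀]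
      exact div_le_one_of_le₀ (hl i) zero_le
    have hDO : ∀ i, D (β i / β l) ∈ O := fun i => h.derivation_mem hk (hO i)
    have h1 : η * x j ^ Q / β l ^ 2 ∈ O := by
      rw [← hcross, ← crossProduct_derivation_div D β hβl, cross_apply]
      fin_cases j <;> exact sub_mem (mul_mem (hO _) (hDO _)) (mul_mem (hO _) (hDO _))
    have h2 : s l / x j ^ e ∈ O := by
      obtain ⟨g, hg, hgl⟩ := mem_formValues.1 (hs l)
      rw [← hgl, ← aeval_div_of_isHomogeneous hg, ← O.valuation_le_one_iff]
      refine ValuationSubring.valuation_aeval_le_one hk (fun i => ?_) g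
      rw [map_div₀]
      exact div_le_one_of_le₀ (hj i) zero_le
    have h3 : s m ^ 2 * η ^ P * x j ^ (P * Q - 2 * e) =
        (η * x j ^ Q / β l ^ 2) ^ P * (s l / x j ^ e) ^ 2 := by
      have h4 : x j ^ (P * Q) = x j ^ (P * Q - 2 * e) * x j ^ (2 * e) :=
        (pow_sub_mul_pow _ he.le).symm
      have h6 : x j ^ (2 * e) = (x j ^ e) ^ 2 := by rw [mul_comm, pow_mul]
      have h7 : (β l ^ 2) ^ P = (β l ^ P) ^ 2 := pow_right_comm _ _ _
      have h8 : β l ^ P ≠ 0 := pow_ne_zero _ hβl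
      have h9 : x j ^ e ≠ 0 := pow_ne_zero _ hj0
      rw [div_pow, mul_pow, ← pow_mul, mul_comm Q P, h4, h6, h7, ← hβ l]
      generalize β l ^ P = u at *
      generalize x j ^ e = v at *
      field_simp
    have h5 : s m ^ 2 * η ^ P * x j ^ (P * Q - 2 * e) ∈ O := by
      rw [h3]; exact mul_mem (pow_mem h1 _) (pow_mem h2 _)
    rw [← O.valuation_le_one_iff] at h5 ⊢
    refine le_trans ?_ h5
    rw [map_mul, map_mul _ _ (x j ^ _), map_pow _ (x i), map_pow _ (x j)]
    exact mul_le_mul_right (pow_le_pow_left₀ zero_le (hj i) _) _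
  have hη0 : η = 0 := by
    obtain ⟨c, hc⟩ := hreg 2
    obtain ⟨c', hc'⟩ := hreg 0
    rw [h.apply_two, one_pow, mul_one] at hc
    rw [← hc] at hc'
    by_cases hc0 : c = 0
    · rw [hc0, map_zero] at hc
      by_contra hne
      exact (mul_ne_zero (pow_ne_zero 2 hsm) (pow_ne_zero P hne)) hc.symm
    · exfalso
      have hc1 : algebraMap k K c ≠ 0 := by simpa using hc0
      have h6 : x 0 ^ (P * Q - 2 * e) = algebraMap k K (c' / c) := by
        rw [map_div₀, hc']; field_simp
      exact h.transcendental_zero (IsAlgebraic.of_pow (by omega) (h6 ▸ isAlgebraic_algebraMap _))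
  have hDm : D (β m) = 0 := by rw [hβm, D.map_one_eq_zero]
  simp only [hη0, zero_mul, cross_apply] at hcross
  have h0 := hcross 0
  have h1 := hcross 1
  have h2 := hcross 2
  simp only [Matrix.cons_val_zero, Matrix.cons_val_one, Matrix.cons_val] at h0 h1 h2
  clear * - hβm hDm h0 h1 h2
  have h01 : ∀ u v w y : K, u = 1 → v = 0 → u * w - y * v = 0 → w = 0 := by
    rintro u v w y rfl rfl h
    simpa using h
  have h02 : ∀ u v w y : K, u = 1 → v = 0 → y * v - u * w = 0 → w = 0 := by
    rintro u v w y rfl rfl h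
    simpa using h
  fin_cases m <;> fin_cases i
  · exact hDm
  · exact h01 _ _ _ _ hβm hDm h2
  · exact h02 _ _ _ _ hβm hDm h1
  · exact h02 _ _ _ _ hβm hDm h2
  · exact hDm
  · exact h01 _ _ _ _ hβm hDm h0
  · exact h01 _ _ _ _ hβm hDm h1
  · exact h02 _ _ _ _ hβm hDm h0
  · exact hDm

/-- There are no nontrivial relations of small degree among the `q`-th powers of
the coordinates. -/
lemma eq_zero_of_sum_mul_pow_eq_zero [IsAlgClosed k] (h : IsCubicFunctionField f x D) {p : ℕ}
    [Fact p.Prime] [CharP K p] {n e : ℕ} (he : 2 * e < p ^ n) {s : Fin 3 → K}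
    (hs : ∀ i, s i ∈ formValues (k := k) x e) (hsum : ∑ i, s i * x i ^ p ^ n = 0) (m : Fin 3) :
    s m = 0 := by
  by_contra hsm
  have hp : p.Prime := Fact.out
  have key : ∀ r, r ≤ n → ∃ β : Fin 3 → K, β m = 1 ∧ (∀ i, β i ^ p ^ r * s m = s i) ∧
      ∑ i, β i * x i ^ p ^ (n - r) = 0 := by
    intro r
    induction r with
    | zero =>
      intro _
      refine ⟨fun i => s i / s m, div_self hsm, fun i => by rw [pow_zero, pow_one]; field_simp, ?_⟩
      have : ∀ i, s i / s m * x i ^ p ^ (n - 0) = (s i * x i ^ p ^ n) / s m := fun i => by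
        rw [Nat.sub_zero]; ring
      simp only [this]
      rw [← Finset.sum_div, hsum, zero_div]
    | succ r ih =>
      intro hr
      obtain ⟨β, hβm, hβ, hβsum⟩ := ih (by omega)
      obtain ⟨t, ht⟩ : ∃ t, n - r = t + 1 := ⟨n - r - 1, by omega⟩
      have hD := h.derivation_eq_zero_of_sum_eq_zero (pow_ne_zero r hp.ne_zero)
        (dvd_pow_self p (by omega : n - r ≠ 0))
        (by rwa [← pow_add, Nat.add_sub_cancel' (by omega)]) hs hsm hβm hβ hβsum
      choose γ hγ using fun i => h.exists_pow_eq_of_derivation_eq_zero p (hD i)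
      refine ⟨γ, ?_, fun i => ?_, ?_⟩
      · apply frobenius_inj K p
        simp only [frobenius_def]
        rw [hγ, hβm, one_pow]
      · rw [pow_succ', pow_mul, hγ, hβ]
      · apply frobenius_inj K p
        rw [map_sum, map_zero, ← hβsum]
        refine Finset.sum_congr rfl fun i _ => ?_
        rw [frobenius_def, mul_pow, hγ, ← pow_mul, ← pow_succ, ht, show n - (r + 1) = t by omega]
  obtain ⟨β, hβm, hβ, hβsum⟩ := key n le_rfl
  have hk : ∀ i, β i ∈ Set.range (algebraMap k K) := by
    intro i
    rw [← isAlgebraic_iff_mem_range_algebraMap]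
    by_contra htr
    obtain ⟨φ, hφ⟩ : ∃ φ, φ ∉ IntermediateField.adjoin k {β i} := by
      by_contra! hall
      exact h.adjoin_simple_ne_top (β i) (eq_top_iff.2 fun y _ => hall y)
    have hli : LinearIndependent (IntermediateField.adjoin k {β i}) ![1, φ] := by
      rw [LinearIndependent.pair_iff]
      intro a b hab
      have hb : b = 0 := by
        by_contra hb
        apply hφ
        have hb' : (b : K) ≠ 0 := by simpa using hb
        have : φ = ((-a / b : IntermediateField.adjoin k {β i}) : K) := by
          push_cast
          rw [eq_div_iff hb']
          simp only [IntermediateField.smul_def, smul_eq_mul] at hab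
          linear_combination hab
        rw [this]
        exact SetLike.coe_mem _
      subst hb
      simpa [IntermediateField.smul_def] using hab
    have := mul_le_of_pow_eq_div h.isHomogeneous h.ne_zero h.aeval_eq_zero h.apply_two
      h.adjoin_eq_top htr (hs i) (hs m) hsm (pow_pos hp.pos n)
      (by rw [eq_div_iff hsm, hβ]) hli
    omega
  choose b hb using hk
  refine h.aeval_ne_zero (n := 1) (g := ∑ i, C (b i) * X i) (by norm_num)
    (IsHomogeneous.sum _ _ _ fun i _ => isHomogeneous_C_mul_X _ _) ?_ ?_
  · intro h0
    have h1 := congrArg (eval (Pi.single m 1)) h0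
    have h2 : b m = 1 := by
      apply (algebraMap k K).injective
      rw [hb, hβm, map_one]
    simp [Pi.single_apply, h2] at h1
  · rw [Nat.sub_self, pow_zero] at hβsum
    simpa [hb] using hβsum

end IsCubicFunctionField

lemma MvPolynomial.homogeneousComponent_mul_of_totalDegree_le {σ R : Type*} [CommSemiring R]
    {a b : MvPolynomial σ R} {m n : ℕ} (ha : a.totalDegree ≤ m) (hb : b.totalDegree ≤ n) :
    homogeneousComponent (m + n) (a * b) =
      homogeneousComponent m a * homogeneousComponent n b := by
  classical
  ext d
  rw [coeff_homogeneousComponent]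
  split_ifs with hd
  · rw [coeff_mul, coeff_mul]
    refine Finset.sum_congr rfl fun y hy => ?_
    rw [coeff_homogeneousComponent, coeff_homogeneousComponent]
    have hy' : y.1.degree + y.2.degree = m + n := by
      rw [← hd, ← Finset.HasAntidiagonal.mem_antidiagonal.1 hy, map_add]
    split_ifs with h1 h2 h2
    · rfl
    · rw [mul_zero]
      have : b.coeff y.2 = 0 ∨ a.coeff y.1 = 0 := by omega
      rcases this with h | h <;> simp [h]
    · rw [zero_mul]
      have : b.coeff y.2 = 0 ∨ a.coeff y.1 = 0 := by omega
      rcases this with h | h <;> simp [h]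
    · rcases lt_or_gt_of_ne h1 with h3 | h3
      · rw [coeff_eq_zero_of_totalDegree_lt (f := b), mul_zero, mul_zero]
        change _ < y.2.degree
        omega
      · rw [coeff_eq_zero_of_totalDegree_lt (f := a), zero_mul, zero_mul]
        change _ < y.1.degree
        omega
  · exact (((homogeneousComponent_isHomogeneous m a).mul
      (homogeneousComponent_isHomogeneous n b)).coeff_eq_zero hd).symm

lemma MvPolynomial.IsHomogeneous.eval_smul {σ R : Type*} [CommSemiring R] {b : MvPolynomial σ R}
    {n : ℕ} (hb : b.IsHomogeneous n) (c : R) (v : σ → R) :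
    eval (c • v) b = c ^ n * eval v b := by
  rw [eval_eq, eval_eq, Finset.mul_sum]
  refine Finset.sum_congr rfl fun d hd => ?_
  have h1 : d.degree = n := by
    by_contra h
    exact (mem_support_iff.1 hd) (hb.coeff_eq_zero h)
  simp_rw [Pi.smul_apply, smul_eq_mul, mul_pow, Finset.prod_mul_distrib,
    Finset.prod_pow_eq_pow_sum]
  rw [← h1, Finsupp.degree_apply]
  ring

lemma MvPolynomial.IsHomogeneous.eval_add {σ R : Type*} [CommSemiring R] {a : MvPolynomial σ R}
    (ha : a.IsHomogeneous 1) (v w : σ → R) : eval (v + w) a = eval v a + eval w a := by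
  simp only [eval_eq, ← Finset.sum_add_distrib]
  refine Finset.sum_congr rfl fun d hd => ?_
  have h1 : d.degree = 1 := by
    by_contra h
    exact (mem_support_iff.1 hd) (ha.coeff_eq_zero h)
  obtain ⟨i, rfl⟩ := Finsupp.range_single_one.ge h1
  rw [← mul_add]
  simp

/-- A form has a zero on every line of the projective space over an algebraically closed field. -/
lemma MvPolynomial.IsHomogeneous.exists_eval_add_smul_eq_zero {σ k : Type*} [Field k]
    [IsAlgClosed k] {b : MvPolynomial σ k} {n : ℕ} (hb : b.IsHomogeneous n) (hn : n ≠ 0)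
    (u v : σ → k) : ∃ s t : k, (s ≠ 0 ∨ t ≠ 0) ∧ eval (s • u + t • v) b = 0 := by
  by_contra! hne
  let P (u v : σ → k) : Polynomial k :=
    MvPolynomial.aeval (fun i => Polynomial.C (u i) + Polynomial.X * Polynomial.C (v i)) b
  have hP : ∀ u v t, (P u v).eval t = eval (u + t • v) b := by
    intro u v t
    simp only [P]
    rw [← Polynomial.coe_aeval_eq_eval, ← AlgHom.comp_apply, comp_aeval,
      ← coe_aeval_eq_eval, RingHom.coe_coe]
    congr 2
    ext i
    simp [Polynomial.aeval_def]
    ring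
  have hdeg : (P u v).degree = 0 := by
    by_contra hdeg
    obtain ⟨t, ht⟩ := IsAlgClosed.exists_root (P u v) hdeg
    rw [Polynomial.IsRoot, hP] at ht
    exact hne 1 t (Or.inl one_ne_zero) (by rwa [one_smul])
  obtain ⟨c, hc⟩ := Polynomial.natDegree_eq_zero.1
    (Polynomial.natDegree_eq_of_degree_eq_some hdeg)
  have hR : ∀ s ≠ 0, (P v u).eval s = c * s ^ n := by
    intro s hs
    have h1 := hP u v s⁻¹
    rw [← hc, Polynomial.eval_C] at h1
    have h2 : v + s • u = s • (u + s⁻¹ • v) := by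
      rw [smul_add, smul_smul, mul_inv_cancel₀ hs, one_smul, add_comm]
    rw [hP, h2, hb.eval_smul, h1]
    ring
  have hR' : Polynomial.X * (P v u - Polynomial.C c * Polynomial.X ^ n) = 0 := by
    refine Polynomial.funext fun s => ?_
    by_cases hs : s = 0
    · simp [hs]
    · simp [hR s hs]
  have h0 := (mul_eq_zero.1 hR').resolve_left Polynomial.X_ne_zero
  have h1 := congrArg (Polynomial.eval 0) h0
  simp only [Polynomial.eval_sub, Polynomial.eval_mul, hP] at h1
  refine hne 0 1 (Or.inr one_ne_zero) ?_
  simpa [hn] using h1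

lemma MvPolynomial.IsHomogeneous.exists_common_zero {k : Type*} [Field k] [IsAlgClosed k]
    {a b : MvPolynomial (Fin 3) k} {n : ℕ} (ha : a.IsHomogeneous 1) (hb : b.IsHomogeneous n)
    (hn : n ≠ 0) : ∃ w : Fin 3 → k, w ≠ 0 ∧ eval w a = 0 ∧ eval w b = 0 := by
  let L : (Fin 3 → k) →ₗ[k] k :=
    { toFun := fun w => eval w a
      map_add' := fun v w => ha.eval_add v w
      map_smul' := fun c w => by
        simpa using ha.eval_smul c w }
  have hker : 1 < Module.finrank k L.ker := by
    have h1 := L.finrank_range_add_finrank_ker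
    have h2 := Submodule.finrank_le L.range
    rw [Module.finrank_self] at h2
    rw [Module.finrank_fin_fun] at h1
    omega
  obtain ⟨u, hu⟩ := Module.finrank_pos_iff_exists_ne_zero.1 (zero_lt_one.trans hker)
  obtain ⟨v, huv⟩ := exists_linearIndependent_pair_of_one_lt_finrank hker hu
  obtain ⟨s, t, hst, h0⟩ := hb.exists_eval_add_smul_eq_zero hn (u : Fin 3 → k) v
  refine ⟨s • u + t • v, fun h => ?_, ?_, h0⟩
  · have := (LinearIndependent.pair_iff.1 huv) s t (Subtype.ext h)
    tauto
  · exact (s • u + t • v).2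

theorem MvPolynomial.irreducible_of_smooth {k : Type*} [Field k] [IsAlgClosed k]
    {f : MvPolynomial (Fin 3) k} (hf : f.IsHomogeneous 3)
    (hsmooth : ∀ a : Fin 3 → k, eval a f = 0 → (∀ i, eval a (pderiv i f) = 0) → a = 0) :
    Irreducible f := by
  have hf0 : f ≠ 0 := by
    rintro rfl
    exact one_ne_zero (congrFun (hsmooth 1 (by simp) (by simp)) 0)
  have key : ∀ a b : MvPolynomial (Fin 3) k, f = a * b → a.totalDegree = 1 → False := by
    intro a b hab ha
    have hb : a.totalDegree + b.totalDegree = 3 := by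
      have ha0 : a ≠ 0 := by rintro rfl; simp_all
      have hb0 : b ≠ 0 := by rintro rfl; simp_all
      rw [← totalDegree_mul_of_isDomain ha0 hb0, ← hab, hf.totalDegree hf0]
    have hfab : f = homogeneousComponent 1 a * homogeneousComponent 2 b := by
      rw [← homogeneousComponent_mul_of_totalDegree_le ha.le (by omega), ← hab,
        homogeneousComponent_eq_self hf]
    obtain ⟨w, hw, hwa, hwb⟩ := (homogeneousComponent_isHomogeneous 1 a).exists_common_zero
      (homogeneousComponent_isHomogeneous 2 b) two_ne_zero
    refine hw (hsmooth w ?_ fun i => ?_)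
    · rw [hfab, map_mul, hwa, zero_mul]
    · rw [hfab, Derivation.leibniz, smul_eq_mul, smul_eq_mul, map_add, map_mul, map_mul, hwa, hwb]
      ring
  refine ⟨fun hu => ?_, fun a b hab => ?_⟩
  · have := (isUnit_iff_totalDegree_of_isReduced.1 hu).2
    rw [hf.totalDegree hf0] at this
    omega
  · have ha0 : a ≠ 0 := by rintro rfl; simp_all
    have hb0 : b ≠ 0 := by rintro rfl; simp_all
    have hd : a.totalDegree + b.totalDegree = 3 := by
      rw [← totalDegree_mul_of_isDomain ha0 hb0, ← hab, hf.totalDegree hf0]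
    have ha1 : a.totalDegree ≠ 1 := key a b hab
    have hb1 : b.totalDegree ≠ 1 := key b a (hab.trans (mul_comm a b))
    have hunit : ∀ c : MvPolynomial (Fin 3) k, c ≠ 0 → c.totalDegree = 0 → IsUnit c := by
      intro c hc0 hc
      rw [totalDegree_eq_zero_iff_eq_C] at hc
      rw [hc] at hc0 ⊢
      exact (isUnit_iff_ne_zero.2 fun h => hc0 (by rw [h, map_zero])).map C
    by_cases h : a.totalDegree = 0
    · exact Or.inl (hunit a ha0 h)
    · exact Or.inr (hunit b hb0 (by omega))

/-- A derivation of a domain extends to its field of fractions. -/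
lemma Derivation.exists_extension_fractionRing {k A F : Type*} [CommRing k] [CommRing A]
    [Algebra k A] [Field F] [Algebra A F] [Algebra k F] [IsScalarTower k A F] [IsFractionRing A F]
    (d : Derivation k A A) :
    ∃ D : Derivation k F F, ∀ a, D (algebraMap A F a) = algebraMap A F (d a) := by
  let φ : A →ₐ[k] TrivSqZeroExt F F :=
    { toFun := fun a => TrivSqZeroExt.inl (algebraMap A F a) +
        TrivSqZeroExt.inr (algebraMap A F (d a))
      map_one' := by ext <;> simp
      map_zero' := by ext <;> simp
      map_mul' := fun a b => by ext <;> simp [-DualNumber.inr_eq_smul_eps, mul_comm]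
      map_add' := fun a b => by ext <;> simp [-DualNumber.inr_eq_smul_eps]
      commutes' := fun c => by
        rw [d.map_algebraMap, map_zero, TrivSqZeroExt.inr_zero, add_zero,
          TrivSqZeroExt.algebraMap_eq_inl', ← IsScalarTower.algebraMap_apply] }
  have hφ1 : ∀ a, (φ a).fst = algebraMap A F a := fun a => by simp [φ]
  have hφ2 : ∀ a, (φ a).snd = algebraMap A F (d a) := fun a => by
    simp [φ, -DualNumber.inr_eq_smul_eps]
  have hφ : ∀ y : nonZeroDivisors A, IsUnit (φ y) := by
    intro y
    rw [TrivSqZeroExt.isUnit_iff_isUnit_fst, hφ1]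
    exact IsLocalization.map_units F y
  let Φ : F →ₐ[k] TrivSqZeroExt F F := IsLocalization.liftAlgHom hφ
  have hΦ : ∀ a, Φ (algebraMap A F a) = φ a := fun a => IsLocalization.lift_eq hφ a
  have hfst : ∀ u, (Φ u).fst = u := by
    have h : ((TrivSqZeroExt.fstHom k F F).comp Φ).toRingHom = RingHom.id F := by
      refine IsLocalization.ringHom_ext (nonZeroDivisors A) (RingHom.ext fun a => ?_)
      exact (congrArg TrivSqZeroExt.fst (hΦ a)).trans (hφ1 a)
    exact fun u => RingHom.congr_fun h u
  refine ⟨Derivation.mk' ((TrivSqZeroExt.sndHom F F).restrictScalars k ∘ₗ Φ.toLinearMap)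
    fun u v => ?_, fun a => (congrArg TrivSqZeroExt.snd (hΦ a)).trans (hφ2 a)⟩
  have h := congrArg TrivSqZeroExt.snd (map_mul Φ u v)
  rw [TrivSqZeroExt.snd_mul, hfst, hfst, op_smul_eq_smul] at h
  exact h

/-- A derivation preserves the intermediate field generated by a set if it maps the generators
into it. -/
lemma Derivation.exists_restrict_adjoin {k F : Type*} [Field k] [Field F] [Algebra k F]
    (D : Derivation k F F) (s : Set F)
    (hs : ∀ y ∈ s, D y ∈ IntermediateField.adjoin k s) :
    ∃ D' : Derivation k (IntermediateField.adjoin k s) (IntermediateField.adjoin k s),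
      ∀ y, (D' y : F) = D y := by
  have hD : ∀ y ∈ IntermediateField.adjoin k s, D y ∈ IntermediateField.adjoin k s := by
    intro y hy
    induction hy using IntermediateField.adjoin_induction with
    | mem y hy => exact hs y hy
    | algebraMap c => rw [D.map_algebraMap]; exact zero_mem _
    | add y z _ _ hy hz => rw [map_add]; exact add_mem hy hz
    | inv y hy' hy =>
      rw [D.leibniz_inv, smul_eq_mul]
      exact mul_mem (neg_mem (pow_mem (inv_mem hy') 2)) hy
    | mul y z hy' hz' hy hz =>
      rw [D.leibniz]
      exact add_mem (mul_mem hy' hz) (mul_mem hz' hy)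
  refine ⟨Derivation.mk'
    { toFun := fun y => ⟨D y, hD y y.2⟩
      map_add' := fun y z => Subtype.ext (by simp)
      map_smul' := fun c y => Subtype.ext (by simp) }
    fun y z => Subtype.ext ?_, fun y => rfl⟩
  simp

/-- The function field of a smooth plane cubic. -/
theorem exists_isCubicFunctionField.{u} {k : Type u} [Field k] [IsAlgClosed k]
    {f : MvPolynomial (Fin 3) k} (hf : f.IsHomogeneous 3)
    (hsmooth : ∀ a : Fin 3 → k, eval a f = 0 → (∀ i, eval a (pderiv i f) = 0) → a = 0) :
    ∃ (K : Type u) (_ : Field K) (_ : Algebra k K) (x : Fin 3 → K) (D : Derivation k K K),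
      IsCubicFunctionField f x D := by
  have hirr := MvPolynomial.irreducible_of_smooth hf hsmooth
  have hf0 := hirr.ne_zero
  have hprime : (Ideal.span {f}).IsPrime :=
    (Ideal.span_singleton_prime hf0).2 hirr.prime
  let R := MvPolynomial (Fin 3) k ⧸ Ideal.span {f}
  let F := FractionRing R
  let π : MvPolynomial (Fin 3) k →ₐ[k] R := Ideal.Quotient.mkₐ k _
  have hπ0 : ∀ g, π g = 0 ↔ f ∣ g := fun g => by
    rw [← Ideal.mem_span_singleton]
    exact Ideal.Quotient.eq_zero_iff_mem
  let d : Derivation k (MvPolynomial (Fin 3) k) (MvPolynomial (Fin 3) k) :=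
    pderiv 1 f • pderiv 0 - pderiv 0 f • pderiv 1
  have hdf : d f = 0 := by
    simp [d, mul_comm]
  have hd : ∀ g, π g = 0 → π (d g) = 0 := by
    intro g hg
    rw [hπ0] at hg ⊢
    obtain ⟨g, rfl⟩ := hg
    rw [d.leibniz, hdf, smul_zero, add_zero]
    exact dvd_mul_right _ _
  obtain ⟨D, hD⟩ := (Derivation.liftOfSurjective (f := π)
    (Ideal.Quotient.mkₐ_surjective k _) hd).exists_extension_fractionRing (F := F)
  let x : Fin 3 → F := fun i => algebraMap R F (π (X i))
  have hx : ∀ g : MvPolynomial (Fin 3) k, aeval x g = algebraMap R F (π g) := by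
    intro g
    have : aeval x = (IsScalarTower.toAlgHom k R F).comp π := by
      ext i
      simp [x]
    rw [this]
    rfl
  have hDx : ∀ i, D (x i) = aeval x ((![pderiv 1 f, - pderiv 0 f, 0] : Fin 3 → _) i) := by
    intro i
    rw [hx, hD, Derivation.liftOfSurjective_apply]
    congr 2
    fin_cases i <;> simp [d, pderiv_X]
  have hx0 : ∀ g : MvPolynomial (Fin 3) k, aeval x g = 0 ↔ f ∣ g := by
    intro g
    rw [hx, ← hπ0, IsFractionRing.to_map_eq_zero_iff]
  have hx2 : x 2 ≠ 0 := by
    intro h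
    have h1 : aeval x (X 2 : MvPolynomial (Fin 3) k) = 0 := by rw [aeval_X, h]
    obtain ⟨r, hr⟩ := (hx0 _).1 h1
    have hr0 : r ≠ 0 := by
      rintro rfl
      exact X_ne_zero 2 (hr.trans (mul_zero f))
    have h2 := totalDegree_mul_of_isDomain hf0 hr0
    rw [← hr, totalDegree_X, hf.totalDegree hf0] at h2
    omega
  let ξ : Fin 3 → F := fun i => x i / x 2
  have hξ : ∀ {n : ℕ} {g : MvPolynomial (Fin 3) k}, g.IsHomogeneous n →
      aeval ξ g = aeval x g / x 2 ^ n := fun hg => aeval_div_of_isHomogeneous hg _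
  have hDξ : ∀ i, ((x 2)⁻¹ • D) (ξ i) =
      aeval ξ ((![pderiv 1 f, - pderiv 0 f, 0] : Fin 3 → _) i) := by
    intro i
    have h2 : D (x 2) = 0 := by rw [hDx]; simp
    have hg : ((![pderiv 1 f, - pderiv 0 f, 0] : Fin 3 → MvPolynomial (Fin 3) k) i).IsHomogeneous
        2 := by
      fin_cases i
      · exact hf.pderiv
      · exact hf.pderiv.neg
      · exact isHomogeneous_zero _ _ _
    rw [hξ hg, ← hDx, Derivation.smul_apply]
    simp only [ξ]
    rw [div_eq_mul_inv, D.leibniz, D.leibniz_inv, h2]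
    simp only [smul_eq_mul]
    ring
  let E := IntermediateField.adjoin k (Set.range ξ)
  have hξE : ∀ i, ξ i ∈ E := fun i => IntermediateField.subset_adjoin _ _ ⟨i, rfl⟩
  let η : Fin 3 → E := fun i => ⟨ξ i, hξE i⟩
  have hη : ∀ g : MvPolynomial (Fin 3) k, (aeval η g : F) = aeval ξ g := by
    intro g
    exact (aeval_algebraMap_apply (A := E) F η g).symm
  obtain ⟨D', hD'⟩ := ((x 2)⁻¹ • D).exists_restrict_adjoin (Set.range ξ) (by
    rintro _ ⟨i, rfl⟩
    rw [hDξ, ← hη]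
    exact SetLike.coe_mem _)
  have hD'η : ∀ i, D' (η i) = aeval η ((![pderiv 1 f, - pderiv 0 f, 0] : Fin 3 → _) i) := by
    intro i
    apply Subtype.ext
    rw [hD', hη]
    exact hDξ i
  have hη2 : η 2 = 1 := Subtype.ext (div_self hx2)
  have hηf : aeval η f = 0 := by
    apply Subtype.ext
    rw [hη, hξ hf, (hx0 f).2 dvd_rfl, zero_div]
    rfl
  refine ⟨E, inferInstance, inferInstance, η, D', hf, hsmooth, hη2, ?_, hηf, ?_, ?_⟩
  · apply IntermediateField.lift_injective E
    rw [IntermediateField.lift_adjoin, IntermediateField.lift_top, ← Set.range_comp]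
    rfl
  · intro n g hg h0
    have h1 := congrArg (Subtype.val) h0
    rw [hη, hξ hg] at h1
    rw [← hx0]
    exact (div_eq_zero_iff.1 h1).resolve_right (pow_ne_zero _ hx2)
  · have heuler := congrArg (aeval η) hf.sum_X_mul_pderiv
    rw [map_nsmul, hηf, smul_zero, Fin.sum_univ_three] at heuler
    simp only [map_add, map_mul, aeval_X, hη2, one_mul] at heuler
    ext i
    rw [cross_apply]
    simp only [hD'η, hη2]
    congr 1
    fin_cases i
    · simp
    · simp
    · simp
      linear_combination -heuler

namespace MvPolynomial

variable {σ k : Type*} [CommRing k]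

lemma homogeneousComponent_mul_of_isHomogeneous (a : MvPolynomial σ k) {b : MvPolynomial σ k}
    {n : ℕ} (hb : b.IsHomogeneous n) (N : ℕ) : homogeneousComponent N (a * b) =
      if n ≤ N then homogeneousComponent (N - n) a * b else 0 := by
  classical
  have key : ∀ d : σ →₀ ℕ, ∀ y ∈ Finset.HasAntidiagonal.antidiagonal d, coeff y.2 b ≠ 0 →
      y.1.degree + n = d.degree := by
    intro d y hy hyb
    rw [← Finset.HasAntidiagonal.mem_antidiagonal.1 hy, map_add]
    by_contra h
    exact hyb (hb.coeff_eq_zero fun h' => h (by rw [h']))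
  ext d
  rw [coeff_homogeneousComponent]
  split_ifs with hd hN hN
  · rw [coeff_mul, coeff_mul]
    refine Finset.sum_congr rfl fun y hy => ?_
    by_cases hyb : coeff y.2 b = 0
    · rw [hyb, mul_zero, mul_zero]
    · have := key d y hy hyb
      rw [coeff_homogeneousComponent, if_pos (by omega)]
  · rw [coeff_mul, coeff_zero]
    refine Finset.sum_eq_zero fun y hy => ?_
    by_cases hyb : coeff y.2 b = 0
    · rw [hyb, mul_zero]
    · have := key d y hy hyb
      omega
  · refine (((homogeneousComponent_isHomogeneous (N - n) a).mul hb).coeff_eq_zero ?_).symm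
    rwa [Nat.sub_add_cancel hN]
  · rw [coeff_zero]

lemma mem_span_range_X_pow {q : ℕ} {P : MvPolynomial σ k} :
    P ∈ Ideal.span (Set.range fun i => (X i : MvPolynomial σ k) ^ q) ↔
      ∀ μ, coeff μ P ≠ 0 → ∃ i, q ≤ μ i := by
  have h : (Set.range fun i => (X i : MvPolynomial σ k) ^ q) =
      (fun s => monomial s (1 : k)) '' Set.range fun i => Finsupp.single i q := by
    rw [← Set.range_comp]
    congr 1
    ext1 i
    simp [X_pow_eq_monomial]
  rw [h, mem_ideal_span_monomial_image]
  simp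

/-- The polynomial corresponding to the functional `φ` under the duality between the monomials
dividing `m`. -/
noncomputable def dualPolynomial [DecidableEq σ] (m : σ →₀ ℕ) (φ : MvPolynomial σ k →ₗ[k] k) :
    MvPolynomial σ k :=
  ∑ ν ∈ Finset.Iic m, monomial ν (φ (monomial (m - ν) 1))

variable [DecidableEq σ] {m : σ →₀ ℕ} {φ : MvPolynomial σ k →ₗ[k] k}

lemma coeff_dualPolynomial (ν : σ →₀ ℕ) :
    coeff ν (dualPolynomial m φ) = if ν ≤ m then φ (monomial (m - ν) 1) else 0 := by
  simp [dualPolynomial, coeff_sum, coeff_monomial]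

lemma coeff_mul_dualPolynomial (hφ : ∀ μ, ¬ μ ≤ m → φ (monomial μ 1) = 0) (a : MvPolynomial σ k)
    {δ : σ →₀ ℕ} (hδ : δ ≤ m) :
    coeff δ (a * dualPolynomial m φ) = φ (a * monomial (m - δ) 1) := by
  induction a using MvPolynomial.induction_on' with
  | monomial α c =>
    have hc : φ (monomial (α + (m - δ)) c) = c * φ (monomial (α + (m - δ)) 1) := by
      rw [← smul_eq_mul, ← map_smul, smul_monomial, smul_eq_mul, mul_one]
    rw [coeff_monomial_mul', monomial_mul, mul_one, hc]
    split_ifs with h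
    · rw [coeff_dualPolynomial, if_pos (tsub_le_self.trans hδ),
        show m - (δ - α) = α + (m - δ) from ?_]
      rw [tsub_tsub_eq_add_tsub_of_le h, add_comm m, add_tsub_assoc_of_le hδ]
    · rw [hφ, mul_zero]
      intro h'
      apply h
      have : α + (m - δ) ≤ δ + (m - δ) := by rwa [add_tsub_cancel_of_le hδ]
      exact (add_le_add_iff_right _).1 this
  | add a b ha hb => rw [add_mul, add_mul, coeff_add, map_add, ha, hb]

lemma isHomogeneous_dualPolynomial {i : ℕ} (hφ : ∀ μ, μ.degree ≠ i → φ (monomial μ 1) = 0) :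
    (dualPolynomial m φ).IsHomogeneous (m.degree - i) := by
  refine IsHomogeneous.sum _ _ _ fun ν hν => ?_
  rw [Finset.mem_Iic] at hν
  by_cases h : (m - ν).degree = i
  · refine isHomogeneous_monomial _ ?_
    rw [← h]
    conv_rhs => rw [← tsub_add_cancel_of_le hν, map_add]
    simp
  · rw [hφ _ h, map_zero]
    exact isHomogeneous_zero _ _ _

end MvPolynomial

lemma IsCubicFunctionField.mem_span_range_X_pow_of_mul_mem {k K : Type*} [Field k]
    [IsAlgClosed k] [Field K] [Algebra k K] {f : MvPolynomial (Fin 3) k} {x : Fin 3 → K}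
    {D : Derivation k K K} (h : IsCubicFunctionField f x D) {p : ℕ}
    [Fact p.Prime] [CharP K p] {n d : ℕ} (hd : 2 * (d + 3 - p ^ n) < p ^ n)
    {g : MvPolynomial (Fin 3) k} (hg : g.IsHomogeneous d)
    (hfg : f * g ∈ Ideal.span (Set.range fun i => (X i : MvPolynomial (Fin 3) k) ^ p ^ n)) :
    g ∈ Ideal.span (Set.range fun i => (X i : MvPolynomial (Fin 3) k) ^ p ^ n) := by
  obtain ⟨c, hc⟩ := Ideal.mem_span_range_iff_exists_fun.1 hfg
  obtain ⟨b, hb, hbs⟩ : ∃ b : Fin 3 → MvPolynomial (Fin 3) k,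
      (∀ i, (b i).IsHomogeneous (d + 3 - p ^ n)) ∧ ∑ i, b i * X i ^ p ^ n = f * g := by
    refine ⟨fun i => if p ^ n ≤ d + 3 then homogeneousComponent (d + 3 - p ^ n) (c i) else 0,
      fun i => ?_, ?_⟩
    · dsimp only
      split_ifs
      · exact homogeneousComponent_isHomogeneous _ _
      · exact isHomogeneous_zero _ _ _
    · have hfg' : (f * g).IsHomogeneous (d + 3) := by
        rw [add_comm]
        exact h.isHomogeneous.mul hg
      have := congrArg (homogeneousComponent (d + 3)) hc
      rw [homogeneousComponent_of_mem hfg', if_pos rfl, map_sum] at this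
      rw [← this]
      refine Finset.sum_congr rfl fun i _ => ?_
      rw [homogeneousComponent_mul_of_isHomogeneous (c i) (isHomogeneous_X_pow i (p ^ n)), ite_mul,
        zero_mul]
  have hdvd : ∀ i, f ∣ b i := fun i => h.dvd_of_aeval_eq_zero (hb i) <|
    h.eq_zero_of_sum_mul_pow_eq_zero hd (s := fun i => aeval x (b i))
      (fun i => mem_formValues.2 ⟨b i, hb i, rfl⟩)
      (by simpa [h.aeval_eq_zero] using congrArg (aeval x) hbs) i
  choose r hr using hdvd
  refine Ideal.mem_span_range_iff_exists_fun.2 ⟨r, mul_left_cancel₀ h.ne_zero ?_⟩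
  rw [← hbs, Finset.mul_sum]
  refine Finset.sum_congr rfl fun i _ => ?_
  rw [hr i, mul_assoc]

namespace MvPolynomial

/-- Membership in `(f, X i ^ q)` in degree `i` is dual to membership in `((X i ^ q) : f)` in the
complementary degree. -/
lemma mem_span_insert_range_X_pow {σ k : Type*} [Fintype σ] [Field k] {f : MvPolynomial σ k}
    {l q i : ℕ} (hf : f.IsHomogeneous l) (hq : 0 < q)
    (H : ∀ g : MvPolynomial σ k, g.IsHomogeneous (Fintype.card σ * (q - 1) - i) →
      f * g ∈ Ideal.span (Set.range fun j => (X j : MvPolynomial σ k) ^ q) →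
      g ∈ Ideal.span (Set.range fun j => (X j : MvPolynomial σ k) ^ q))
    {g : MvPolynomial σ k} (hg : g.IsHomogeneous i) :
    g ∈ Ideal.span (insert f (Set.range fun j => (X j : MvPolynomial σ k) ^ q)) := by
  classical
  set I := Ideal.span (insert f (Set.range fun j => (X j : MvPolynomial σ k) ^ q)) with hI
  by_contra hgI
  obtain ⟨φ₀, hφ₀g, hφ₀⟩ := Submodule.exists_le_ker_of_notMem (p := I.restrictScalars k) hgI
  set φ : MvPolynomial σ k →ₗ[k] k := φ₀ ∘ₗ homogeneousComponent i with hφ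
  have hφg : φ g ≠ 0 := by
    rwa [hφ, LinearMap.comp_apply, homogeneousComponent_of_mem hg, if_pos rfl]
  have hφI : ∀ (a : MvPolynomial σ k) {b : MvPolynomial σ k} {e : ℕ}, b.IsHomogeneous e →
      b ∈ I → φ (a * b) = 0 := by
    intro a b e hb hbI
    rw [hφ, LinearMap.comp_apply, homogeneousComponent_mul_of_isHomogeneous a hb]
    split_ifs
    · exact hφ₀ (I.mul_mem_left _ hbI)
    · exact map_zero _
  set m : σ →₀ ℕ := Finsupp.equivFunOnFinite.symm fun _ => q - 1 with hm
  have hmj : ∀ j, m j = q - 1 := fun j => rfl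
  have hmdeg : m.degree = Fintype.card σ * (q - 1) := by
    simp [Finsupp.degree_eq_sum, hmj]
  have hle : ∀ {μ : σ →₀ ℕ}, μ ≤ m ↔ ∀ j, μ j < q := fun {μ} =>
    forall_congr' fun j => by rw [hmj]; omega
  have hφm : ∀ μ, ¬ μ ≤ m → φ (monomial μ 1) = 0 := by
    intro μ hμ
    rw [hle] at hμ
    push Not at hμ
    obtain ⟨j, hj⟩ := hμ
    have hμj : monomial μ (1 : k) = monomial (μ - Finsupp.single j q) 1 * X j ^ q := by
      rw [X_pow_eq_monomial, monomial_mul, mul_one,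
        tsub_add_cancel_of_le (Finsupp.single_le_iff.2 hj)]
    rw [hμj]
    exact hφI _ (isHomogeneous_X_pow j q) (Ideal.subset_span (Or.inr ⟨j, rfl⟩))
  have hφi : ∀ μ : σ →₀ ℕ, μ.degree ≠ i → φ (monomial μ 1) = 0 := by
    intro μ hμ
    rw [hφ, LinearMap.comp_apply, homogeneousComponent_of_mem (isHomogeneous_monomial 1 rfl),
      if_neg (Ne.symm hμ), map_zero]
  have hmem : dualPolynomial m φ ∈
      Ideal.span (Set.range fun j => (X j : MvPolynomial σ k) ^ q) := by
    refine H _ (hmdeg ▸ isHomogeneous_dualPolynomial hφi) (mem_span_range_X_pow.2 fun μ hμ => ?_)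
    contrapose! hμ
    rw [coeff_mul_dualPolynomial hφm _ (hle.2 hμ), mul_comm]
    exact hφI _ hf (Ideal.subset_span (Or.inl rfl))
  have hφ0 : φ = 0 := by
    refine LinearMap.ext fun P => ?_
    have hmon : ∀ μ, φ (monomial μ 1) = 0 := by
      intro μ
      by_contra hne
      have hμ : μ ≤ m := by
        by_contra hμ
        exact hne (hφm μ hμ)
      obtain ⟨j, hj⟩ := mem_span_range_X_pow.1 hmem (m - μ) (by
        rwa [coeff_dualPolynomial, if_pos tsub_le_self, tsub_tsub_cancel_of_le hμ])
      rw [Finsupp.tsub_apply, hmj] at hj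
      omega
    induction P using MvPolynomial.induction_on' with
    | monomial μ c =>
      rw [← mul_one c, ← smul_eq_mul, ← smul_monomial, map_smul, hmon, smul_zero]
      rfl
    | add P Q hP hQ => rw [map_add, map_add, hP, hQ]
  exact hφg (by rw [hφ0]; rfl)

end MvPolynomial

/-- The exponents of the monomials of degree `d` whose exponents are all less than `q`. -/
def boxExponents {σ : Type*} [Fintype σ] [DecidableEq σ] (q d : ℕ) : Finset (σ → ℕ) :=
  {μ ∈ Fintype.piFinset fun _ => Finset.range q | ∑ j, μ j = d}

lemma mem_boxExponents {σ : Type*} [Fintype σ] [DecidableEq σ] {q d : ℕ} {μ : σ → ℕ} :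
    μ ∈ boxExponents q d ↔ (∀ j, μ j < q) ∧ ∑ j, μ j = d := by
  simp [boxExponents]

lemma card_boxExponents_lt (r : ℕ) (hr : 0 < r) :
    (boxExponents (σ := Fin 3) (2 * r + 1) (3 * r - 2)).card <
      (boxExponents (σ := Fin 3) (2 * r + 1) (3 * r + 1)).card := by
  set F : (Fin 3 → ℕ) → (Fin 3 → ℕ) := fun μ =>
    if μ 2 < 2 * r then ![2 * r - μ 0, 2 * r - μ 1, 2 * r - 1 - μ 2]
    else ![μ 0, μ 1 + 3, 2 * r] with hF
  have hmem : ![r + 1, 0, 2 * r] ∈ boxExponents (σ := Fin 3) (2 * r + 1) (3 * r + 1) := by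
    simp only [mem_boxExponents, Fin.forall_fin_succ, Fin.sum_univ_three]
    simp
    omega
  refine lt_of_le_of_lt (Finset.card_le_card_of_injOn F
    (t := (boxExponents (2 * r + 1) (3 * r + 1)).erase ![r + 1, 0, 2 * r]) ?_ ?_)
    (Finset.card_erase_lt_of_mem hmem)
  · intro μ hμ
    simp only [Finset.mem_coe, mem_boxExponents, Fin.forall_fin_succ, Fin.sum_univ_three] at hμ
    simp only [Finset.coe_erase, Set.mem_sdiff, Finset.mem_coe, mem_boxExponents,
      Fin.forall_fin_succ, Fin.sum_univ_three, Set.mem_singleton_iff, funext_iff, hF]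
    split_ifs <;> simp_all <;> omega
  · intro μ hμ ν hν h
    simp only [Finset.mem_coe, mem_boxExponents, Fin.forall_fin_succ, Fin.sum_univ_three] at hμ hν
    have h₀ := congrFun h 0
    have h₁ := congrFun h 1
    have h₂ := congrFun h 2
    have hext : μ 0 = ν 0 ∧ μ 1 = ν 1 ∧ μ 2 = ν 2 := by
      simp only [hF] at h₀ h₁ h₂
      split_ifs at h₀ h₁ h₂ <;> simp at h₀ h₁ h₂ hμ hν <;> omega
    ext j
    fin_cases j
    exacts [hext.1, hext.2.1, hext.2.2]

namespace MvPolynomial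

/-- If multiplication by `f` cannot be surjective in degree `M` for dimension reasons, some
monomial of degree `M` lies outside `(f, X j ^ q)`. -/
lemma exists_notMem_span_insert_range_X_pow {σ k : Type*} [Fintype σ] [DecidableEq σ] [Field k]
    {f : MvPolynomial σ k} {l q M : ℕ} (hf : f.IsHomogeneous l) (hM : l ≤ M)
    (hcard : (boxExponents (σ := σ) q (M - l)).card < (boxExponents (σ := σ) q M).card) :
    ∃ g : MvPolynomial σ k, g.IsHomogeneous M ∧
      g ∉ Ideal.span (insert f (Set.range fun j => (X j : MvPolynomial σ k) ^ q)) := by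
  let e : (σ → ℕ) ≃ (σ →₀ ℕ) := Finsupp.equivFunOnFinite.symm
  let A : Matrix (boxExponents (σ := σ) q (M - l)) (boxExponents (σ := σ) q M) k :=
    Matrix.of fun ν μ => coeff (e μ) (f * monomial (e ν) 1)
  obtain ⟨w, hwA, hw⟩ := (Submodule.ne_bot_iff _).1
    (LinearMap.ker_ne_bot_of_finrank_lt (f := A.mulVecLin) (by simpa using hcard))
  let φ : MvPolynomial σ k →ₗ[k] k := ∑ μ : boxExponents (σ := σ) q M, w μ • lcoeff k (e μ)
  have hφ : ∀ P, φ P = ∑ μ : boxExponents (σ := σ) q M, w μ * coeff (e μ) P := fun P => by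
    simp [φ]
  have hφf : ∀ a, φ (f * a) = 0 := by
    intro a
    induction a using MvPolynomial.induction_on' with
    | monomial α c =>
      suffices h : φ (f * monomial α 1) = 0 by
        rw [show monomial α c = c • monomial α (1 : k) by simp [smul_monomial], mul_smul_comm,
          map_smul, h, smul_zero]
      obtain ⟨ν, rfl⟩ := e.surjective α
      rw [hφ]
      by_cases hν : ν ∈ boxExponents q (M - l)
      · have := congrFun (LinearMap.mem_ker.1 hwA) ⟨ν, hν⟩
        simpa [A, Matrix.mulVec, dotProduct, mul_comm] using this
      · refine Finset.sum_eq_zero fun μ _ => ?_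
        obtain ⟨hμ, hμM⟩ := mem_boxExponents.1 μ.2
        rw [coeff_mul_monomial']
        split_ifs with hle
        · rw [hf.coeff_eq_zero, zero_mul, mul_zero]
          intro hdeg
          refine hν (mem_boxExponents.2 ⟨fun j => (hle j).trans_lt (hμ j), ?_⟩)
          have h1 := congrArg Finsupp.degree (tsub_add_cancel_of_le hle)
          rw [map_add, hdeg, Finsupp.degree_eq_sum, Finsupp.degree_eq_sum] at h1
          change l + ∑ j, ν j = ∑ j, μ.1 j at h1
          omega
        · rw [mul_zero]
    | add a b ha hb => rw [mul_add, map_add, ha, hb, add_zero]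
  obtain ⟨μ, hμ⟩ := Function.ne_iff.1 hw
  refine ⟨monomial (e μ) 1, isHomogeneous_monomial _ ?_, fun hmem => hμ ?_⟩
  · rw [Finsupp.degree_eq_sum]
    exact (mem_boxExponents.1 μ.2).2
  obtain ⟨a, z, hz, hμz⟩ := Ideal.mem_span_insert.1 hmem
  have hφz : φ z = 0 := by
    rw [hφ]
    refine Finset.sum_eq_zero fun ν _ => ?_
    by_cases hν : coeff (e ν) z = 0
    · rw [hν, mul_zero]
    · obtain ⟨j, hj⟩ := mem_span_range_X_pow.1 hz _ hν
      exact absurd ((mem_boxExponents.1 ν.2).1 j) (not_lt.2 hj)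
  have := congrArg φ hμz
  rw [map_add, mul_comm, hφf, hφz, add_zero, hφ] at this
  have hcoeff : ∀ ν : boxExponents (σ := σ) q M,
      coeff (e ν) (monomial (e μ) (1 : k)) = if μ = ν then 1 else 0 := fun ν => by
    simp only [coeff_monomial, e.injective.eq_iff, Subtype.val_inj]
  simpa [hcoeff] using this

end MvPolynomial

/-- **Socle degree for plane elliptic curves in odd characteristic.**
If `f ∈ k[x,y,z]` is a homogeneous cubic over an algebraically closed field of odd
characteristic `p` defining a smooth curve, then for every `q = p^n` with `n ≥ 1`,
the socle degree of `k[x,y,z]/(f, x^q, y^q, z^q)` equals `(3q − 1)/2`. -/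
theorem socle_degree_elliptic_curve_odd_char
    (k : Type*) [Field k] [IsAlgClosed k] (p : ℕ) [Fact p.Prime] [CharP k p]
    (hodd : Odd p)
    (f : MvPolynomial (Fin 3) k) (hf : f.IsHomogeneous 3)
    (hsmooth : ∀ a : Fin 3 → k,
      eval a f = 0 → (∀ i : Fin 3, eval a (pderiv i f) = 0) → a = 0)
    (n : ℕ) (hn : 1 ≤ n) :
    (∃ g : MvPolynomial (Fin 3) k, g.IsHomogeneous ((3 * p ^ n - 1) / 2) ∧
        g ∉ Ideal.span {f, X 0 ^ p ^ n, X 1 ^ p ^ n, X 2 ^ p ^ n}) ∧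
      ∀ i : ℕ, (3 * p ^ n - 1) / 2 < i → ∀ g : MvPolynomial (Fin 3) k,
        g.IsHomogeneous i →
          g ∈ Ideal.span {f, X 0 ^ p ^ n, X 1 ^ p ^ n, X 2 ^ p ^ n} := by
  have hq : 3 ≤ p ^ n := calc
    3 ≤ p := by
      have := (Fact.out : p.Prime).two_le
      obtain ⟨s, hs⟩ := hodd
      omega
    _ ≤ p ^ n := Nat.le_self_pow (by omega) p
  obtain ⟨r, hr⟩ : Odd (p ^ n) := hodd.pow
  have hset : ({f, X 0 ^ p ^ n, X 1 ^ p ^ n, X 2 ^ p ^ n} : Set (MvPolynomial (Fin 3) k)) =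
      insert f (Set.range fun j => X j ^ p ^ n) := by
    congr 1
    ext g
    simp [Fin.exists_fin_succ, eq_comm]
  rw [hset]
  refine ⟨exists_notMem_span_insert_range_X_pow hf (by omega) ?_, fun i hi g hg => ?_⟩
  · rw [hr]
    convert card_boxExponents_lt r (by omega) using 3 <;> omega
  · obtain ⟨K, _, _, x, D, h⟩ := exists_isCubicFunctionField hf hsmooth
    have := charP_of_injective_algebraMap (algebraMap k K).injective p
    refine mem_span_insert_range_X_pow hf (by omega) (fun b hb hfb => ?_) hg
    refine h.mem_span_range_X_pow_of_mul_mem ?_ hb hfb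
    rw [Fintype.card_fin]
    omega
end

section
/- Let k be an algebraically closed field of characteristic p, let a₁, a₂ ∈ k be such that the polynomial Y² + a₁Y − a₂ has two distinct roots in k, and let f = z(y² + a₁xy − a₂x²) − x³ ∈ k[x,y,z] (a nodal plane cubic). Then for every power q = pⁿ of p: dim_k k[x,y,z]/(f, x^q, y^q, z^q) = (7q² − q − 3)/3 if q ≢ 2 (mod 3), and = (7q² − q − 5)/3 if q ≡ 2 (mod 3). -/
section Family

variable {A : Type*} [CommRing A]

/-- The element `b³ᵈ · ab²` of the coordinate ring of the nodal cubic `stz = s³ + t³`, parametrized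
by `s = a²b`, `t = ab²`, `z = a³ + b³`. -/
def nodalEdge (s t z : A) : ℕ → A
  | 0 => t
  | 1 => z * t - s ^ 2
  | d + 2 => z * nodalEdge s t z (d + 1) - s * t * nodalEdge s t z d

/-- The element `a³ᶜ b³ᵈ · ab²` of the coordinate ring of the nodal cubic `stz = s³ + t³`,
parametrized by `s = a²b`, `t = ab²`, `z = a³ + b³`. -/
def nodalMon (s t z : A) : ℕ → ℕ → A
  | 0, d => nodalEdge s t z d
  | c + 1, 0 => s * nodalEdge t s z c
  | c + 1, d + 1 => s * t * nodalMon s t z c d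

lemma mul_nodalMon_swap (s t z : A) (c d : ℕ) :
    s * nodalMon t s z d c = nodalMon s t z (c + 1) d := by
  induction d generalizing c with
  | zero => simp [nodalMon]
  | succ d ih =>
    cases c with
    | zero => simp [nodalMon]; ring
    | succ c => simp only [nodalMon]; rw [← ih]; ring

lemma mul_nodalEdge_succ {s t z : A} (h : s * t * z = s ^ 3 + t ^ 3) (d : ℕ) :
    s * nodalEdge s t z (d + 1) = t ^ 2 * nodalEdge s t z d := by
  induction d using Nat.twoStepInduction with
  | zero => simp only [nodalEdge]; linear_combination h
  | one => simp only [nodalEdge]; linear_combination z * h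
  | more d ih ih' =>
    simp only [nodalEdge] at *
    linear_combination z * ih' - s * t * ih

lemma mul_nodalMon_eq {s t z : A} (h : s * t * z = s ^ 3 + t ^ 3) (c d : ℕ) :
    s * nodalMon s t z c d = t * nodalMon t s z d c := by
  induction c generalizing d with
  | zero =>
    cases d with
    | zero => simp [nodalMon, nodalEdge]; ring
    | succ d => simp only [nodalMon]; rw [mul_nodalEdge_succ h]; ring
  | succ c ih =>
    cases d with
    | zero =>
      have h' : t * s * z = t ^ 3 + s ^ 3 := by linear_combination h
      simp only [nodalMon]; rw [mul_nodalEdge_succ h']; ring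
    | succ d => simp only [nodalMon]; linear_combination s * t * ih d

lemma mul_nodalMon_zero (s t z : A) (d : ℕ) :
    z * nodalMon s t z 0 d = nodalMon s t z 1 d + nodalMon s t z 0 (d + 1) := by
  cases d with
  | zero => simp [nodalMon, nodalEdge]; ring
  | succ d => simp [nodalMon, nodalEdge]

lemma mul_nodalMon (s t z : A) (c d : ℕ) :
    z * nodalMon s t z c d = nodalMon s t z (c + 1) d + nodalMon s t z c (d + 1) := by
  induction c generalizing d with
  | zero => exact mul_nodalMon_zero s t z d
  | succ c ih =>
    cases d with
    | zero =>
      have := mul_nodalMon_zero t s z c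
      rw [← mul_nodalMon_swap, ← mul_nodalMon_swap s t z (c + 1), ← mul_nodalMon_swap s t z c]
      linear_combination s * this
    | succ d => simp only [nodalMon]; linear_combination s * t * ih d

/-- In a ring satisfying the equation `stz = s³ + t³` there are elements `e n i`, for `0 < i < 3n`,
that multiply like the monomials `aⁱ b³ⁿ⁻ⁱ`, where `s = a²b`, `t = ab²`, `z = a³ + b³`. -/
lemma exists_nodal_monomials {s t z : A} (h : s * t * z = s ^ 3 + t ^ 3) :
    ∃ e : ℕ → ℕ → A, e 1 1 = t ∧ e 1 2 = s ∧ ∀ n i, 0 < i → i < 3 * n →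
      s * e n i = e (n + 1) (i + 2) ∧ t * e n i = e (n + 1) (i + 1) ∧
      z * e n i = e (n + 1) i + e (n + 1) (i + 3) := by
  let e : ℕ → ℕ → A := fun n i =>
    if i % 3 = 1 then nodalMon s t z (i / 3) (n - 1 - i / 3)
    else if i % 3 = 2 then nodalMon t s z (n - 1 - i / 3) (i / 3)
    else s * nodalMon s t z (i / 3 - 1) (n - 1 - i / 3)
  have e1 (c d n i : ℕ) (hn : n = c + d + 1) (hi : i = 3 * c + 1) :
      e n i = nodalMon s t z c d := by
    have h1 : i % 3 = 1 := by omega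
    have h2 : i / 3 = c := by omega
    have h3 : n - 1 - c = d := by omega
    simp only [e, h1, h2, h3, if_true]
  have e2 (c d n i : ℕ) (hn : n = c + d + 1) (hi : i = 3 * c + 2) :
      e n i = nodalMon t s z d c := by
    have h1 : i % 3 = 2 := by omega
    have h2 : i / 3 = c := by omega
    have h3 : n - 1 - c = d := by omega
    simp [e, h1, h2, h3]
  have e3 (c d n i : ℕ) (hn : n = c + d + 2) (hi : i = 3 * c + 3) :
      e n i = s * nodalMon s t z c d := by
    have h1 : i % 3 = 0 := by omega
    have h2 : i / 3 = c + 1 := by omega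
    have h3 : n - 1 - (c + 1) = d := by omega
    simp [e, h1, h2, h3]
  refine ⟨e, ?_, ?_, fun n i hi hin => ?_⟩
  · rw [e1 0 0 1 1 rfl rfl]; rfl
  · rw [e2 0 0 1 2 rfl rfl]; rfl
  have key := mul_nodalMon_eq h
  obtain hi3 | hi3 | hi3 : i % 3 = 1 ∨ i % 3 = 2 ∨ i % 3 = 0 := by omega
  · obtain ⟨c, d, rfl, rfl⟩ : ∃ c d, i = 3 * c + 1 ∧ n = c + d + 1 :=
      ⟨i / 3, n - 1 - i / 3, by omega, by omega⟩
    rw [e1 c d _ _ rfl rfl, e3 c d _ (3 * c + 1 + 2) (by omega) (by omega),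
      e2 c (d + 1) _ (3 * c + 1 + 1) (by omega) (by omega),
      e1 c (d + 1) _ (3 * c + 1) (by omega) (by omega),
      e1 (c + 1) d _ (3 * c + 1 + 3) (by omega) (by omega)]
    exact ⟨rfl, mul_nodalMon_swap t s z d c, by rw [mul_nodalMon, add_comm]⟩
  · obtain ⟨c, d, rfl, rfl⟩ : ∃ c d, i = 3 * c + 2 ∧ n = c + d + 1 :=
      ⟨i / 3, n - 1 - i / 3, by omega, by omega⟩
    rw [e2 c d _ _ rfl rfl, e1 (c + 1) d _ (3 * c + 2 + 2) (by omega) (by omega),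
      e3 c d _ (3 * c + 2 + 1) (by omega) (by omega),
      e2 c (d + 1) _ (3 * c + 2) (by omega) (by omega),
      e2 (c + 1) d _ (3 * c + 2 + 3) (by omega) (by omega)]
    exact ⟨mul_nodalMon_swap s t z c d, (key c d).symm, mul_nodalMon t s z d c⟩
  · obtain ⟨c, d, rfl, rfl⟩ : ∃ c d, i = 3 * c + 3 ∧ n = c + d + 2 :=
      ⟨i / 3 - 1, n - 1 - i / 3, by omega, by omega⟩
    rw [e3 c d _ _ rfl rfl, e2 (c + 1) (d + 1) _ (3 * c + 3 + 2) (by omega) (by omega),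
      e1 (c + 1) (d + 1) _ (3 * c + 3 + 1) (by omega) (by omega),
      e3 c (d + 1) _ (3 * c + 3) (by omega) (by omega),
      e3 (c + 1) d _ (3 * c + 3 + 3) (by omega) (by omega)]
    refine ⟨?_, ?_, ?_⟩
    · rw [key]; simp only [nodalMon]; ring
    · simp only [nodalMon]; ring
    · linear_combination s * mul_nodalMon s t z c d

end Family

section Family

variable {A : Type*} [CommRing A] {s t z : A} {e : ℕ → ℕ → A}

lemma pow_mul_of_mul_shift {x : A} {δ : ℕ} (hδ : δ < 3)
    (he : ∀ n i, 0 < i → i < 3 * n → x * e n i = e (n + 1) (i + δ)) (m : ℕ) {n i : ℕ}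
    (hi : 0 < i) (hin : i < 3 * n) : x ^ m * e n i = e (n + m) (i + δ * m) := by
  induction m with
  | zero => simp
  | succ m ih =>
    have : δ * m ≤ 3 * m := by gcongr
    rw [pow_succ', mul_assoc, ih, he _ _ (by omega) (by omega)]
    congr 1
    ring

lemma pow_mul_of_mul_add
    (he : ∀ n i, 0 < i → i < 3 * n → z * e n i = e (n + 1) i + e (n + 1) (i + 3)) (m : ℕ)
    {n i : ℕ} (hi : 0 < i) (hin : i < 3 * n) :
    z ^ m * e n i = ∑ j ∈ Finset.range (m + 1), m.choose j • e (n + m) (i + 3 * j) := by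
  have key : z ^ m * e n i =
      ∑ x ∈ Finset.HasAntidiagonal.antidiagonal m,
        m.choose x.1 • e (n + (x.1 + x.2)) (i + 3 * x.1) := by
    induction m with
    | zero => simp
    | succ m ih =>
      rw [Finset.sum_antidiagonal_choose_succ_nsmul
          (fun a b => e (n + (a + b)) (i + 3 * a)) m, pow_succ', mul_assoc, ih, Finset.mul_sum,
          ← Finset.sum_add_distrib]
      refine Finset.sum_congr rfl fun x hx => ?_
      rw [Finset.HasAntidiagonal.mem_antidiagonal] at hx
      rw [mul_smul_comm, he _ _ (by omega) (by omega), smul_add]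
      have hc : m.choose x.2 = m.choose x.1 := (Nat.choose_symm_of_eq_add hx.symm).symm
      have h1 : n + (x.1 + x.2) + 1 = n + (x.1 + (x.2 + 1)) := by ring
      have h2 : n + (x.1 + (x.2 + 1)) = n + (x.1 + 1 + x.2) := by ring
      have h3 : i + 3 * (x.1 + 1) = i + 3 * x.1 + 3 := by ring
      rw [hc, h1, h3, h2]
  rw [key, Finset.Nat.sum_antidiagonal_eq_sum_range_succ_mk]
  refine Finset.sum_congr rfl fun j hj => ?_
  rw [Finset.mem_range] at hj
  congr 3
  simp only
  omega

lemma pow_prime_pow_mul {p : ℕ} [Fact p.Prime] (hp : (p : A) = 0)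
    (he : ∀ n i, 0 < i → i < 3 * n → z * e n i = e (n + 1) i + e (n + 1) (i + 3)) (r : ℕ)
    {n i : ℕ} (hi : 0 < i) (hin : i < 3 * n) :
    z ^ p ^ r * e n i = e (n + p ^ r) i + e (n + p ^ r) (i + 3 * p ^ r) := by
  rw [pow_mul_of_mul_add he _ hi hin]
  have hq : 0 < p ^ r := pow_pos (Fact.out : p.Prime).pos r
  rw [Finset.sum_range_succ, ← Finset.sum_erase_add _ _ (Finset.mem_range.2 hq),
    Finset.sum_eq_zero, zero_add]
  · simp
  · intro j hj
    rw [Finset.mem_erase, Finset.mem_range] at hj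
    obtain ⟨c, hc⟩ := (Fact.out : p.Prime).dvd_choose_pow hj.1 hj.2.ne
    rw [nsmul_eq_mul, hc, Nat.cast_mul, hp, zero_mul, zero_mul]

/-- The relations among the monomials of degree at least `q` in a quotient of the coordinate ring of
the nodal cubic in which `s ^ q = t ^ q = z ^ q = 0`. -/
lemma nodal_relations {p : ℕ} [Fact p.Prime] (hp : (p : A) = 0) {r q : ℕ} (hq : q = p ^ r)
    (hs : s ^ q = 0) (ht : t ^ q = 0) (hz : z ^ q = 0) (e1 : e 1 1 = t) (e2 : e 1 2 = s)
    (he : ∀ n i, 0 < i → i < 3 * n →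
      s * e n i = e (n + 1) (i + 2) ∧ t * e n i = e (n + 1) (i + 1) ∧
      z * e n i = e (n + 1) i + e (n + 1) (i + 3)) :
    e q q = 0 ∧ e q (2 * q) = 0 ∧ ∀ m, 0 < m →
      (∀ i, q < i → i < q + 3 * m → e (q + m) i = 0) ∧
      (∀ i, 2 * q < i → i < 2 * q + 3 * m → e (q + m) i = 0) ∧
      e (q + m) q + e (q + m) (q + 3 * m) = 0 ∧
      e (q + m) (2 * q) + e (q + m) (2 * q + 3 * m) = 0 ∧
      ∀ i, 0 < i → i < 3 * m → e (q + m) i + e (q + m) (i + 3 * q) = 0 := by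
  have hq0 : 0 < q := hq ▸ pow_pos (Fact.out : p.Prime).pos r
  have hs' (n i) (hi : 0 < i) (hin : i < 3 * n) := (he n i hi hin).1
  have ht' (n i) (hi : 0 < i) (hin : i < 3 * n) := (he n i hi hin).2.1
  have hz' (n i) (hi : 0 < i) (hin : i < 3 * n) := (he n i hi hin).2.2
  have hqq : e q q = 0 := by
    have := pow_mul_of_mul_shift (by norm_num) ht' (q - 1) (n := 1) (i := 1) (by omega) (by omega)
    rw [e1, pow_sub_one_mul hq0.ne', ht] at this
    rw [this]; congr 1 <;> omega
  have hq2 : e q (2 * q) = 0 := by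
    have := pow_mul_of_mul_shift (by norm_num) hs' (q - 1) (n := 1) (i := 2) (by omega) (by omega)
    rw [e2, pow_sub_one_mul hq0.ne', hs] at this
    rw [this]; congr 1 <;> omega
  refine ⟨hqq, hq2, fun m hm => ?_⟩
  have k1 (i) (h1 : q < i) (h2 : i < q + 3 * m) : e (q + m) i = 0 := by
    have := pow_mul_of_mul_shift (by norm_num) ht' q (n := m) (i := i - q) (by omega) (by omega)
    rw [ht, zero_mul] at this
    rw [this]; congr 1 <;> omega
  have k2 (i) (h1 : 2 * q < i) (h2 : i < 2 * q + 3 * m) : e (q + m) i = 0 := by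
    have := pow_mul_of_mul_shift (by norm_num) hs' q (n := m) (i := i - 2 * q) (by omega) (by omega)
    rw [hs, zero_mul] at this
    rw [this]; congr 1 <;> omega
  have glue (i : ℕ) (hi : 0 < i) (hi' : i < 3 * q) (h0 : e q i = 0)
      (hk : ∀ j, i < j → j < i + 3 * m → e (q + m) j = 0) :
      e (q + m) i + e (q + m) (i + 3 * m) = 0 := by
    have := pow_mul_of_mul_add hz' m hi hi'
    rw [h0, mul_zero, Finset.sum_range_succ, ← Finset.sum_erase_add _ _ (Finset.mem_range.2 hm),
      Finset.sum_eq_zero, zero_add] at this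
    · simpa using this.symm
    · intro j hj
      rw [Finset.mem_erase, Finset.mem_range] at hj
      rw [hk _ (by omega) (by omega), smul_zero]
  refine ⟨k1, k2, glue _ hq0 (by omega) hqq k1, glue _ (by omega) (by omega) hq2 k2,
    fun i hi him => ?_⟩
  have := pow_prime_pow_mul hp hz' r hi him
  rw [← hq, hz, zero_mul] at this
  rw [this, add_comm m q]

end Family

/-- The Hilbert function of the quotient of the coordinate ring of a nodal cubic by the `q`-th
powers of its generators. -/
def nodalDim (q n : ℕ) : ℕ :=
  if n < q then max (3 * n) 1
  else if n = q then 3 * q - 3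
  else if 3 * (n - q) ≤ q then 3 * q - 6 * (n - q)
  else 2 * q - 1 - 3 * (n - q)

section Upper

open Submodule

variable {k A : Type*} [Field k] [CommRing A] [Algebra k A] {s t z : A} {e : ℕ → ℕ → A}

lemma exists_finset_nodal_span {q : ℕ} (hq0 : 0 < q) (hz : z ^ q = 0)
    (hrel : e q q = 0 ∧ e q (2 * q) = 0 ∧ ∀ m, 0 < m →
      (∀ i, q < i → i < q + 3 * m → e (q + m) i = 0) ∧
      (∀ i, 2 * q < i → i < 2 * q + 3 * m → e (q + m) i = 0) ∧
      e (q + m) q + e (q + m) (q + 3 * m) = 0 ∧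
      e (q + m) (2 * q) + e (q + m) (2 * q + 3 * m) = 0 ∧
      ∀ i, 0 < i → i < 3 * m → e (q + m) i + e (q + m) (i + 3 * q) = 0) (n : ℕ) :
    ∃ Y : Finset A, Y.card ≤ nodalDim q n ∧ z ^ n ∈ span k (Y : Set A) ∧
      ∀ i, 0 < i → i < 3 * n → e n i ∈ span k (Y : Set A) := by
  classical
  obtain ⟨hqq, hq2, hrel⟩ := hrel
  rcases lt_or_ge n q with hn | hn
  · refine ⟨(Finset.range (max (3 * n) 1)).image fun i => if i = 0 then z ^ n else e n i,
      ?_, ?_, ?_⟩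
    · refine Finset.card_image_le.trans ?_
      simp [nodalDim, hn]
    · exact subset_span (Finset.mem_coe.2 (Finset.mem_image.2 ⟨0, by simp, by simp⟩))
    · intro i hi hin
      exact subset_span (Finset.mem_coe.2 (Finset.mem_image.2
        ⟨i, Finset.mem_range.2 (by omega), if_neg hi.ne'⟩))
  have hzn : z ^ n = 0 := pow_eq_zero_of_le hn hz
  suffices h : ∃ Y : Finset ℕ, Y.card ≤ nodalDim q n ∧
      ∀ i, 0 < i → i < 3 * n → e n i ∈ span k (e n '' Y) by
    obtain ⟨Y, hY, hY'⟩ := h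
    refine ⟨Y.image (e n), Finset.card_image_le.trans hY, ?_, ?_⟩
    · rw [hzn]; exact zero_mem _
    · simpa using hY'
  obtain ⟨m, rfl⟩ := Nat.exists_eq_add_of_le hn
  rcases Nat.eq_zero_or_pos m with rfl | hm
  · refine ⟨((Finset.Icc 1 (3 * q - 1)).erase q).erase (2 * q), ?_, fun i hi hin => ?_⟩
    · rw [Finset.card_erase_of_mem, Finset.card_erase_of_mem]
      · simp [nodalDim]; omega
      · rw [Finset.mem_Icc]; omega
      · rw [Finset.mem_erase, Finset.mem_Icc]; omega
    · by_cases h1 : i = q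
      · rw [h1, add_zero, hqq]; exact zero_mem _
      by_cases h2 : i = 2 * q
      · rw [h2, add_zero, hq2]; exact zero_mem _
      refine subset_span ⟨i, Finset.mem_coe.2 ?_, rfl⟩
      simp only [Finset.mem_erase, Finset.mem_Icc]
      omega
  obtain ⟨k1, k2, g1, g2, g3⟩ := hrel m hm
  by_cases hmq : 3 * m ≤ q
  · refine ⟨Finset.Icc 1 q ∪ Finset.Ioc (q + 3 * m) (2 * q) ∪
      Finset.Ioc (2 * q + 3 * m) (3 * q), ?_, ?_⟩
    · refine (Finset.card_union_le _ _).trans ((Nat.add_le_add_right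
        (Finset.card_union_le _ _) _).trans ?_)
      simp [nodalDim, hm.ne', hmq]; omega
    have base (i : ℕ) (h : 1 ≤ i ∧ i ≤ q ∨ q + 3 * m < i ∧ i ≤ 2 * q ∨
        2 * q + 3 * m < i ∧ i ≤ 3 * q) : e (q + m) i ∈ span k (e (q + m) ''
        ((Finset.Icc 1 q ∪ Finset.Ioc (q + 3 * m) (2 * q) ∪
          Finset.Ioc (2 * q + 3 * m) (3 * q) : Finset ℕ) : Set ℕ)) := by
      refine subset_span ⟨i, Finset.mem_coe.2 ?_, rfl⟩
      simp only [Finset.mem_union, Finset.mem_Icc, Finset.mem_Ioc]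
      omega
    generalize span k (_ : Set A) = W at base ⊢
    have b2 (i : ℕ) (h1 : 0 < i) (h2 : i ≤ 2 * q) : e (q + m) i ∈ W := by
      rcases le_or_gt i q with h | h
      · exact base i (by omega)
      rcases lt_trichotomy i (q + 3 * m) with h' | h' | h'
      · rw [k1 i h h']; exact zero_mem _
      · rw [h', ← neg_eq_of_add_eq_zero_right g1]; exact neg_mem (base q (by omega))
      · exact base i (by omega)
    intro i hi hin
    rcases le_or_gt i (2 * q) with h | h
    · exact b2 i hi h
    rcases lt_trichotomy i (2 * q + 3 * m) with h' | h' | h'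
    · rw [k2 i h h']; exact zero_mem _
    · rw [h', ← neg_eq_of_add_eq_zero_right g2]; exact neg_mem (b2 _ (by omega) le_rfl)
    rcases le_or_gt i (3 * q) with h'' | h''
    · exact base i (by omega)
    · have := g3 (i - 3 * q) (by omega) (by omega)
      rw [Nat.sub_add_cancel h''.le] at this
      rw [← neg_eq_of_add_eq_zero_right this]
      exact neg_mem (base _ (by omega))
  · refine ⟨Finset.Ioo (3 * m - q) q, ?_, ?_⟩
    · simp [nodalDim, hm.ne', hmq]; omega
    have base (i : ℕ) (h1 : 3 * m - q < i) (h2 : i < q) :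
        e (q + m) i ∈ span k (e (q + m) '' (Finset.Ioo (3 * m - q) q : Finset ℕ)) :=
      subset_span ⟨i, by simp [h1, h2], rfl⟩
    generalize span k (_ : Set A) = W at base ⊢
    have b0 (i : ℕ) (h1 : q ≤ i) (h2 : i ≤ 2 * q + 3 * m) : e (q + m) i = 0 := by
      rcases h1.eq_or_lt with rfl | h1
      · rw [← neg_eq_of_add_eq_zero_left g1, k2 _ (by omega) (by omega), neg_zero]
      rcases h2.eq_or_lt with rfl | h2
      · rw [← neg_eq_of_add_eq_zero_right g2, k1 _ (by omega) (by omega), neg_zero]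
      rcases lt_or_ge i (q + 3 * m) with h | h
      · exact k1 i h1 h
      · exact k2 i (by omega) h2
    have b1 (i : ℕ) (h1 : 0 < i) (h2 : i ≤ 2 * q + 3 * m) : e (q + m) i ∈ W := by
      rcases le_or_gt q i with h | h
      · rw [b0 i h h2]; exact zero_mem _
      rcases lt_or_ge (3 * m - q) i with h' | h'
      · exact base i h' h
      · rw [← neg_eq_of_add_eq_zero_left (g3 i h1 (by omega)), b0 _ (by omega) (by omega), neg_zero]
        exact zero_mem _
    intro i hi hin
    rcases le_or_gt i (2 * q + 3 * m) with h | h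
    · exact b1 i hi h
    · have := g3 (i - 3 * q) (by omega) (by omega)
      rw [Nat.sub_add_cancel (by omega)] at this
      rw [← neg_eq_of_add_eq_zero_right this]
      exact neg_mem (b1 _ (by omega) (by omega))

/-- The dimension of a quotient of the coordinate ring of a nodal cubic by the `q`-th powers of its
generators is at most the sum of the values of `nodalDim q`. -/
lemma nodal_finrank_le {p : ℕ} [Fact p.Prime] [CharP k p] {r q : ℕ} (hq : q = p ^ r)
    (h : s * t * z = s ^ 3 + t ^ 3) (hs : s ^ q = 0) (ht : t ^ q = 0) (hz : z ^ q = 0)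
    (htop : Algebra.adjoin k {s, t, z} = ⊤) :
    Module.Finite k A ∧ Module.finrank k A ≤ ∑ n ∈ Finset.range (2 * q), nodalDim q n := by
  classical
  have hq0 : 0 < q := hq ▸ pow_pos (Fact.out : p.Prime).pos r
  have hp : (p : A) = 0 := by rw [← map_natCast (algebraMap k A), CharP.cast_eq_zero, map_zero]
  obtain ⟨e, e1, e2, he⟩ := exists_nodal_monomials h
  choose Y hYcard hYz hYe using
    exists_finset_nodal_span (k := k) hq0 hz (nodal_relations hp hq hs ht hz e1 e2 he)
  set C : Submodule k A := span k {x | ∃ n i, 0 < i ∧ i < 3 * n ∧ e n i = x} with hC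
  have eC (n i : ℕ) (h1 : 0 < i) (h2 : i < 3 * n) : e n i ∈ C := subset_span ⟨n, i, h1, h2, rfl⟩
  have mulC (x : A) (hx : x ∈ C) : s * x ∈ C ∧ t * x ∈ C ∧ z * x ∈ C := by
    induction hx using span_induction with
    | mem x hx =>
      obtain ⟨n, i, h1, h2, rfl⟩ := hx
      obtain ⟨h3, h4, h5⟩ := he n i h1 h2
      rw [h3, h4, h5]
      exact ⟨eC _ _ (by omega) (by omega), eC _ _ (by omega) (by omega),
        add_mem (eC _ _ (by omega) (by omega)) (eC _ _ (by omega) (by omega))⟩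
    | zero => simp
    | add x y _ _ hx hy =>
      simp only [mul_add]
      exact ⟨add_mem hx.1 hy.1, add_mem hx.2.1 hy.2.1, add_mem hx.2.2 hy.2.2⟩
    | smul a x _ hx =>
      simp only [mul_smul_comm]
      exact ⟨smul_mem _ _ hx.1, smul_mem _ _ hx.2.1, smul_mem _ _ hx.2.2⟩
  have powC (n : ℕ) (x : A) (hx : x ∈ C) : z ^ n * x ∈ C := by
    induction n with
    | zero => simpa
    | succ n ih => rw [pow_succ', mul_assoc]; exact (mulC _ ih).2.2
  have hsC : s ∈ C := e2 ▸ eC 1 2 (by norm_num) (by norm_num)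
  have htC : t ∈ C := e1 ▸ eC 1 1 (by norm_num) (by norm_num)
  set V : Submodule k A := C ⊔ span k (Set.range fun n : ℕ => z ^ n) with hV
  have hCV : C ≤ V := le_sup_left
  have zV (n : ℕ) : z ^ n ∈ V := (le_sup_right : _ ≤ V) (subset_span ⟨n, rfl⟩)
  have mulV (y : A) (hy : y ∈ ({s, t, z} : Set A)) (x : A) (hx : x ∈ V) : y * x ∈ V := by
    have hyC (a : A) (ha : a ∈ C) : y * a ∈ C := by
      rcases hy with rfl | rfl | rfl
      exacts [(mulC a ha).1, (mulC a ha).2.1, (mulC a ha).2.2]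
    have hyz (n : ℕ) : y * z ^ n ∈ V := by
      rcases hy with rfl | rfl | rfl
      · rw [mul_comm]; exact hCV (powC n _ hsC)
      · rw [mul_comm]; exact hCV (powC n _ htC)
      · rw [← pow_succ']; exact zV _
    obtain ⟨a, ha, b, hb, rfl⟩ := mem_sup.1 hx
    rw [mul_add]
    refine add_mem (hCV (hyC a ha)) ?_
    clear hx
    induction hb using span_induction with
    | mem x hx => obtain ⟨n, rfl⟩ := hx; exact hyz n
    | zero => simp
    | add x y _ _ hx hy => rw [mul_add]; exact add_mem hx hy
    | smul a x _ hx => rw [mul_smul_comm]; exact smul_mem _ _ hx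
  have Vtop : V = ⊤ := by
    refine eq_top_iff.2 fun y _ => ?_
    suffices ∀ x ∈ V, y * x ∈ V by simpa using this 1 (by simpa using zV 0)
    have hy : y ∈ Algebra.adjoin k {s, t, z} := htop ▸ Algebra.mem_top
    induction hy using Algebra.adjoin_induction with
    | mem y hy => exact mulV y hy
    | algebraMap a => intro x hx; rw [← Algebra.smul_def]; exact smul_mem _ _ hx
    | add a b _ _ ha hb =>
      intro x hx; rw [add_mul]; exact add_mem (ha trivial x hx) (hb trivial x hx)
    | mul a b _ _ ha hb => intro x hx; rw [mul_assoc]; exact ha trivial _ (hb trivial x hx)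
  have hYe0 (n : ℕ) (hn : 2 * q ≤ n) : Y n = ∅ := by
    rw [← Finset.card_eq_zero]
    have := hYcard n
    simp only [nodalDim] at this
    split_ifs at this <;> omega
  set Z := (Finset.range (2 * q)).biUnion Y with hZ
  have YZ (n : ℕ) : span k (Y n : Set A) ≤ span k (Z : Set A) := by
    rcases lt_or_ge n (2 * q) with hn | hn
    · exact span_mono (Finset.coe_subset.2
        (Finset.subset_biUnion_of_mem Y (Finset.mem_range.2 hn)))
    · simp [hYe0 n hn]
  have Ztop : span k (Z : Set A) = ⊤ := by
    rw [eq_top_iff, ← Vtop, hV, hC, ← span_union, span_le]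
    rintro _ (⟨n, i, h1, h2, rfl⟩ | ⟨n, rfl⟩)
    · exact YZ n (hYe n i h1 h2)
    · exact YZ n (hYz n)
  refine ⟨⟨⟨Z, Ztop⟩⟩, ?_⟩
  rw [← finrank_top, ← Ztop]
  exact (finrank_span_finset_le_card Z).trans
    (Finset.card_biUnion_le.trans (Finset.sum_le_sum fun n _ => hYcard n))

end Upper

section Arithmetic

lemma two_mul_sum_sub_three_mul (B d K : ℕ) (hd : d < 3) :
    2 * ∑ j ∈ Finset.range (B + K), (3 * B + d - 3 - 3 * j) + 3 * B = 2 * B * d + 3 * B ^ 2 := by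
  induction B with
  | zero =>
    rw [Finset.sum_eq_zero (fun j _ => by omega)]; simp
  | succ B ih =>
    rw [add_right_comm, Finset.sum_range_succ']
    have : ∑ j ∈ Finset.range (B + K), (3 * (B + 1) + d - 3 - 3 * (j + 1)) =
        ∑ j ∈ Finset.range (B + K), (3 * B + d - 3 - 3 * j) :=
      Finset.sum_congr rfl fun j _ => by omega
    rw [this, show 3 * (B + 1) + d - 3 - 3 * 0 = 3 * B + d by omega]
    linear_combination ih

lemma two_mul_sum_nodalDim_lt (q : ℕ) (N : ℕ) (hN : N < q) :
    2 * ∑ n ∈ Finset.range (N + 1), nodalDim q n = 3 * N * (N + 1) + 2 := by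
  induction N with
  | zero => simp [nodalDim, hN]
  | succ N ih =>
    rw [Finset.sum_range_succ, mul_add, ih (by omega),
      show nodalDim q (N + 1) = 3 * (N + 1) by simp only [nodalDim, if_pos hN]; omega]
    ring

lemma sum_nodalDim_mid (q N : ℕ) (hq : 0 < q) (hN : 3 * N ≤ q) :
    ∑ m ∈ Finset.range (N + 1), nodalDim q (q + m) + 3 + 3 * N * (N + 1) =
      3 * q + 3 * q * N := by
  induction N with
  | zero => simp [nodalDim]; omega
  | succ N ih =>
    have h := ih (by omega)
    have h2 : nodalDim q (q + (N + 1)) + 6 * (N + 1) = 3 * q := by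
      simp [nodalDim, hN]; omega
    rw [Finset.sum_range_succ]
    linear_combination h + h2

lemma two_mul_sum_nodalDim_top (q r B d K : ℕ) (hr : q < 3 * (r + 1)) (hd : d < 3)
    (h : 2 * q = 3 * r + 3 * B + d + 1) :
    2 * ∑ m ∈ Finset.range (B + K), nodalDim q (q + (r + 1 + m)) + 3 * B =
      2 * B * d + 3 * B ^ 2 := by
  rw [← two_mul_sum_sub_three_mul B d K hd]
  congr 2
  refine Finset.sum_congr rfl fun m _ => ?_
  have h1 : ¬ 3 * (r + 1 + m) ≤ q := by omega
  simp [nodalDim, h1]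
  omega

lemma three_mul_sum_nodalDim (q : ℕ) (hq : 0 < q) :
    3 * ∑ n ∈ Finset.range (2 * q), nodalDim q n =
      if q % 3 = 2 then 7 * q ^ 2 - q - 5 else 7 * q ^ 2 - q - 3 := by
  have hA := two_mul_sum_nodalDim_lt q (q - 1) (by omega)
  rw [Nat.sub_add_cancel hq] at hA
  rw [two_mul, Finset.sum_range_add]
  set SA := ∑ n ∈ Finset.range q, nodalDim q n
  obtain ⟨r, rfl | rfl | rfl⟩ : ∃ r, q = 3 * r + 3 ∨ q = 3 * r + 1 ∨ q = 3 * r + 2 :=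
    ⟨(q - 1) / 3, by omega⟩
  · have h1 := sum_nodalDim_mid (3 * r + 3) (r + 1) hq (by omega)
    have h2 := two_mul_sum_nodalDim_top (3 * r + 3) (r + 1) r 2 (r + 1) (by omega) (by omega)
      (by omega)
    rw [show 3 * r + 3 - 1 = 3 * r + 2 by omega] at hA
    rw [if_neg (by omega), show Finset.range (3 * r + 3) = Finset.range (r + 1 + 1 + (r + (r + 1)))
      by congr 1; omega, Finset.sum_range_add, Nat.sub_sub]
    refine Nat.eq_sub_of_add_eq ?_
    linarith
  · have h1 := sum_nodalDim_mid (3 * r + 1) r hq (by omega)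
    have h2 := two_mul_sum_nodalDim_top (3 * r + 1) r r 1 r (by omega) (by omega) (by omega)
    rw [show 3 * r + 1 - 1 = 3 * r by omega] at hA
    rw [if_neg (by omega), show Finset.range (3 * r + 1) = Finset.range (r + 1 + (r + r))
      by congr 1; omega, Finset.sum_range_add, Nat.sub_sub]
    refine Nat.eq_sub_of_add_eq ?_
    linarith
  · have h1 := sum_nodalDim_mid (3 * r + 2) r hq (by omega)
    have h2 := two_mul_sum_nodalDim_top (3 * r + 2) r (r + 1) 0 r (by omega) (by omega) (by omega)
    rw [show 3 * r + 2 - 1 = 3 * r + 1 by omega] at hA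
    rw [if_pos (by omega), show Finset.range (3 * r + 2) = Finset.range (r + 1 + (r + 1 + r))
      by congr 1; omega, Finset.sum_range_add, Nat.sub_sub]
    refine Nat.eq_sub_of_add_eq ?_
    linarith

end Arithmetic

section Lower

open Polynomial Submodule

variable (k : Type*) [Field k]

/-- The degree `n` component of the coordinate ring of the nodal cubic, parametrized by `s = w²`,
`t = w`, `z = 1 + w³`. -/
noncomputable def nodalComponent (n : ℕ) : Submodule k k[X] :=
  (LinearMap.ker ((lcoeff k 0 - lcoeff k (3 * n)).domRestrict (degreeLT k (3 * n + 1)))).map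
    (degreeLT k (3 * n + 1)).subtype

variable {k}

lemma mem_nodalComponent {n : ℕ} {g : k[X]} :
    g ∈ nodalComponent k n ↔ g.natDegree ≤ 3 * n ∧ g.coeff 0 = g.coeff (3 * n) := by
  have : g ∈ degreeLT k (3 * n + 1) ↔ g.natDegree ≤ 3 * n := by
    rw [mem_degreeLT, degree_lt_iff_coeff_zero, natDegree_le_iff_coeff_eq_zero]
    rfl
  simp [nodalComponent, sub_eq_zero, this, and_comm]

instance (n : ℕ) : FiniteDimensional k (degreeLT k n) :=
  (degreeLTEquiv k n).symm.finiteDimensional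

instance (n : ℕ) : FiniteDimensional k (nodalComponent k n) := by
  unfold nodalComponent; infer_instance

lemma finrank_nodalComponent (n : ℕ) :
    Module.finrank k (nodalComponent k n) = max (3 * n) 1 := by
  have hd : Module.finrank k (degreeLT k (3 * n + 1)) = 3 * n + 1 := by
    rw [(degreeLTEquiv k _).finrank_eq, Module.finrank_fin_fun]
  have h := LinearMap.finrank_range_add_finrank_ker
    ((lcoeff k 0 - lcoeff k (3 * n)).domRestrict (degreeLT k (3 * n + 1)))
  rw [hd] at h
  rw [nodalComponent, finrank_map_subtype_eq]
  rcases Nat.eq_zero_or_pos n with rfl | hn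
  · rw [show (lcoeff k 0 - lcoeff k (3 * 0)).domRestrict (degreeLT k (3 * 0 + 1)) = 0 by
      ext; simp] at h ⊢
    rw [LinearMap.range_zero, finrank_bot] at h
    omega
  · rw [LinearMap.range_eq_top.2, finrank_top, Module.finrank_self] at h
    · omega
    refine LinearMap.surjective fun h0 => ?_
    have := LinearMap.congr_fun h0 ⟨1, by
      rw [mem_degreeLT]; exact degree_one_le.trans_lt (by exact_mod_cast Nat.succ_pos _)⟩
    simp [coeff_one, hn.ne'] at this

lemma nodalComponent_le_span {n : ℕ} (hn : 0 < n) :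
    nodalComponent k n ≤
      span k ({1 + X ^ (3 * n)} ∪ (fun i : ℕ => (X : k[X]) ^ i) '' Finset.Ioo 0 (3 * n)) := by
  intro g hg
  obtain ⟨h1, h2⟩ := mem_nodalComponent.1 hg
  obtain ⟨N, hN⟩ : ∃ N, 3 * n = N + 1 := ⟨3 * n - 1, by omega⟩
  rw [hN] at h1 h2 ⊢
  rw [as_sum_range' g (N + 2) (by omega), Finset.sum_range_succ, Finset.sum_range_succ', ← h2]
  have : ∑ i ∈ Finset.range N, monomial (i + 1) (g.coeff (i + 1)) + monomial 0 (g.coeff 0) +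
      monomial (N + 1) (g.coeff 0) = g.coeff 0 • (1 + X ^ (N + 1)) +
      ∑ i ∈ Finset.range N, g.coeff (i + 1) • X ^ (i + 1) := by
    simp only [smul_X_eq_monomial, smul_add]
    rw [show (1 : k[X]) = monomial 0 1 from rfl, smul_monomial, smul_eq_mul, mul_one]
    ring
  rw [this]
  refine add_mem (smul_mem _ _ (subset_span (Or.inl rfl)))
    (sum_mem fun i hi => smul_mem _ _ (subset_span (Or.inr ⟨i + 1, ?_, rfl⟩)))
  rw [Finset.mem_range] at hi
  simp [hi]

lemma mul_mem_nodalComponent {m n : ℕ} {f g : k[X]} (hf : f ∈ nodalComponent k m)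
    (hg : g ∈ nodalComponent k n) : f * g ∈ nodalComponent k (m + n) := by
  rw [mem_nodalComponent] at *
  refine ⟨natDegree_mul_le.trans (by omega), ?_⟩
  rw [mul_add, coeff_mul_add_eq_of_natDegree_le hf.1 hg.1, mul_coeff_zero, hf.2, hg.2]

variable (k)

/-- The coordinate ring of the nodal cubic as a subalgebra of the polynomials in `T` over `k[w]`,
parametrized by `s = w²T`, `t = wT`, `z = (1 + w³)T`. -/
noncomputable def nodalSubalgebra : Subalgebra k k[X][X] where
  carrier := {F | ∀ n, F.coeff n ∈ nodalComponent k n}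
  mul_mem' := fun {F G} hF hG n => by
    rw [coeff_mul]
    refine sum_mem fun x hx => ?_
    rw [← Finset.HasAntidiagonal.mem_antidiagonal.1 hx]
    exact mul_mem_nodalComponent (hF _) (hG _)
  add_mem' := fun {F G} hF hG n => by rw [coeff_add]; exact add_mem (hF n) (hG n)
  algebraMap_mem' := fun a n => by
    rw [Polynomial.algebraMap_apply, coeff_C]
    split_ifs with h
    · subst h; rw [mem_nodalComponent]; simp
    · exact zero_mem _

/-- The parametrization of the coordinate `s` on the nodal cubic. -/
noncomputable def nodalS : k[X][X] := monomial 1 (X ^ 2)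

/-- The parametrization of the coordinate `t` on the nodal cubic. -/
noncomputable def nodalT : k[X][X] := monomial 1 X

/-- The parametrization of the coordinate `z` on the nodal cubic. -/
noncomputable def nodalZ : k[X][X] := monomial 1 (1 + X ^ 3)

variable {k}

lemma nodal_equation :
    nodalS k * nodalT k * nodalZ k = nodalS k ^ 3 + nodalT k ^ 3 := by
  simp only [nodalS, nodalT, nodalZ, monomial_mul_monomial, monomial_pow, ← map_add]
  congr 1
  ring

lemma adjoin_le_nodalSubalgebra :
    Algebra.adjoin k {nodalS k, nodalT k, nodalZ k} ≤ nodalSubalgebra k := by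
  have key (g : k[X]) (hg : g ∈ nodalComponent k 1) : monomial 1 g ∈ nodalSubalgebra k := by
    intro n
    rw [coeff_monomial]
    split_ifs with h
    · exact h ▸ hg
    · exact zero_mem _
  refine Algebra.adjoin_le ?_
  rintro _ (rfl | rfl | rfl) <;> refine key _ (mem_nodalComponent.2 ⟨?_, ?_⟩)
  · simp
  · simp [coeff_X_pow]
  · simp
  · simp [coeff_X]
  · compute_degree
  · simp [coeff_one, coeff_X_pow]

lemma monomial_X_pow_mem_adjoin {n i : ℕ} (hi : 0 < i) (hin : i < 3 * n) :
    monomial n (X ^ i) ∈ Algebra.adjoin k {nodalS k, nodalT k, nodalZ k} := by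
  set W := Algebra.adjoin k {nodalS k, nodalT k, nodalZ k}
  have hs : nodalS k ∈ W := Algebra.subset_adjoin (by simp)
  have ht : nodalT k ∈ W := Algebra.subset_adjoin (by simp)
  have hz : nodalZ k ∈ W := Algebra.subset_adjoin (by simp)
  induction n generalizing i with
  | zero => omega
  | succ n ih =>
    rcases Nat.eq_zero_or_pos n with rfl | hn
    · obtain rfl | rfl : i = 1 ∨ i = 2 := by omega
      · simpa [nodalT] using ht
      · exact hs
    have mid (j : ℕ) (h1 : 1 < j) (h2 : j < 3 * n + 2) : monomial (n + 1) (X ^ j) ∈ W := by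
      rcases le_or_gt j (3 * n) with h | h
      · have := mul_mem ht (ih (i := j - 1) (by omega) (by omega))
        rwa [nodalT, monomial_mul_monomial, ← pow_succ', add_comm 1 n,
          Nat.sub_add_cancel (by omega)] at this
      · have := mul_mem hs (ih (i := j - 2) (by omega) (by omega))
        rwa [nodalS, monomial_mul_monomial, ← pow_add, add_comm 1 n,
          Nat.add_sub_cancel' (by omega)] at this
    have mulz (j : ℕ) (h1 : 0 < j) (h2 : j < 3 * n) :
        monomial (n + 1) (X ^ j) + monomial (n + 1) (X ^ (j + 3)) ∈ W := by
      have := mul_mem hz (ih h1 h2)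
      rwa [nodalZ, monomial_mul_monomial, add_mul, one_mul, ← pow_add, add_comm 1 n,
        add_comm 3 j, map_add] at this
    rcases le_or_gt i 1 with h | h
    · obtain rfl : i = 1 := by omega
      exact (add_mem_cancel_right (mid 4 (by omega) (by omega))).1 (mulz 1 (by omega) (by omega))
    rcases lt_or_ge i (3 * n + 2) with h' | h'
    · exact mid i h h'
    · obtain ⟨j, rfl⟩ := Nat.exists_eq_add_of_le' (show 3 ≤ i by omega)
      exact (add_mem_cancel_left (mid j (by omega) (by omega))).1 (mulz j (by omega) (by omega))

lemma monomial_one_add_mem_adjoin {n : ℕ} (hn : 0 < n) :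
    monomial n (1 + X ^ (3 * n)) ∈ Algebra.adjoin k {nodalS k, nodalT k, nodalZ k} := by
  have hmon := @monomial_X_pow_mem_adjoin k _
  have hz : nodalZ k ∈ Algebra.adjoin k {nodalS k, nodalT k, nodalZ k} :=
    Algebra.subset_adjoin (by simp)
  generalize Algebra.adjoin k {nodalS k, nodalT k, nodalZ k} = W at hmon hz ⊢
  induction n, hn using Nat.le_induction with
  | base => exact hz
  | succ n hn ih =>
    have h := sub_mem (sub_mem (mul_mem hz ih) (hmon (n := n + 1) (i := 3) (by omega) (by omega)))
      (hmon (n := n + 1) (i := 3 * n) (by omega) (by omega))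
    rw [nodalZ, monomial_mul_monomial, add_comm 1 n, ← map_sub, ← map_sub] at h
    convert h using 2
    ring

lemma monomial_mem_adjoin {n : ℕ} {g : k[X]} (hg : g ∈ nodalComponent k n) :
    monomial n g ∈ Algebra.adjoin k {nodalS k, nodalT k, nodalZ k} := by
  rcases Nat.eq_zero_or_pos n with rfl | hn
  · rw [mem_nodalComponent] at hg
    rw [eq_C_of_natDegree_le_zero hg.1]
    exact Subalgebra.algebraMap_mem _ (g.coeff 0)
  · suffices nodalComponent k n ≤ (Subalgebra.toSubmodule
        (Algebra.adjoin k {nodalS k, nodalT k, nodalZ k})).comap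
        ((monomial n : k[X] →ₗ[k[X]] k[X][X]).restrictScalars k) from this hg
    refine (nodalComponent_le_span hn).trans (span_le.2 ?_)
    rintro _ (rfl | ⟨i, hi, rfl⟩)
    · exact monomial_one_add_mem_adjoin hn
    · simp only [Finset.coe_Ioo, Set.mem_Ioo] at hi
      exact monomial_X_pow_mem_adjoin hi.1 hi.2

end Lower

section LowerBound

open Polynomial Submodule

variable (k : Type*) [Field k]

/-- The degree `n` component of the ideal generated by the `q`-th powers of the generators of the
coordinate ring of the nodal cubic. -/
noncomputable def nodalPowers (q n : ℕ) : Submodule k k[X] :=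
  if n < q then ⊥ else
    (nodalComponent k (n - q)).map (LinearMap.mulLeft k (X ^ (2 * q))) ⊔
    (nodalComponent k (n - q)).map (LinearMap.mulLeft k (X ^ q)) ⊔
    (nodalComponent k (n - q)).map (LinearMap.mulLeft k (1 + X ^ (3 * q)))

instance (q n : ℕ) : FiniteDimensional k (nodalPowers k q n) := by
  by_cases h : n < q
  · rw [nodalPowers, if_pos h]; infer_instance
  · rw [nodalPowers, if_neg h]; infer_instance

variable {k}

lemma finrank_nodalPowers_le {q n : ℕ} (hn : q ≤ n) :
    Module.finrank k (nodalPowers k q n) ≤ 3 * max (3 * (n - q)) 1 := by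
  rw [nodalPowers, if_neg (by omega)]
  have h (f : k[X] →ₗ[k] k[X]) :
      Module.finrank k ((nodalComponent k (n - q)).map f) ≤ max (3 * (n - q)) 1 :=
    (finrank_map_le _ _).trans (finrank_nodalComponent (n - q)).le
  refine (finrank_add_le_finrank_add_finrank _ _).trans
    ((Nat.add_le_add (finrank_add_le_finrank_add_finrank _ _) le_rfl).trans ?_)
  have h1 := h (LinearMap.mulLeft k (X ^ (2 * q)))
  have h2 := h (LinearMap.mulLeft k (X ^ q))
  have h3 := h (LinearMap.mulLeft k (1 + X ^ (3 * q)))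
  omega

lemma finrank_nodalPowers_le_of_lt {q m : ℕ} (hm : q < 3 * m) :
    Module.finrank k (nodalPowers k q (q + m)) ≤ q + 6 * m + 1 := by
  classical
  set Y : Finset k[X] := ((Finset.Icc q (2 * q + 3 * m)).image fun i => (X : k[X]) ^ i) ∪
    ((Finset.Ioo 0 (3 * m)).image fun i => (X : k[X]) ^ i + X ^ (i + 3 * q)) ∪
    {(1 + X ^ (3 * q)) * (1 + X ^ (3 * m))} with hY
  have hYcard : Y.card ≤ q + 6 * m + 1 := by
    refine (Finset.card_union_le _ _).trans ((Nat.add_le_add_right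
      ((Finset.card_union_le _ _).trans (Nat.add_le_add Finset.card_image_le
        Finset.card_image_le)) _).trans ?_)
    simp; omega
  have hpow (i : ℕ) (h1 : q ≤ i) (h2 : i ≤ 2 * q + 3 * m) :
      (X : k[X]) ^ i ∈ span k (Y : Set k[X]) := by
    refine subset_span (Finset.mem_coe.2 ?_)
    simp only [hY, Finset.mem_union, Finset.mem_image, Finset.mem_Icc]
    exact Or.inl (Or.inl ⟨i, ⟨h1, h2⟩, rfl⟩)
  have hadd (i : ℕ) (h1 : 0 < i) (h2 : i < 3 * m) :
      (X : k[X]) ^ i + X ^ (i + 3 * q) ∈ span k (Y : Set k[X]) := by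
    refine subset_span (Finset.mem_coe.2 ?_)
    simp only [hY, Finset.mem_union, Finset.mem_image, Finset.mem_Ioo]
    exact Or.inl (Or.inr ⟨i, ⟨h1, h2⟩, rfl⟩)
  have hlast : (1 + X ^ (3 * q)) * (1 + X ^ (3 * m)) ∈ span k (Y : Set k[X]) :=
    subset_span (Finset.mem_coe.2 (by simp [hY]))
  have key (g : k[X]) (h0 : g * (1 + X ^ (3 * m)) ∈ span k (Y : Set k[X]))
      (h : ∀ i, 0 < i → i < 3 * m → g * X ^ i ∈ span k (Y : Set k[X])) :
      (nodalComponent k (q + m - q)).map (LinearMap.mulLeft k g) ≤ span k (Y : Set k[X]) := by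
    rw [Nat.add_sub_cancel_left, map_le_iff_le_comap]
    refine (nodalComponent_le_span (by omega)).trans (span_le.2 ?_)
    rintro _ (rfl | ⟨i, hi, rfl⟩)
    · exact h0
    · simp only [Finset.coe_Ioo, Set.mem_Ioo] at hi
      exact h i hi.1 hi.2
  refine le_trans (finrank_mono ?_) ((finrank_span_finset_le_card Y).trans hYcard)
  rw [nodalPowers, if_neg (by omega)]
  refine sup_le (sup_le (key _ ?_ fun i h1 h2 => ?_) (key _ ?_ fun i h1 h2 => ?_))
    (key _ hlast fun i h1 h2 => ?_)
  · rw [mul_add, mul_one, ← pow_add]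
    exact add_mem (hpow _ (by omega) (by omega)) (hpow _ (by omega) (by omega))
  · rw [← pow_add]; exact hpow _ (by omega) (by omega)
  · rw [mul_add, mul_one, ← pow_add]
    exact add_mem (hpow _ (by omega) (by omega)) (hpow _ (by omega) (by omega))
  · rw [← pow_add]; exact hpow _ (by omega) (by omega)
  · rw [add_mul, one_mul, ← pow_add, add_comm (3 * q)]; exact hadd i h1 h2

lemma nodalDim_le_finrank (q n : ℕ) (hq : 0 < q) :
    nodalDim q n ≤ Module.finrank k
      (nodalComponent k n ⧸ (nodalPowers k q n).submoduleOf (nodalComponent k n)) := by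
  have h1 := finrank_quotient_add_finrank
    ((nodalPowers k q n).submoduleOf (nodalComponent k n))
  rw [finrank_nodalComponent] at h1
  have h2 : Module.finrank k ((nodalPowers k q n).submoduleOf (nodalComponent k n)) ≤
      Module.finrank k (nodalPowers k q n) := by
    rw [← finrank_map_subtype_eq]
    exact finrank_mono (map_comap_le _ _)
  rcases lt_or_ge n q with hn | hn
  · have h3 : Module.finrank k (nodalPowers k q n) = 0 := by
      rw [nodalPowers, if_pos hn, finrank_bot]
    simp only [nodalDim, if_pos hn]
    omega
  have h3 := finrank_nodalPowers_le (k := k) hn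
  obtain ⟨m, rfl⟩ := Nat.exists_eq_add_of_le hn
  have h4 := fun h => finrank_nodalPowers_le_of_lt (k := k) (q := q) (m := m) h
  simp only [nodalDim, Nat.add_sub_cancel_left] at *
  split_ifs <;> omega

lemma sum_finrank_le_finrank_quotient {S : Type*} [CommRing S] [Algebra k S] (J : Ideal S)
    [Module.Finite k (S ⧸ J)] {ι : Type*} [Fintype ι] {E : ι → Type*} [∀ i, AddCommGroup (E i)]
    [∀ i, Module k (E i)] [∀ i, FiniteDimensional k (E i)] (ψ : S →ₗ[k] ∀ i, E i)
    (hψ : Function.Surjective ψ) (hker : ∀ F ∈ J, ψ F = 0) :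
    ∑ i, Module.finrank k (E i) ≤ Module.finrank k (S ⧸ J) := by
  rw [← Module.finrank_pi_fintype]
  refine LinearMap.finrank_le_finrank_of_surjective
    (f := ((J.restrictScalars k).liftQ ψ hker).comp
      (Submodule.Quotient.restrictScalarsEquiv k J).symm.toLinearMap) ?_
  rw [LinearMap.coe_comp]
  refine Function.Surjective.comp (fun g => ?_)
    (Submodule.Quotient.restrictScalarsEquiv k J).symm.surjective
  obtain ⟨F, hF⟩ := hψ g
  exact ⟨Submodule.Quotient.mk F, hF⟩

/-- The dimension of a quotient of an algebra that surjects onto the coordinate ring of a nodal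
cubic is at least the sum of the values of `nodalDim q`, if the ideal maps into the ideal generated
by the `q`-th powers of the generators. -/
lemma sum_nodalDim_le_finrank {p : ℕ} [Fact p.Prime] [CharP k p] {r q : ℕ} (hq : q = p ^ r)
    {S : Type*} [CommRing S] [Algebra k S] (J : Ideal S) [Module.Finite k (S ⧸ J)]
    (φ : S →ₐ[k] k[X][X]) (hφ : φ.range = Algebra.adjoin k {nodalS k, nodalT k, nodalZ k})
    (hJ : ∀ F ∈ J, ∃ a ∈ φ.range, ∃ b ∈ φ.range, ∃ c ∈ φ.range,
      φ F = nodalS k ^ q * a + nodalT k ^ q * b + nodalZ k ^ q * c) :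
    ∑ n ∈ Finset.range (2 * q), nodalDim q n ≤ Module.finrank k (S ⧸ J) := by
  have hq0 : 0 < q := hq ▸ pow_pos (Fact.out : p.Prime).pos r
  have hφ' (F : k[X][X]) (hF : F ∈ φ.range) (n : ℕ) : F.coeff n ∈ nodalComponent k n :=
    adjoin_le_nodalSubalgebra (hφ ▸ hF) n
  let c (n : ℕ) : S →ₗ[k] nodalComponent k n :=
    ((((lcoeff k[X] n).restrictScalars k).comp φ.toLinearMap).codRestrict _
      fun F => hφ' _ ⟨F, rfl⟩ n)
  let ψ : S →ₗ[k] ((n : Fin (2 * q)) → nodalComponent k n ⧸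
      (nodalPowers k q n).submoduleOf (nodalComponent k n)) :=
    LinearMap.pi fun n => (mkQ _).comp (c n)
  have hψ : Function.Surjective ψ := by
    intro g
    choose g' hg' using fun n => mkQ_surjective _ (g n)
    have hmon (n : Fin (2 * q)) : ∃ F, φ F = monomial n (g' n : k[X]) := by
      have := monomial_mem_adjoin (g' n).2
      rwa [← hφ] at this
    choose F hF using hmon
    refine ⟨∑ n, F n, funext fun n => ?_⟩
    rw [← hg']
    change mkQ _ (c n _) = _
    congr 1
    ext1
    change (φ (∑ n, F n)).coeff n = _
    simp only [map_sum, hF, finsetSum_coeff, coeff_monomial, Fin.val_inj]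
    simp
  have hker (F : S) (hF : F ∈ J) : ψ F = 0 := by
    obtain ⟨a, ha, b, hb, d, hd, h⟩ := hJ F hF
    refine funext fun n => (Submodule.Quotient.mk_eq_zero _).2 ?_
    change (φ F).coeff n ∈ nodalPowers k q n
    rw [h, coeff_add, coeff_add]
    have hcoeff (g : k[X]) (G : k[X][X]) : (monomial q g * G).coeff n =
        if (n : ℕ) < q then 0 else g * G.coeff (n - q) := by
      rw [← C_mul_X_pow_eq_monomial, mul_assoc, coeff_C_mul, coeff_X_pow_mul']
      split_ifs <;> first | omega | simp
    have hs : nodalS k ^ q = monomial q (X ^ (2 * q)) := by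
      rw [nodalS, monomial_pow, one_mul, ← pow_mul]
    have ht : nodalT k ^ q = monomial q (X ^ q) := by
      rw [nodalT, monomial_pow, one_mul]
    have hz : nodalZ k ^ q = monomial q (1 + X ^ (3 * q)) := by
      rw [nodalZ, monomial_pow, one_mul, hq, add_pow_char_pow, one_pow, ← pow_mul]
    rw [hs, ht, hz, hcoeff, hcoeff, hcoeff, nodalPowers]
    split_ifs
    · simp
    · exact add_mem_sup (add_mem_sup ⟨_, hφ' a ha _, rfl⟩ ⟨_, hφ' b hb _, rfl⟩)
        ⟨_, hφ' d hd _, rfl⟩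
  refine le_trans ?_ (sum_finrank_le_finrank_quotient J (E := fun n : Fin (2 * q) =>
    nodalComponent k n ⧸ (nodalPowers k q n).submoduleOf (nodalComponent k n)) ψ hψ hker)
  rw [← Fin.sum_univ_eq_sum_range]
  exact Finset.sum_le_sum fun n _ => nodalDim_le_finrank q n hq0

end LowerBound

open MvPolynomial

/-- **Hilbert-Kunz function of a nodal plane cubic.**
Let `k` be algebraically closed of characteristic `p`, let `Y² + a₁Y − a₂` split with two
distinct roots in `k`, and let `f = z(y² + a₁xy − a₂x²) − x³`.  Then for every `q = p^n`,
`dim_k k[x,y,z]/(f, x^q, y^q, z^q)` equals `(7q² − q − 3)/3` if `q ≢ 2 (mod 3)` and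
`(7q² − q − 5)/3` if `q ≡ 2 (mod 3)`. -/
theorem hilbert_kunz_nodal_cubic
    (k : Type*) [Field k] [IsAlgClosed k] (p : ℕ) [Fact p.Prime] [CharP k p]
    (a₁ a₂ : k) (u v : k) (huv : u ≠ v)
    (hQ : (Polynomial.X ^ 2 + Polynomial.C a₁ * Polynomial.X - Polynomial.C a₂ : Polynomial k) =
      (Polynomial.X - Polynomial.C u) * (Polynomial.X - Polynomial.C v))
    (f : MvPolynomial (Fin 3) k)
    (hf : f = X 2 * ((X 1) ^ 2 + C a₁ * X 0 * X 1 - C a₂ * (X 0) ^ 2) - (X 0) ^ 3)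
    (n : ℕ) :
    3 * Module.finrank k (MvPolynomial (Fin 3) k ⧸
        Ideal.span {f, X 0 ^ p ^ n, X 1 ^ p ^ n, X 2 ^ p ^ n}) =
      if p ^ n % 3 = 2 then 7 * (p ^ n) ^ 2 - p ^ n - 5
      else 7 * (p ^ n) ^ 2 - p ^ n - 3 := by
  have hq0 : 0 < p ^ n := pow_pos (Fact.out : p.Prime).pos n
  have h0 : a₂ = -(u * v) := by
    have := congrArg (Polynomial.eval 0) hQ
    simp only [Polynomial.eval_add, Polynomial.eval_sub, Polynomial.eval_mul, Polynomial.eval_pow,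
      Polynomial.eval_X, Polynomial.eval_C] at this
    linear_combination -this
  have h1 : a₁ = -(u + v) := by
    have := congrArg (Polynomial.eval 1) hQ
    simp only [Polynomial.eval_add, Polynomial.eval_sub, Polynomial.eval_mul, Polynomial.eval_pow,
      Polynomial.eval_X, Polynomial.eval_C] at this
    linear_combination this + h0
  obtain ⟨d, hd⟩ : ∃ d, (v - u) * d = 1 := ⟨_, mul_inv_cancel₀ (sub_ne_zero.2 huv.symm)⟩
  have hdC : (C v - C u) * C d = (1 : MvPolynomial (Fin 3) k) := by
    rw [← C_sub, ← C_mul, hd, C_1]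
  set J := Ideal.span {f, X 0 ^ p ^ n, X 1 ^ p ^ n, X 2 ^ p ^ n} with hJ
  have hfJ : f ∈ J := Ideal.subset_span (by simp)
  have hXJ (i : Fin 3) : (X i : MvPolynomial (Fin 3) k) ^ p ^ n ∈ J :=
    Ideal.subset_span (by fin_cases i <;> simp)
  have linJ (i j : Fin 3) (b c : k) : (C b * X i + C c * X j) ^ p ^ n ∈ J := by
    rw [add_pow_char_pow, mul_pow, mul_pow]
    exact add_mem (J.mul_mem_left _ (hXJ i)) (J.mul_mem_left _ (hXJ j))
  obtain ⟨s, hs⟩ : ∃ s : MvPolynomial (Fin 3) k, s = C 1 * X 1 + C (-u) * X 0 := ⟨_, rfl⟩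
  obtain ⟨t, ht⟩ : ∃ t : MvPolynomial (Fin 3) k, t = C v * X 0 + C (-1) * X 1 := ⟨_, rfl⟩
  obtain ⟨z, hz⟩ : ∃ z : MvPolynomial (Fin 3) k,
    z = C (-(v - u) ^ 3) * X 2 + C (-(3 * (v - u))) * X 0 := ⟨_, rfl⟩
  have hsJ : s ^ p ^ n ∈ J := hs ▸ linJ _ _ _ _
  have htJ : t ^ p ^ n ∈ J := ht ▸ linJ _ _ _ _
  have hzJ : z ^ p ^ n ∈ J := hz ▸ linJ _ _ _ _
  have h3 : C (3 : k) = (3 : MvPolynomial (Fin 3) k) := map_ofNat C 3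
  simp only [C_neg, C_1, one_mul, C_mul, C_pow, C_sub, neg_mul, h3] at hs ht hz
  have hst : (X 0 : MvPolynomial (Fin 3) k) = C d * (s + t) := by
    rw [hs, ht]; linear_combination -X 0 * hdC
  have hX1 : (X 1 : MvPolynomial (Fin 3) k) = s + C u * X 0 := by rw [hs]; ring
  have hX2 : (X 2 : MvPolynomial (Fin 3) k) = -C d ^ 3 * (z + 3 * (s + t)) := by
    rw [hs, ht, hz]
    linear_combination (-X 2) * ((C v - C u) ^ 2 * C d ^ 2 + (C v - C u) * C d + 1) * hdC
  have hstz : s * t * z - (s ^ 3 + t ^ 3) = (C v - C u) ^ 3 * f := by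
    rw [hs, ht, hz, hf, h0, h1]
    simp only [C_neg, C_mul, C_add]
    ring
  have htop : Algebra.adjoin k {s, t, z} = ⊤ := by
    set W := Algebra.adjoin k {s, t, z}
    have hC (a : k) : C a ∈ W := W.algebraMap_mem a
    have hsW : s ∈ W := Algebra.subset_adjoin (by simp)
    have hstW : s + t ∈ W := add_mem hsW (Algebra.subset_adjoin (by simp))
    have hX0W : X 0 ∈ W := hst ▸ mul_mem (hC d) hstW
    have hX1W : X 1 ∈ W := hX1 ▸ add_mem hsW (mul_mem (hC u) hX0W)
    have hX2W : X 2 ∈ W := hX2 ▸ mul_mem (neg_mem (pow_mem (hC d) 3))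
      (add_mem (Algebra.subset_adjoin (by simp)) (mul_mem (ofNat_mem W 3) hstW))
    rw [eq_top_iff, ← adjoin_range_X, Algebra.adjoin_le_iff]
    rintro _ ⟨i, rfl⟩
    fin_cases i
    exacts [hX0W, hX1W, hX2W]
  obtain ⟨_, hle⟩ := nodal_finrank_le (k := k) (A := MvPolynomial (Fin 3) k ⧸ J) (p := p)
    (s := Ideal.Quotient.mkₐ k J s) (t := Ideal.Quotient.mkₐ k J t)
    (z := Ideal.Quotient.mkₐ k J z) (r := n) rfl
    (by
      rw [← sub_eq_zero, ← map_mul, ← map_mul, ← map_pow, ← map_pow, ← map_add, ← map_sub, hstz]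
      exact Ideal.Quotient.eq_zero_iff_mem.2 (J.mul_mem_left _ hfJ))
    (by rw [← map_pow]; exact Ideal.Quotient.eq_zero_iff_mem.2 hsJ)
    (by rw [← map_pow]; exact Ideal.Quotient.eq_zero_iff_mem.2 htJ)
    (by rw [← map_pow]; exact Ideal.Quotient.eq_zero_iff_mem.2 hzJ)
    (by
      have := congrArg (Subalgebra.map (Ideal.Quotient.mkₐ k J)) htop
      rw [AlgHom.map_adjoin, Algebra.map_top,
        (AlgHom.range_eq_top _).2 (Ideal.Quotient.mkₐ_surjective k J)] at this
      simpa only [Set.image_insert_eq, Set.image_singleton] using this)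
  let x : Fin 3 → Polynomial (Polynomial k) :=
    ![algebraMap k _ d * (nodalS k + nodalT k),
      nodalS k + algebraMap k _ u * (algebraMap k _ d * (nodalS k + nodalT k)),
      -algebraMap k _ d ^ 3 * (nodalZ k + 3 * (nodalS k + nodalT k))]
  have hdB : (algebraMap k (Polynomial (Polynomial k)) v - algebraMap k _ u) * algebraMap k _ d =
      1 := by rw [← map_sub, ← map_mul, hd, map_one]
  have φC (a : k) : aeval (R := k) x (C a) = algebraMap k _ a := aeval_C x a
  have φ0 : aeval (R := k) x (X 0) = algebraMap k _ d * (nodalS k + nodalT k) := aeval_X x 0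
  have φ1 : aeval (R := k) x (X 1) = nodalS k + algebraMap k _ u *
      (algebraMap k _ d * (nodalS k + nodalT k)) := aeval_X x 1
  have φ2 : aeval (R := k) x (X 2) =
      -algebraMap k _ d ^ 3 * (nodalZ k + 3 * (nodalS k + nodalT k)) := aeval_X x 2
  generalize aeval (R := k) x = φ at φC φ0 φ1 φ2
  have φs : φ s = nodalS k := by
    rw [hs, map_add, map_neg, map_mul, φC, φ0, φ1]
    ring
  have φt : φ t = nodalT k := by
    rw [ht, map_add, map_neg, map_mul, φC, φ0, φ1]
    linear_combination (nodalS k + nodalT k) * hdB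
  have φz : φ z = nodalZ k := by
    rw [hz]
    simp only [map_add, map_sub, map_neg, map_mul, map_pow, map_ofNat, φC, φ0, φ2]
    set D := algebraMap k (Polynomial (Polynomial k)) v - algebraMap k _ u
    set e := algebraMap k (Polynomial (Polynomial k)) d
    linear_combination ((nodalZ k + 3 * (nodalS k + nodalT k)) * (D ^ 2 * e ^ 2 + D * e + 1) -
      3 * (nodalS k + nodalT k)) * hdB
  have φf : φ f = 0 := by
    have hf' : f = C d ^ 3 * (s * t * z - (s ^ 3 + t ^ 3)) := by
      rw [hstz]
      linear_combination -f * ((C v - C u) ^ 2 * C d ^ 2 + (C v - C u) * C d + 1) * hdC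
    rw [hf', map_mul, map_sub, map_add, map_mul, map_mul, map_pow φ s, map_pow φ t, φs, φt, φz,
      nodal_equation, sub_self, mul_zero]
  have hrange : φ.range = Algebra.adjoin k {nodalS k, nodalT k, nodalZ k} := by
    rw [← Algebra.map_top, ← htop, AlgHom.map_adjoin, Set.image_insert_eq, Set.image_insert_eq,
      Set.image_singleton, φs, φt, φz]
  set K := Ideal.span {f, s ^ p ^ n, t ^ p ^ n, z ^ p ^ n}
  have hsK : s ^ p ^ n ∈ K := Ideal.subset_span (by simp)
  have htK : t ^ p ^ n ∈ K := Ideal.subset_span (by simp)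
  have hzK : z ^ p ^ n ∈ K := Ideal.subset_span (by simp)
  have hstK : (s + t) ^ p ^ n ∈ K := by
    rw [add_pow_char_pow]
    exact add_mem hsK htK
  have hx0 : X 0 ^ p ^ n ∈ K := by
    rw [hst, mul_pow]
    exact K.mul_mem_left _ hstK
  have hJK : J ≤ K := by
    rw [hJ, Ideal.span_le]
    rintro _ (rfl | rfl | rfl | rfl)
    · exact Ideal.subset_span (by simp)
    · exact hx0
    · rw [hX1, add_pow_char_pow, mul_pow]
      exact add_mem hsK (K.mul_mem_left _ hx0)
    · rw [hX2, mul_pow, add_pow_char_pow, mul_pow]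
      exact K.mul_mem_left _ (add_mem hzK (K.mul_mem_left _ hstK))
  have hge := sum_nodalDim_le_finrank (p := p) (r := n) rfl J φ hrange fun F hF ↦ by
    obtain ⟨a, _, ha, rfl⟩ := Ideal.mem_span_insert.1 (hJK hF)
    obtain ⟨b, _, hb, rfl⟩ := Ideal.mem_span_insert.1 ha
    obtain ⟨c, _, hc, rfl⟩ := Ideal.mem_span_insert.1 hb
    obtain ⟨e, rfl⟩ := Ideal.mem_span_singleton'.1 hc
    refine ⟨φ b, ⟨b, rfl⟩, φ c, ⟨c, rfl⟩, φ e, ⟨e, rfl⟩, ?_⟩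
    simp only [map_add, map_mul, map_pow, φf, φs, φt, φz]
    ring
  rw [← three_mul_sum_nodalDim _ hq0]
  exact congrArg _ (le_antisymm hle hge)
end
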